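/- For every Δ ∈ ℕ and δ > 0 there exist C = C(Δ, δ) > 0 and n₀ such that the following holds for all n ≥ n₀. Let G be an n-vertex graph with minimum degree δ(G) ≥ (1/2 + δ)n, and let T be an n-vertex tree with maximum degree Δ(T) ≤ Δ. Color the edges of G independently and uniformly at random with q ≥ n − 1 colors, and let G_{C log n / n} be the spanning subgraph of G in which each edge of G is retained independently with probability C log n / n. Then with probability 1 − o_{n→∞}(1) (i.e. with probability tending to 1 as n → ∞, uniformly over all such G and T), G_{C log n / n} contains a rainbow copy of T. -/

import Mathlib

open Finset SimpleGraph
open scoped Classical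

/-- The probability that, when the edges of `G` are colored independently and uniformly at
random with `qc` colors and each edge of `G` is retained independently with probability `p`,
the retained subgraph contains a rainbow copy of `T`: an injective map `f` on the vertices
such that every edge of `T` maps to a retained edge and distinct image edges receive
pairwise distinct colors. -/
noncomputable def rainbowTreeProb (n qc : ℕ) (p : ℝ) (G T : SimpleGraph (Fin n))
    [DecidableRel G.Adj] [DecidableRel T.Adj] : ℝ :=
  ∑ R ∈ G.edgeFinset.powerset,
    ∑ c : Sym2 (Fin n) → Fin qc,
      p ^ R.card * (1 - p) ^ (G.edgeFinset.card - R.card) *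
        ((qc : ℝ) ^ Fintype.card (Sym2 (Fin n)))⁻¹ *
        (if ∃ f : Fin n → Fin n, Function.Injective f ∧
            (∀ e ∈ T.edgeFinset, Sym2.map f e ∈ R) ∧
            (∀ e₁ ∈ T.edgeFinset, ∀ e₂ ∈ T.edgeFinset,
              c (Sym2.map f e₁) = c (Sym2.map f e₂) → Sym2.map f e₁ = Sym2.map f e₂)
          then 1 else 0)

/-- The term of index `k` is the largest one in the binomial expansion of `(k + l) ^ (k + l)`. -/
theorem choose_mul_pow_le_mode (k l j : ℕ) (hj : j ≤ k + l) :
    (k + l).choose j * k ^ j * l ^ (k + l - j) ≤ (k + l).choose k * k ^ k * l ^ l := by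
  have key : ∀ j, j < k + l →
      (k + l).choose (j + 1) * k ^ (j + 1) * l ^ (k + l - (j + 1)) * ((j + 1) * l) =
        (k + l).choose j * k ^ j * l ^ (k + l - j) * ((k + l - j) * k) := by
    intro j hj
    have h1 := Nat.choose_succ_right_eq (k + l) j
    have h2 : k + l - j = (k + l - (j + 1)) + 1 := by omega
    calc _ = ((k + l).choose (j + 1) * (j + 1)) * k ^ (j + 1) * (l ^ (k + l - (j + 1)) * l) := by
            ring
      _ = _ := by
            rw [h1, ← pow_succ, ← h2]; ring
  rcases le_total k j with h | h
  · induction j, h using Nat.le_induction with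
    | base => simp
    | succ j hkj ih =>
      refine le_trans ?_ (ih (by omega))
      rcases Nat.eq_zero_or_pos l with hl | hl
      · omega
      refine Nat.le_of_mul_le_mul_right ?_ (Nat.mul_pos j.succ_pos hl)
      rw [key j (by omega)]
      exact Nat.mul_le_mul_left _ (by rw [mul_comm]; exact Nat.mul_le_mul (by omega) (by omega))
  · induction h using Nat.decreasingInduction with
    | self => simp
    | of_succ j hkj ih =>
      refine le_trans ?_ (ih (by omega))
      have hk : 0 < k := by omega
      refine Nat.le_of_mul_le_mul_right ?_ (Nat.mul_pos (show 0 < k + l - j by omega) hk)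
      rw [← key j (by omega)]
      exact Nat.mul_le_mul_left _ (by rw [mul_comm]; exact Nat.mul_le_mul (by omega) (by omega))

theorem add_pow_le_mode (k l : ℕ) :
    (k + l) ^ (k + l) ≤ (k + l + 1) * ((k + l).choose k * k ^ k * l ^ l) := by
  rw [add_pow]
  refine (sum_le_card_nsmul _ _ ((k + l).choose k * k ^ k * l ^ l) ?_).trans ?_
  · intro j hj
    have := choose_mul_pow_le_mode k l j (by simp at hj; omega)
    calc _ = (k + l).choose j * k ^ j * l ^ (k + l - j) := by push_cast; ring
      _ ≤ _ := this
  · simp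

theorem exp_neg_le_quadratic {t : ℝ} (ht : 0 ≤ t) : Real.exp (-t) ≤ 1 - t + t ^ 2 / 2 := by
  have h1 := Real.quadratic_le_exp_of_nonneg ht
  have h0 : 0 < 1 + t + t ^ 2 / 2 := by positivity
  rw [Real.exp_neg, inv_le_comm₀ (Real.exp_pos t) (by nlinarith [sq_nonneg (t - 1)])]
  refine le_trans ?_ h1
  rw [inv_le_iff_one_le_mul₀ (by nlinarith [sq_nonneg (t - 1)])]
  nlinarith [sq_nonneg (t ^ 2)]

/-- The lower tail of the hypergeometric distribution, in counting form. -/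
theorem card_filter_inter_lt_le {α : Type*} (U A : Finset α) (hA : A ⊆ U) (k : ℕ)
    (hk : k ≤ #U) (t : ℝ) (ht : 0 ≤ t) :
    (#{W ∈ powersetCard k U | (#(A ∩ W) : ℝ) < ((#A : ℝ) / #U - t) * k} : ℝ) ≤
      (#U + 1) * Real.exp (-(t ^ 2 * k / 2)) * (#U).choose k := by
  obtain ⟨l, hl⟩ := Nat.exists_eq_add_of_le hk
  set m := #U with hm
  set a := #A with ha
  rcases Nat.eq_zero_or_pos m with h0 | hmpos
  · have hk0 : k = 0 := by omega
    subst hk0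
    rw [h0]
    simpa using (card_filter_le {∅} (fun x => (#(A ∩ x) : ℝ) < 0)).trans (by simp)
  have ham : a ≤ m := card_le_card hA
  have hmR : (0 : ℝ) < m := by exact_mod_cast hmpos
  set τ := Real.exp (-t) with hτ
  have hτ0 : 0 < τ := Real.exp_pos _
  have hmode : ((m : ℝ)) ^ m ≤ (m + 1) * (m.choose k * (k : ℝ) ^ k * (l : ℝ) ^ l) := by
    have := add_pow_le_mode k l
    rw [← hl] at this
    exact_mod_cast this
  have hgen : ((k : ℝ) * τ + l) ^ a * ((k : ℝ) + l) ^ (m - a) =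
      ∑ W ∈ U.powerset, (k : ℝ) ^ #W * (l : ℝ) ^ (m - #W) * τ ^ #(A ∩ W) := by
    have h1 : ∏ i ∈ U, ((k : ℝ) * (if i ∈ A then τ else 1) + l) =
        ((k : ℝ) * τ + l) ^ a * ((k : ℝ) + l) ^ (m - a) := by
      rw [← prod_sdiff hA, mul_comm]
      congr 1
      · rw [ha, ← prod_const]
        exact prod_congr rfl fun i hi => by simp [hi]
      · rw [hm, ha, ← card_sdiff_of_subset hA, ← prod_const]
        exact prod_congr rfl fun i hi => by simp [(mem_sdiff.1 hi).2]
    rw [← h1, prod_add]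
    refine sum_congr rfl fun W hW => ?_
    have hWU := mem_powerset.1 hW
    rw [prod_mul_distrib, prod_const, prod_const, card_sdiff_of_subset hWU, ← hm,
      prod_ite, prod_const, prod_const_one, mul_one]
    have : W.filter (· ∈ A) = A ∩ W := by ext; simp [and_comm]
    rw [this]; ring
  have hS : (k : ℝ) ^ k * (l : ℝ) ^ l * ∑ W ∈ powersetCard k U, τ ^ #(A ∩ W) ≤
      ((k : ℝ) * τ + l) ^ a * ((k : ℝ) + l) ^ (m - a) := by
    rw [hgen, mul_sum]
    calc _ = ∑ W ∈ powersetCard k U, (k : ℝ) ^ #W * (l : ℝ) ^ (m - #W) * τ ^ #(A ∩ W) := by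
          refine sum_congr rfl fun W hW => ?_
          rw [(mem_powersetCard.1 hW).2, hl, Nat.add_sub_cancel_left]
      _ ≤ _ := sum_le_sum_of_subset_of_nonneg
          (fun W hW => mem_powerset.2 (mem_powersetCard.1 hW).1) fun _ _ _ => by positivity
  have hklpos : (0 : ℝ) < (k : ℝ) ^ k * (l : ℝ) ^ l := by
    have : ∀ i : ℕ, (0 : ℝ) < (i : ℝ) ^ i := by
      intro i
      rcases Nat.eq_zero_or_pos i with h | h
      · simp [h]
      · positivity
    exact mul_pos (this k) (this l)
  have hkl : (k : ℝ) + l = m := by exact_mod_cast hl.symm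
  have hbase : ((k : ℝ) * τ + l) ≤ m * Real.exp (-((k : ℝ) / m * (t - t ^ 2 / 2))) := by
    have h1 := exp_neg_le_quadratic ht
    have h2 := Real.add_one_le_exp (-((k : ℝ) / m * (t - t ^ 2 / 2)))
    calc ((k : ℝ) * τ + l) ≤ k * (1 - t + t ^ 2 / 2) + l := by gcongr
      _ = m * (-((k : ℝ) / m * (t - t ^ 2 / 2)) + 1) := by
          field_simp; rw [← hkl]; ring
      _ ≤ _ := by gcongr
  have hE : ∑ W ∈ powersetCard k U, τ ^ #(A ∩ W) ≤
      (m + 1) * m.choose k * Real.exp (-((k : ℝ) / m * (t - t ^ 2 / 2))) ^ a := by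
    refine le_of_mul_le_mul_left ?_ hklpos
    refine hS.trans ?_
    calc ((k : ℝ) * τ + l) ^ a * ((k : ℝ) + l) ^ (m - a)
        ≤ (m * Real.exp (-((k : ℝ) / m * (t - t ^ 2 / 2)))) ^ a * (m : ℝ) ^ (m - a) := by
          rw [hkl]; gcongr
      _ = (m : ℝ) ^ m * Real.exp (-((k : ℝ) / m * (t - t ^ 2 / 2))) ^ a := by
          rw [mul_pow, mul_right_comm, ← pow_add, Nat.add_sub_cancel' ham]
      _ ≤ ((m + 1) * (m.choose k * (k : ℝ) ^ k * (l : ℝ) ^ l)) *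
            Real.exp (-((k : ℝ) / m * (t - t ^ 2 / 2))) ^ a := by gcongr
      _ = _ := by ring
  have hbad : (#{W ∈ powersetCard k U | (#(A ∩ W) : ℝ) < ((a : ℝ) / m - t) * k} : ℝ) *
      Real.exp (-t * (((a : ℝ) / m - t) * k)) ≤ ∑ W ∈ powersetCard k U, τ ^ #(A ∩ W) := by
    rw [← nsmul_eq_mul]
    refine (card_nsmul_le_sum _ _ _ fun W hW => ?_).trans
      (sum_le_sum_of_subset_of_nonneg (filter_subset _ _) fun _ _ _ => by positivity)
    rw [hτ, ← Real.exp_nat_mul]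
    refine Real.exp_le_exp.2 ?_
    have := (mem_filter.1 hW).2
    nlinarith
  rw [← Real.exp_nat_mul] at hE
  refine le_of_mul_le_mul_right (hbad.trans (hE.trans ?_))
    (Real.exp_pos (-t * (((a : ℝ) / m - t) * k)))
  have : Real.exp (a * -((k : ℝ) / m * (t - t ^ 2 / 2))) ≤
      Real.exp (-(t ^ 2 * k / 2)) * Real.exp (-t * (((a : ℝ) / m - t) * k)) := by
    rw [← Real.exp_add]
    refine Real.exp_le_exp.2 ?_
    have h3 : (a : ℝ) / m ≤ 1 := by rw [div_le_one hmR]; exact_mod_cast ham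
    have h4 : (a : ℝ) * -((k : ℝ) / m * (t - t ^ 2 / 2)) =
      -((a : ℝ) / m * k * (t - t ^ 2 / 2)) := by ring
    rw [h4]
    have h5 : 0 ≤ (1 - (a : ℝ) / m) * (k * t ^ 2) :=
      mul_nonneg (by linarith) (by positivity)
    nlinarith
  calc ((m : ℝ) + 1) * m.choose k * Real.exp (a * -((k : ℝ) / m * (t - t ^ 2 / 2)))
      ≤ (m + 1) * m.choose k *
        (Real.exp (-(t ^ 2 * k / 2)) * Real.exp (-t * (((a : ℝ) / m - t) * k))) := by gcongr
    _ = _ := by ring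

section BinomialSubset

variable {X : Type*}

/-- The weight of `W` in the `p`-random subset of `U`. -/
noncomputable def subsetWeight (p : ℝ) (U W : Finset X) : ℝ := p ^ #W * (1 - p) ^ #(U \ W)

/-- The expectation of `F` at the `p`-random subset of `U`. -/
noncomputable def subsetExp (p : ℝ) (U : Finset X) (F : Finset X → ℝ) : ℝ :=
  ∑ W ∈ U.powerset, subsetWeight p U W * F W

theorem subsetWeight_nonneg {p : ℝ} (h0 : 0 ≤ p) (h1 : p ≤ 1) (U W : Finset X) :
    0 ≤ subsetWeight p U W :=
  mul_nonneg (pow_nonneg h0 _) (pow_nonneg (by linarith) _)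

@[simp] theorem subsetExp_empty (p : ℝ) (F : Finset X → ℝ) : subsetExp p ∅ F = F ∅ := by
  simp [subsetExp, subsetWeight]

theorem subsetExp_insert (p : ℝ) {U : Finset X} {a : X} (ha : a ∉ U) (F : Finset X → ℝ) :
    subsetExp p (insert a U) F =
      (1 - p) * subsetExp p U F + p * subsetExp p U fun W => F (insert a W) := by
  unfold subsetExp subsetWeight
  rw [sum_powerset_insert ha, mul_sum, mul_sum]
  congr 1 <;> refine sum_congr rfl fun W hW => ?_
  · have haW : a ∉ W := fun h => ha (mem_powerset.1 hW h)
    rw [insert_sdiff_of_notMem _ haW, card_insert_of_notMem (by simp [ha])]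
    ring
  · have haW : a ∉ W := fun h => ha (mem_powerset.1 hW h)
    rw [card_insert_of_notMem haW, insert_sdiff_insert, sdiff_insert_of_notMem ha]
    ring

theorem subsetExp_const (p : ℝ) (U : Finset X) (x : ℝ) : subsetExp p U (fun _ => x) = x := by
  induction U using Finset.induction_on with
  | empty => simp
  | insert a U ha ih => rw [subsetExp_insert p ha, ih]; ring

theorem subsetExp_add (p : ℝ) (U : Finset X) (F F' : Finset X → ℝ) :
    subsetExp p U (fun W => F W + F' W) = subsetExp p U F + subsetExp p U F' := by
  simp only [subsetExp, mul_add, sum_add_distrib]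

theorem subsetExp_const_mul (p : ℝ) (U : Finset X) (x : ℝ) (F : Finset X → ℝ) :
    subsetExp p U (fun W => x * F W) = x * subsetExp p U F := by
  simp only [subsetExp, mul_sum]
  exact sum_congr rfl fun W _ => by ring

theorem subsetExp_sum {ι : Type*} (p : ℝ) (U : Finset X) (s : Finset ι)
    (F : ι → Finset X → ℝ) :
    subsetExp p U (fun W => ∑ i ∈ s, F i W) = ∑ i ∈ s, subsetExp p U (F i) := by
  simp only [subsetExp, mul_sum]
  exact sum_comm

theorem subsetExp_mono {p : ℝ} (h0 : 0 ≤ p) (h1 : p ≤ 1) (U : Finset X)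
    {F F' : Finset X → ℝ} (h : ∀ W ⊆ U, F W ≤ F' W) : subsetExp p U F ≤ subsetExp p U F' :=
  sum_le_sum fun W hW =>
    mul_le_mul_of_nonneg_left (h W (mem_powerset.1 hW)) (subsetWeight_nonneg h0 h1 U W)

/-- The union of independent binomial random subsets is a binomial random subset. -/
theorem subsetExp_union (p q : ℝ) (U : Finset X) (F : Finset X → ℝ) :
    subsetExp p U (fun W => subsetExp q U fun W' => F (W ∪ W')) =
      subsetExp (1 - (1 - p) * (1 - q)) U F := by
  induction U using Finset.induction_on generalizing F with
  | empty => simp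
  | insert a U ha ih =>
    have h := ih fun W => F (insert a W)
    rw [subsetExp_insert _ ha, subsetExp_insert _ ha, ← ih F, ← h]
    simp only [subsetExp_insert q ha, subsetExp_add, subsetExp_const_mul, insert_union,
      union_insert, insert_idem]
    ring

/-- Expectations of increasing functions are increasing in the density. -/
theorem subsetExp_mono_density {p q : ℝ} (h0 : 0 ≤ p) (hpq : p ≤ q) (h1 : q ≤ 1)
    (U : Finset X) (F : Finset X → ℝ) (hF : Monotone F) :
    subsetExp p U F ≤ subsetExp q U F := by
  induction U using Finset.induction_on generalizing F with
  | empty => simp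
  | insert a U ha ih =>
    rw [subsetExp_insert _ ha, subsetExp_insert _ ha]
    have h2 := ih F hF
    have h3 := ih (fun W => F (insert a W)) fun W W' h => hF (insert_subset_insert a h)
    have h4 : subsetExp q U F ≤ subsetExp q U fun W => F (insert a W) :=
      subsetExp_mono (h0.trans hpq) h1 U fun W _ => hF (subset_insert a W)
    nlinarith [mul_le_mul_of_nonneg_left h2 (show 0 ≤ 1 - p by linarith),
      mul_le_mul_of_nonneg_left h3 h0, mul_nonneg (sub_nonneg.2 hpq) (sub_nonneg.2 h4)]

theorem subsetWeight_le_union {p : ℝ} (h0 : 0 < p) (h1 : p ≤ 1) {U W Z : Finset X}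
    (hWZ : Disjoint W Z) :
    subsetWeight p U W ≤ subsetWeight p U (W ∪ Z) * (1 / p) ^ #Z := by
  unfold subsetWeight
  have h2 : (1 - p) ^ #(U \ W) ≤ (1 - p) ^ #(U \ (W ∪ Z)) :=
    pow_le_pow_of_le_one (by linarith) (by linarith)
      (card_le_card (sdiff_subset_sdiff le_rfl subset_union_left))
  calc p ^ #W * (1 - p) ^ #(U \ W) ≤ p ^ #W * (1 - p) ^ #(U \ (W ∪ Z)) := by gcongr
    _ = _ := by
      rw [card_union_of_disjoint hWZ, pow_add, one_div, inv_pow]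
      field_simp

/-- The probability that the `p`-random subset of `U` contains a member of `ℋ`. -/
noncomputable def hitProb (p : ℝ) (U : Finset X) (ℋ : Set (Finset X)) : ℝ :=
  subsetExp p U fun W => if ∃ S ∈ ℋ, S ⊆ W then 1 else 0

variable {Ω : Type*} [Fintype Ω]

/-- The `μ`-measure of the members of the random family `H` that contain a member of `ℋ`. -/
noncomputable def coverMeasure (μ : Ω → ℝ) (H : Ω → Finset X) (ℋ : Set (Finset X)) : ℝ :=
  ∑ ω, μ ω * if ∃ S ∈ ℋ, S ⊆ H ω then 1 else 0

/-- The measure `μ` on the family `H` of sets is `ρ`-spread. -/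
def IsSpread (μ : Ω → ℝ) (H : Ω → Finset X) (ρ : ℝ) : Prop :=
  ∀ S, ∑ ω with S ⊆ H ω, μ ω ≤ ρ ^ #S

/-- The sets of size less than `t` that complete `W` to a superset of a member of `ℋ`. -/
def smallFragments (ℋ : Set (Finset X)) (t : ℕ) (W : Finset X) : Set (Finset X) :=
  {Z | #Z < t ∧ ∃ S ∈ ℋ, S ⊆ W ∪ Z}

/-- The minimal sets of size at least `t` that complete `W` to a superset of a member of `ℋ`. -/
def largeFragments (U : Finset X) (ℋ : Set (Finset X)) (t : ℕ) (W : Finset X) :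
    Set (Finset X) :=
  {Z | Z ⊆ U ∧ Disjoint W Z ∧ t ≤ #Z ∧ (∃ S ∈ ℋ, S ⊆ W ∪ Z) ∧ ∀ S ∈ ℋ, S ⊆ W ∪ Z → Z ⊆ S}

theorem coverMeasure_le_fragments {μ : Ω → ℝ} (hμ : ∀ ω, 0 ≤ μ ω) {H : Ω → Finset X}
    {U : Finset X} (hH : ∀ ω, H ω ⊆ U) (ℋ : Set (Finset X)) (t : ℕ) (W : Finset X) :
    coverMeasure μ H ℋ ≤ coverMeasure μ H (smallFragments ℋ t W) +
      coverMeasure μ H (largeFragments U ℋ t W) := by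
  unfold coverMeasure
  rw [← sum_add_distrib]
  refine sum_le_sum fun ω _ => ?_
  rw [← mul_add]
  refine mul_le_mul_of_nonneg_left ?_ (hμ ω)
  by_cases h : ∃ S ∈ ℋ, S ⊆ H ω
  · suffices (∃ S ∈ smallFragments ℋ t W, S ⊆ H ω) ∨
        ∃ S ∈ largeFragments U ℋ t W, S ⊆ H ω by
      rcases this with h' | h' <;> rw [if_pos h, if_pos h']
      · split_ifs <;> norm_num
      · split_ifs <;> norm_num
    obtain ⟨S, hS, hSH⟩ := h
    have hex : ∃ m, ∃ S' ∈ ℋ, S' ⊆ W ∪ S ∧ #(S' \ W) = m :=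
      ⟨_, S, hS, subset_union_right, rfl⟩
    obtain ⟨S', hS', hS'W, hm⟩ := Nat.find_spec hex
    have hmin := fun m (hm' : m < Nat.find hex) => Nat.find_min hex hm'
    rw [← hm] at hmin
    have hZ : S' \ W ⊆ S := by
      intro x hx
      have := hS'W (mem_sdiff.1 hx).1
      exact (mem_union.1 this).resolve_left (mem_sdiff.1 hx).2
    have hcov : S' ⊆ W ∪ S' \ W := by simp
    by_cases ht : #(S' \ W) < t
    · exact Or.inl ⟨S' \ W, ⟨ht, S', hS', hcov⟩, hZ.trans hSH⟩
    · refine Or.inr ⟨S' \ W, ⟨(hZ.trans hSH).trans (hH ω), disjoint_sdiff, not_lt.1 ht,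
        ⟨S', hS', hcov⟩, fun S'' hS'' hS''W => ?_⟩, hZ.trans hSH⟩
      have h1 : S'' \ W ⊆ S' \ W := by
        intro x hx
        exact (mem_union.1 (hS''W (mem_sdiff.1 hx).1)).resolve_left (mem_sdiff.1 hx).2
      have h2 : #(S' \ W) ≤ #(S'' \ W) := by
        by_contra hlt
        exact hmin _ (not_le.1 hlt) ⟨S'', hS'', hS''W.trans
          (union_subset_union le_rfl hZ), rfl⟩
      rw [← eq_of_subset_of_card_le h1 h2]
      exact sdiff_subset
  · rw [if_neg h]
    positivity

theorem coverMeasure_le_sum {μ : Ω → ℝ} (hμ : ∀ ω, 0 ≤ μ ω) {H : Ω → Finset X} {ρ : ℝ}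
    (hs : IsSpread μ H ρ) {U : Finset X} (ℋ : Set (Finset X)) (hℋ : ∀ Z ∈ ℋ, Z ⊆ U) :
    coverMeasure μ H ℋ ≤ ∑ Z ∈ U.powerset with Z ∈ ℋ, ρ ^ #Z := by
  calc coverMeasure μ H ℋ ≤ ∑ ω, ∑ Z ∈ U.powerset with Z ∈ ℋ, if Z ⊆ H ω then μ ω else 0 := by
        refine sum_le_sum fun ω _ => ?_
        split_ifs with h
        · obtain ⟨S, hS, hSH⟩ := h
          have h2 : ∀ Z ∈ U.powerset.filter (· ∈ ℋ), 0 ≤ if Z ⊆ H ω then μ ω else 0 := by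
            intro Z _
            split_ifs
            exacts [hμ ω, le_rfl]
          refine le_trans ?_ (single_le_sum h2 (mem_filter.2 ⟨mem_powerset.2 (hℋ S hS), hS⟩))
          rw [if_pos hSH, mul_one]
        · rw [mul_zero]
          refine sum_nonneg fun Z _ => ?_
          split_ifs
          exacts [hμ ω, le_rfl]
    _ = ∑ Z ∈ U.powerset with Z ∈ ℋ, ∑ ω with Z ⊆ H ω, μ ω := by
        rw [sum_comm]
        exact sum_congr rfl fun Z _ => by rw [sum_filter]
    _ ≤ _ := sum_le_sum fun Z _ => hs Z

theorem subsetExp_coverMeasure_largeFragments_le {μ : Ω → ℝ} (hμ : ∀ ω, 0 ≤ μ ω)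
    {H : Ω → Finset X} {U : Finset X} {ρ : ℝ} (hρ : 0 ≤ ρ)
    (hs : IsSpread μ H ρ) {ℋ : Set (Finset X)} {l t : ℕ} (hl : ∀ S ∈ ℋ, #S ≤ l) {p : ℝ}
    (h0 : 0 < p) (h1 : p ≤ 1) (hρp : ρ ≤ p) :
    subsetExp p U (fun W => coverMeasure μ H (largeFragments U ℋ t W)) ≤
      2 ^ l * (ρ / p) ^ t := by
  have hρp0 : 0 ≤ ρ / p := by positivity
  have hρp1 : ρ / p ≤ 1 := (div_le_one h0).2 hρp
  calc subsetExp p U (fun W => coverMeasure μ H (largeFragments U ℋ t W))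
      ≤ ∑ W ∈ U.powerset, subsetWeight p U W *
          ∑ Z ∈ U.powerset with Z ∈ largeFragments U ℋ t W, ρ ^ #Z :=
        subsetExp_mono h0.le h1 U fun W _ => coverMeasure_le_sum hμ hs _ fun Z hZ => hZ.1
    _ ≤ ∑ W ∈ U.powerset, ∑ Z ∈ U.powerset with Z ∈ largeFragments U ℋ t W,
          subsetWeight p U (W ∪ Z) * (ρ / p) ^ #Z := by
        refine sum_le_sum fun W _ => ?_
        rw [mul_sum]
        refine sum_le_sum fun Z hZ => ?_
        obtain ⟨-, hWZ, -⟩ := (mem_filter.1 hZ).2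
        calc subsetWeight p U W * ρ ^ #Z
            ≤ subsetWeight p U (W ∪ Z) * (1 / p) ^ #Z * ρ ^ #Z :=
              mul_le_mul_of_nonneg_right (subsetWeight_le_union h0 h1 hWZ) (by positivity)
          _ = _ := by rw [mul_assoc, ← mul_pow, one_div_mul_eq_div]
    _ = ∑ x ∈ U.powerset.sigma fun W => U.powerset.filter (· ∈ largeFragments U ℋ t W),
          subsetWeight p U (x.1 ∪ x.2) * (ρ / p) ^ #x.2 := by rw [sum_sigma]
    _ ≤ ∑ y ∈ U.powerset.sigma fun V => U.powerset.filter fun Z =>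
            Z ∈ largeFragments U ℋ t (V \ Z) ∧ Z ⊆ V,
          subsetWeight p U y.1 * (ρ / p) ^ #y.2 := by
        rw [← sum_image (s := U.powerset.sigma fun W =>
          U.powerset.filter (· ∈ largeFragments U ℋ t W))
          (g := fun x : (_ : Finset X) × Finset X => (⟨x.1 ∪ x.2, x.2⟩ : (_ : Finset X) × Finset X))
          (f := fun y => subsetWeight p U y.1 * (ρ / p) ^ #y.2)]
        · refine sum_le_sum_of_subset_of_nonneg ?_ fun y _ _ =>
            mul_nonneg (subsetWeight_nonneg h0.le h1 _ _) (by positivity)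
          intro y hy
          obtain ⟨⟨W, Z⟩, hx, rfl⟩ := mem_image.1 hy
          simp only [mem_sigma, mem_filter, mem_powerset] at hx ⊢
          have hd : (W ∪ Z) \ Z = W := by
            rw [union_sdiff_right, sdiff_eq_self_of_disjoint hx.2.2.2.1]
          exact ⟨union_subset hx.1 hx.2.1, hx.2.1, by rw [hd]; exact hx.2.2, subset_union_right⟩
        · rintro ⟨W, Z⟩ hx ⟨W', Z'⟩ hx' h
          simp only [coe_sigma, Set.mem_sigma_iff, mem_coe, mem_filter, mem_powerset] at hx hx'
          simp only [Sigma.mk.injEq, heq_eq_eq] at h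
          obtain ⟨h2, rfl⟩ := h
          have hd : ∀ W, Disjoint W Z → (W ∪ Z) \ Z = W := fun W hW => by
            rw [union_sdiff_right, sdiff_eq_self_of_disjoint hW]
          have := hd W hx.2.2.2.1
          rw [h2, hd W' hx'.2.2.2.1] at this
          rw [this]
    _ = ∑ V ∈ U.powerset, subsetWeight p U V * ∑ Z ∈ U.powerset with
          Z ∈ largeFragments U ℋ t (V \ Z) ∧ Z ⊆ V, (ρ / p) ^ #Z := by
        rw [sum_sigma]
        exact sum_congr rfl fun V _ => by rw [mul_sum]
    _ ≤ subsetExp p U fun _ => 2 ^ l * (ρ / p) ^ t := by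
        refine subsetExp_mono h0.le h1 U fun V _ => ?_
        by_cases hV : ∃ S ∈ ℋ, S ⊆ V
        · obtain ⟨S, hS, hSV⟩ := hV
          calc _ ≤ ∑ Z ∈ S.powerset, (ρ / p) ^ t := by
                refine (sum_le_sum (g := fun _ => (ρ / p) ^ t) fun Z hZ => ?_).trans
                  (sum_le_sum_of_subset_of_nonneg (fun Z hZ => ?_) fun _ _ _ => by positivity)
                · exact pow_le_pow_of_le_one hρp0 hρp1 (mem_filter.1 hZ).2.1.2.2.1
                · obtain ⟨⟨-, -, -, -, hZS⟩, hZV⟩ := (mem_filter.1 hZ).2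
                  exact mem_powerset.2 (hZS S hS (by
                    rwa [sdiff_union_of_subset hZV]))
            _ = 2 ^ #S * (ρ / p) ^ t := by simp
            _ ≤ _ := by
                gcongr
                · norm_num
                · exact hl S hS
        · rw [sum_eq_zero]
          · positivity
          · intro Z hZ
            obtain ⟨⟨-, -, -, ⟨S, hS, hSZ⟩, -⟩, hZV⟩ := (mem_filter.1 hZ).2
            exact absurd ⟨S, hS, by rwa [sdiff_union_of_subset hZV] at hSZ⟩ hV
    _ = _ := subsetExp_const _ _ _

theorem coverMeasure_le_round {μ : Ω → ℝ} (hμ : ∀ ω, 0 ≤ μ ω)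
    {H : Ω → Finset X} {U : Finset X} (hH : ∀ ω, H ω ⊆ U) {ρ : ℝ} (hρ : 0 ≤ ρ)
    (hs : IsSpread μ H ρ) {ℋ : Set (Finset X)} {l t : ℕ} (hl : ∀ S ∈ ℋ, #S ≤ l) {p : ℝ}
    (h0 : 0 < p) (h1 : p ≤ 1) (hρp : ρ ≤ p) :
    coverMeasure μ H ℋ ≤ subsetExp p U (fun W => coverMeasure μ H (smallFragments ℋ t W)) +
      2 ^ l * (ρ / p) ^ t := by
  calc coverMeasure μ H ℋ = subsetExp p U fun _ => coverMeasure μ H ℋ :=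
        (subsetExp_const _ _ _).symm
    _ ≤ _ := (subsetExp_mono h0.le h1 U fun W _ => coverMeasure_le_fragments hμ hH ℋ t W)
    _ ≤ _ := by
        rw [subsetExp_add]
        gcongr
        exact subsetExp_coverMeasure_largeFragments_le hμ hρ hs hl h0 h1 hρp

theorem coverMeasure_le_hitProb {μ : Ω → ℝ} (hμ : ∀ ω, 0 ≤ μ ω) (hμ1 : ∑ ω, μ ω = 1)
    {H : Ω → Finset X} {U : Finset X} (hH : ∀ ω, H ω ⊆ U) {ρ : ℝ} (hρ : 0 < ρ)
    (hs : IsSpread μ H ρ) {p : ℝ} (hρp : ρ ≤ p) (M k : ℕ) (hk : M ≤ k)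
    (hp1 : p + (k - M : ℕ) * (64 * ρ) ≤ 1) (ℋ : Set (Finset X)) (hl : ∀ S ∈ ℋ, #S ≤ 2 ^ k) :
    coverMeasure μ H ℋ ≤ hitProb (p + (k - M : ℕ) * (64 * ρ)) U ℋ +
      (2 ^ 2 ^ M * (ρ / p) + ((1 / 2) ^ M - (1 / 2) ^ k)) := by
  have hp0 : 0 < p := hρ.trans_le hρp
  induction k, hk using Nat.le_induction generalizing ℋ with
  | base =>
    simp only [Nat.sub_self, Nat.cast_zero, zero_mul, add_zero, sub_self] at hp1 ⊢
    refine (coverMeasure_le_round hμ hH hρ.le hs hl (t := 1) hp0 hp1 hρp).trans ?_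
    rw [pow_one]
    gcongr
    refine subsetExp_mono hp0.le hp1 U fun W _ => ?_
    by_cases hW : ∃ S ∈ ℋ, S ⊆ W
    · rw [if_pos hW, ← hμ1]
      refine sum_le_sum fun ω _ => ?_
      split_ifs
      · simp
      · simpa using hμ ω
    · rw [if_neg hW]
      refine sum_nonpos fun ω _ => ?_
      rw [if_neg, mul_zero]
      rintro ⟨Z, ⟨hZ, S, hS, hSW⟩, -⟩
      rw [Nat.lt_one_iff, card_eq_zero] at hZ
      exact hW ⟨S, hS, by simpa [hZ] using hSW⟩
  | succ k hk ih =>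
    have hcast : ((k + 1 - M : ℕ) : ℝ) = (k - M : ℕ) + 1 := by
      rw [Nat.succ_sub hk]; push_cast; ring
    rw [hcast] at hp1 ⊢
    have hkM : (0 : ℝ) ≤ (k - M : ℕ) := Nat.cast_nonneg _
    set p' := p + (k - M : ℕ) * (64 * ρ) with hp'
    have hp'0 : 0 < p' := by positivity
    have hp'1 : p' + 64 * ρ ≤ 1 := by rw [hp']; linarith
    have hq0 : 0 < 64 * ρ := by positivity
    have hq1 : 64 * ρ ≤ 1 := by linarith
    refine (coverMeasure_le_round hμ hH hρ.le hs hl (t := 2 ^ k + 1) hq0 hq1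
      (by linarith)).trans ?_
    have h2 : subsetExp (64 * ρ) U (fun W => coverMeasure μ H
        (smallFragments ℋ (2 ^ k + 1) W)) ≤
        hitProb (p + ((k - M : ℕ) + 1) * (64 * ρ)) U ℋ +
        (2 ^ 2 ^ M * (ρ / p) + ((1 / 2) ^ M - (1 / 2) ^ k)) := by
      refine (subsetExp_mono hq0.le hq1 U fun W _ => ih (by linarith)
        (smallFragments ℋ (2 ^ k + 1) W) fun S hS => Nat.lt_succ_iff.1 hS.1).trans ?_
      rw [subsetExp_add, subsetExp_const]
      gcongr
      calc _ ≤ subsetExp (64 * ρ) U (fun W => subsetExp p' U fun W' =>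
            if ∃ S ∈ ℋ, S ⊆ W ∪ W' then 1 else 0) := by
            refine subsetExp_mono hq0.le hq1 U fun W _ =>
              subsetExp_mono hp'0.le (by linarith) U fun W' _ => ?_
            by_cases h : ∃ S ∈ smallFragments ℋ (2 ^ k + 1) W, S ⊆ W'
            · obtain ⟨Z, ⟨-, S, hS, hSZ⟩, hZ⟩ := h
              rw [if_pos (⟨S, hS, hSZ.trans (union_subset_union le_rfl hZ)⟩ :
                ∃ S ∈ ℋ, S ⊆ W ∪ W')]
              split_ifs <;> norm_num
            · rw [if_neg h]
              split_ifs <;> norm_num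
        _ = _ := subsetExp_union _ _ U fun W => if ∃ S ∈ ℋ, S ⊆ W then 1 else 0
        _ ≤ _ := by
            refine subsetExp_mono_density ?_ ?_ ?_ U _ ?_
            · nlinarith
            · rw [hp']; nlinarith
            · linarith
            · intro W W' h
              by_cases hW : ∃ S ∈ ℋ, S ⊆ W
              · obtain ⟨S, hS, hSW⟩ := hW
                simp only []
                rw [if_pos ⟨S, hS, hSW⟩, if_pos ⟨S, hS, hSW.trans h⟩]
              · simp only []
                rw [if_neg hW]
                split_ifs <;> norm_num
    have h3 : (2 : ℝ) ^ 2 ^ (k + 1) * (ρ / (64 * ρ)) ^ (2 ^ k + 1) ≤ (1 / 2) ^ (k + 1) := by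
      have h4 : ρ / (64 * ρ) = 1 / 64 := by field_simp
      have h5 : k + 1 ≤ 2 ^ k := Nat.lt_two_pow_self
      calc (2 : ℝ) ^ 2 ^ (k + 1) * (ρ / (64 * ρ)) ^ (2 ^ k + 1)
          ≤ (2 : ℝ) ^ 2 ^ (k + 1) * (1 / 64) ^ (2 ^ k) := by
            rw [h4]
            gcongr ?_ * ?_
            exact pow_le_pow_of_le_one (by norm_num) (by norm_num) (Nat.le_succ _)
        _ = (1 / 16) ^ 2 ^ k := by
            rw [pow_succ 2 k, mul_comm (2 ^ k) 2, pow_mul, ← mul_pow]; norm_num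
        _ ≤ (1 / 2) ^ 2 ^ k := by gcongr; norm_num
        _ ≤ _ := pow_le_pow_of_le_one (by norm_num) (by norm_num) h5
    have h6 : ((1 : ℝ) / 2) ^ k = 2 * (1 / 2) ^ (k + 1) := by ring
    linarith

end BinomialSubset

/-- A `ρ`-spread measure on sets of size at most `r` forces the `O(ρ log r)`-random subset to
contain a set of its support. -/
theorem exists_le_hitProb_of_isSpread (ε : ℝ) (hε : 0 < ε) :
    ∃ r₀ : ℕ, ∀ r : ℕ, r₀ ≤ r → ∀ (X Ω : Type) [Fintype Ω] (μ : Ω → ℝ) (H : Ω → Finset X)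
      (U : Finset X) (ρ p : ℝ), (∀ ω, 0 ≤ μ ω) → ∑ ω, μ ω = 1 → (∀ ω, H ω ⊆ U) →
      (∀ ω, #(H ω) ≤ r) → 0 < ρ → IsSpread μ H ρ → p ≤ 1 → 200 * ρ * Real.log r ≤ p →
      1 - ε ≤ hitProb p U {S | ∃ ω, 0 < μ ω ∧ H ω = S} := by
  obtain ⟨M, hM⟩ := exists_pow_lt_of_lt_one (half_pos hε) (show (1 / 2 : ℝ) < 1 by norm_num)
  have hev : ∀ᶠ r : ℕ in Filter.atTop, max 1 (2 ^ 2 ^ M / (ε / 2)) ≤ Real.log r :=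
    (Real.tendsto_log_atTop.comp tendsto_natCast_atTop_atTop).eventually_ge_atTop _
  obtain ⟨r₁, hr₁⟩ := Filter.eventually_atTop.1 hev
  refine ⟨max r₁ (2 ^ M + 1), fun r hr X Ω _ μ H U ρ p hμ hμ1 hH hHr hρ hs hp1 hp => ?_⟩
  have hlog := hr₁ r ((le_max_left _ _).trans hr)
  have hlog1 : 1 ≤ Real.log r := (le_max_left _ _).trans hlog
  have hlog2 : 2 ^ 2 ^ M / (ε / 2) ≤ Real.log r := (le_max_right _ _).trans hlog
  have hr2 : 2 ^ M + 1 ≤ r := (le_max_right _ _).trans hr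
  set k := Nat.clog 2 r with hk
  have hrk : r ≤ 2 ^ k := Nat.le_pow_clog (by norm_num) r
  have hMk : M ≤ k := by
    by_contra h
    have : 2 ^ k ≤ 2 ^ M := Nat.pow_le_pow_right (by norm_num) (by omega)
    omega
  have hr1 : 1 < r := by have := Nat.one_le_two_pow (n := M); omega
  have hkr : 2 ^ (k - 1) < r := Nat.pow_pred_clog_lt_self (by norm_num) hr1
  have hklog : (k : ℝ) ≤ 3 * Real.log r := by
    have h1 : ((k - 1 : ℕ) : ℝ) * Real.log 2 ≤ Real.log r := by
      rw [← Real.log_pow]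
      exact Real.log_le_log (by positivity) (by exact_mod_cast hkr.le)
    have h2 : (k : ℝ) ≤ (k - 1 : ℕ) + 1 := by
      have : k ≤ k - 1 + 1 := by omega
      exact_mod_cast this
    have h3 := Real.log_two_gt_d9
    have h4 : (0 : ℝ) ≤ (k - 1 : ℕ) := Nat.cast_nonneg _
    nlinarith
  have hρl : ρ ≤ ρ * Real.log r := by nlinarith
  have hkM : ((k - M : ℕ) : ℝ) ≤ 3 * Real.log r :=
    le_trans (by exact_mod_cast Nat.sub_le k M) hklog
  have hle : ρ * Real.log r + (k - M : ℕ) * (64 * ρ) ≤ p := by nlinarith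
  have hmain := coverMeasure_le_hitProb hμ hμ1 hH hρ hs hρl M k hMk (hle.trans hp1)
    {S | ∃ ω, 0 < μ ω ∧ H ω = S} (by rintro S ⟨ω, -, rfl⟩; exact (hHr ω).trans hrk)
  have hone : coverMeasure μ H {S | ∃ ω, 0 < μ ω ∧ H ω = S} = 1 := by
    rw [← hμ1]
    refine sum_congr rfl fun ω _ => ?_
    rcases (hμ ω).eq_or_lt with h | h
    · rw [← h, zero_mul]
    · rw [if_pos ⟨H ω, ⟨ω, h, rfl⟩, le_rfl⟩, mul_one]
  have hmono : hitProb (ρ * Real.log r + (k - M : ℕ) * (64 * ρ)) U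
      {S | ∃ ω, 0 < μ ω ∧ H ω = S} ≤ hitProb p U {S | ∃ ω, 0 < μ ω ∧ H ω = S} := by
    refine subsetExp_mono_density (by positivity) hle hp1 U _ ?_
    intro W W' h
    simp only []
    by_cases hW : ∃ S ∈ {S | ∃ ω, 0 < μ ω ∧ H ω = S}, S ⊆ W
    · obtain ⟨S, hS, hSW⟩ := hW
      rw [if_pos ⟨S, hS, hSW⟩, if_pos ⟨S, hS, hSW.trans h⟩]
    · rw [if_neg hW]
      split_ifs <;> norm_num
  have herr : (2 : ℝ) ^ 2 ^ M * (ρ / (ρ * Real.log r)) ≤ ε / 2 := by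
    have : ρ / (ρ * Real.log r) = 1 / Real.log r := by field_simp
    rw [this, mul_one_div, div_le_iff₀ (by linarith)]
    rw [div_le_iff₀ (by positivity)] at hlog2
    linarith
  have : (0 : ℝ) ≤ (1 / 2) ^ k := by positivity
  linarith

section Exclusive

variable {E K : Type*}

theorem subsetExp_disjUnion [inst : DecidableEq E] (p : ℝ) {U V : Finset E}
    (h : Disjoint U V) (F : Finset E → ℝ) :
    subsetExp p (U ∪ V) F = subsetExp p U fun W => subsetExp p V fun W' => F (W ∪ W') := by
  obtain rfl : inst = fun a b => Classical.propDecidable _ := Subsingleton.elim _ _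
  induction V using Finset.induction_on generalizing F with
  | empty => simp
  | insert a V ha ih =>
    rw [disjoint_insert_right] at h
    rw [union_insert, subsetExp_insert p (by simp [h.1, ha]), ih h.2, ih h.2]
    simp only [subsetExp_insert p ha, subsetExp_add, subsetExp_const_mul, union_insert]

theorem subsetExp_sum_mem (p : ℝ) (U : Finset E) (g : E → ℝ) :
    subsetExp p U (fun W => ∑ a ∈ W, g a) = p * ∑ a ∈ U, g a := by
  induction U using Finset.induction_on with
  | empty => simp
  | insert a U ha ih =>
    have h : subsetExp p U (fun W => ∑ x ∈ insert a W, g x) =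
        g a + p * ∑ x ∈ U, g x := by
      rw [← ih, ← subsetExp_const p U (g a), ← subsetExp_add]
      refine sum_congr rfl fun W hW => ?_
      dsimp only
      rw [sum_insert fun h => ha (mem_powerset.1 hW h)]
    rw [subsetExp_insert p ha, h, ih, sum_insert ha]
    ring

variable [Fintype E] [Fintype K]

/-- The expectation of `F` at the set of pairs (retained element, its colour), where each
element of `U` is retained with probability `p` and all elements receive uniform colours. -/
noncomputable def colouredExp (p : ℝ) (U : Finset E) (F : Finset (E × K) → ℝ) : ℝ :=
  subsetExp p U fun R => ((Fintype.card K : ℝ) ^ Fintype.card E)⁻¹ *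
    ∑ c : E → K, F (R.image fun e => (e, c e))

theorem colouredExp_eq_sum [instE : DecidableEq E] [instK : DecidableEq K] (p : ℝ) (U : Finset E)
    (F : Finset (E × K) → ℝ) :
    colouredExp p U F = ∑ R ∈ U.powerset, ∑ c : E → K, p ^ #R * (1 - p) ^ (#U - #R) *
      ((Fintype.card K : ℝ) ^ Fintype.card E)⁻¹ * F (R.image fun e => (e, c e)) := by
  obtain rfl : instE = fun a b => Classical.propDecidable _ := Subsingleton.elim _ _
  obtain rfl : instK = fun a b => Classical.propDecidable _ := Subsingleton.elim _ _
  unfold colouredExp subsetExp subsetWeight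
  refine sum_congr rfl fun R hR => ?_
  rw [card_sdiff_of_subset (mem_powerset.1 hR), ← mul_sum, mul_assoc, mul_assoc, mul_assoc]

theorem sum_eq_sum_update [Nonempty K] (e : E) (g : (E → K) → ℝ) :
    ∑ c, g c = (Fintype.card K : ℝ)⁻¹ * ∑ a : K, ∑ c, g (Function.update c e a) := by
  have h1 : ∀ c : E → K, ∀ a, Function.update c e a =
      (Equiv.piSplitAt e fun _ => K).symm (a, fun j => c j) := by
    intro c a
    ext j
    by_cases h : j = e
    · subst h; simp [Equiv.piSplitAt]
    · simp [Equiv.piSplitAt, h]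
  have h2 : ∀ f : (E → K) → ℝ, ∑ c, f c =
      ∑ x, f ((Equiv.piSplitAt e fun _ => K).symm x) := fun f =>
    (Equiv.sum_comp (Equiv.piSplitAt e fun _ => K).symm f).symm
  have h3 : ∀ x : K × ((j : { j // j ≠ e }) → K), ∀ j : {j // j ≠ e},
      (Equiv.piSplitAt e fun _ => K).symm x j = x.2 j := by
    intro x j
    simp [Equiv.piSplitAt, j.2]
  simp only [h1]
  rw [h2]
  have h4 : ∀ a : K, (∑ c : E → K, g ((Equiv.piSplitAt e fun _ => K).symm (a, fun j => c j))) =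
      Fintype.card K * ∑ y, g ((Equiv.piSplitAt e fun _ => K).symm (a, y)) := by
    intro a
    rw [h2 fun c => g ((Equiv.piSplitAt e fun _ => K).symm (a, fun j => c j))]
    simp only [h3]
    rw [Fintype.sum_prod_type]
    simp
  simp only [h4]
  rw [← mul_sum, ← mul_assoc, inv_mul_cancel₀ (by simp), one_mul, Fintype.sum_prod_type]

theorem colouredExp_insert [Nonempty K] (p : ℝ) {U : Finset E} {e : E} (he : e ∉ U)
    (F : Finset (E × K) → ℝ) :
    colouredExp p (insert e U) F = (1 - p) * colouredExp p U F +
      p * ((Fintype.card K : ℝ)⁻¹ * ∑ a : K, colouredExp p U fun W => F (insert (e, a) W)) := by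
  unfold colouredExp
  rw [subsetExp_insert p he]
  congr 2
  rw [← subsetExp_sum, ← subsetExp_const_mul]
  refine sum_congr rfl fun R hR => ?_
  congr 1
  dsimp only
  rw [sum_eq_sum_update e, ← mul_sum, mul_left_comm]
  congr 2
  refine sum_congr rfl fun a _ => sum_congr rfl fun c _ => ?_
  rw [image_insert, Function.update_self]
  congr 2
  refine image_congr fun x hx => ?_
  have : x ≠ e := fun h => he (h ▸ mem_powerset.1 hR hx)
  simp [this]

/-- A function of sets of pairs that is locally subadditive in the second coordinate. -/
def FiberSubadditive (F : Finset (E × K) → ℝ) : Prop :=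
  ∀ (e : E) (W : Finset (E × K)) (A : Finset K),
    F (W ∪ A.image fun a => (e, a)) ≤ F W + ∑ a ∈ A, (F (insert (e, a) W) - F W)

/-- Comparison of independent retention of (element, colour) pairs with the model in which
a retained element gets exactly one colour. -/
theorem subsetExp_le_colouredExp [Nonempty K] {p : ℝ} (h0 : 0 ≤ p) (h1 : p ≤ 1)
    (U : Finset E) (F : Finset (E × K) → ℝ) (hF : FiberSubadditive F) :
    subsetExp (p / Fintype.card K) (U ×ˢ (univ : Finset K)) F ≤ colouredExp p U F := by
  have hK : (0 : ℝ) < Fintype.card K := by exact_mod_cast Fintype.card_pos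
  have hK1 : (1 : ℝ) ≤ Fintype.card K := by exact_mod_cast Fintype.card_pos
  have hp'0 : 0 ≤ p / Fintype.card K := by positivity
  have hp'1 : p / Fintype.card K ≤ 1 := by rw [div_le_one hK]; linarith
  induction U using Finset.induction_on generalizing F with
  | empty => simp [colouredExp]
  | insert e U he ih =>
    have hprod : insert e U ×ˢ (univ : Finset K) = U ×ˢ univ ∪ {e} ×ˢ univ := by
      ext ⟨x, y⟩
      simp [or_comm, eq_comm]
    rw [hprod, subsetExp_disjUnion, colouredExp_insert p he]
    · calc _ ≤ subsetExp (p / Fintype.card K) (U ×ˢ (univ : Finset K)) (fun W =>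
            subsetExp (p / Fintype.card K) ({e} ×ˢ (univ : Finset K)) fun W' =>
              F W + ∑ x ∈ W', (F (insert x W) - F W)) := by
            refine subsetExp_mono hp'0 hp'1 _ fun W _ => subsetExp_mono hp'0 hp'1 _ fun W' hW' => ?_
            have hW'e : (W'.image Prod.snd).image (fun a => (e, a)) = W' := by
              rw [image_image]
              conv_rhs => rw [← image_id (s := W')]
              refine image_congr fun x hx => ?_
              have := hW' hx
              simp only [singleton_product, mem_map, mem_univ, true_and] at this
              obtain ⟨a, rfl⟩ := this
              rfl
            have := hF e W (W'.image Prod.snd)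
            rw [hW'e] at this
            refine this.trans (le_of_eq ?_)
            congr 1
            conv_rhs => rw [← hW'e]
            rw [sum_image fun a _ b _ h => (Prod.mk.inj h).2]
        _ = subsetExp (p / Fintype.card K) (U ×ˢ (univ : Finset K)) (fun W =>
            (1 - p) * F W + p * ((Fintype.card K : ℝ)⁻¹ * ∑ a : K, F (insert (e, a) W))) := by
            congr 1
            ext W
            rw [subsetExp_add, subsetExp_const, subsetExp_sum_mem, sum_sub_distrib,
              sum_product, sum_singleton, sum_const, card_product, card_singleton, one_mul,
              card_univ, nsmul_eq_mul]
            field_simp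
            ring
        _ = (1 - p) * subsetExp (p / Fintype.card K) (U ×ˢ (univ : Finset K)) F +
            p * ((Fintype.card K : ℝ)⁻¹ * ∑ a : K,
              subsetExp (p / Fintype.card K) (U ×ˢ (univ : Finset K)) fun W =>
                F (insert (e, a) W)) := by
            rw [subsetExp_add, subsetExp_const_mul, subsetExp_const_mul, subsetExp_const_mul,
              subsetExp_sum]
        _ ≤ _ := by
            have h2 := ih F hF
            have h3 : ∀ a : K, _ := fun a => ih (fun W => F (insert (e, a) W)) (by
              intro e' W A
              have := hF e' (insert (e, a) W) A
              simpa only [insert_union, insert_comm (e, a)] using this)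
            have : 0 ≤ 1 - p := by linarith
            gcongr with a
            exact h3 a
    · rw [disjoint_product]
      left
      simpa using he

end Exclusive

section Basic

variable {α β : Type}

/-- The neighbours of `v` inside `U`. -/
noncomputable def nbrsIn (G : SimpleGraph β) (v : β) (U : Finset β) : Finset β :=
  U.filter (G.Adj v)

theorem mem_nbrsIn {G : SimpleGraph β} {v w : β} {U : Finset β} :
    w ∈ nbrsIn G v U ↔ w ∈ U ∧ G.Adj v w := mem_filter

theorem nbrsIn_subset (G : SimpleGraph β) (v : β) (U : Finset β) : nbrsIn G v U ⊆ U :=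
  filter_subset _ _

theorem nbrsIn_inter (G : SimpleGraph β) (v : β) {U W : Finset β} (h : W ⊆ U) :
    nbrsIn G v U ∩ W = nbrsIn G v W := by
  ext x
  simp only [mem_inter, mem_nbrsIn]
  exact ⟨fun h => ⟨h.2, h.1.2⟩, fun h' => ⟨⟨h h'.1, h'.2⟩, h'.1⟩⟩

theorem card_nbrsIn_le_sdiff (G : SimpleGraph β) (v : β) (U W : Finset β) :
    #(nbrsIn G v U) ≤ #(nbrsIn G v (U \ W)) + #W := by
  have : nbrsIn G v U ⊆ nbrsIn G v (U \ W) ∪ W := by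
    intro x hx
    by_cases h : x ∈ W
    · exact mem_union_right _ h
    · exact mem_union_left _ (mem_nbrsIn.2 ⟨mem_sdiff.2 ⟨(mem_nbrsIn.1 hx).1, h⟩,
        (mem_nbrsIn.1 hx).2⟩)
  exact (card_le_card this).trans (card_union_le _ _)

/-- Two subsets of `U` of density more than one half together meet in a positive proportion. -/
theorem le_card_inter {U A B : Finset β} (hA : A ⊆ U) (hB : B ⊆ U) :
    #A + #B ≤ #(A ∩ B) + #U := by
  have h1 := card_union_add_card_inter A B
  have h2 := card_le_card (union_subset hA hB)
  omega

/-- Every vertex of `U` is adjacent to at least a `1 / 2 + η` fraction of `U`. -/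
def DiracOn (G : SimpleGraph β) (η : ℝ) (U : Finset β) : Prop :=
  ∀ v ∈ U, (1 / 2 + η) * #U ≤ #(nbrsIn G v U)

/-- `S` is a subtree, rooted at `r`, of the forest with parent function `π` and depth `d`. -/
structure IsSubtree (π : α → α) (d : α → ℕ) (S : Finset α) (r : α) : Prop where
  root_mem : r ∈ S
  parent_mem : ∀ i ∈ S, i ≠ r → π i ∈ S
  depth_eq : ∀ i ∈ S, i ≠ r → d i = d (π i) + 1

/-- `φ` embeds the subtree `S` with root `r` into the graph induced by `G` on `U`. -/
structure IsTreeEmb (G : SimpleGraph β) (π : α → α) (S : Finset α) (r : α) (U : Finset β)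
    (φ : α → β) : Prop where
  mem : ∀ i ∈ S, φ i ∈ U
  inj : Set.InjOn φ S
  adj : ∀ i ∈ S, i ≠ r → G.Adj (φ (π i)) (φ i)

end Basic

section Tiling

variable {β : Type}

/-- Every vertex of `A` is adjacent to every vertex of `B`. -/
def CompletePair (G : SimpleGraph β) (A B : Finset β) : Prop := ∀ a ∈ A, ∀ b ∈ B, G.Adj a b

theorem CompletePair.disjoint {G : SimpleGraph β} {A B : Finset β} (h : CompletePair G A B) :
    Disjoint A B :=
  Finset.disjoint_left.2 fun a ha hb => G.loopless.irrefl a (h a ha a hb)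

theorem CompletePair.mono {G : SimpleGraph β} {A B A' B' : Finset β} (h : CompletePair G A B)
    (hA : A' ⊆ A) (hB : B' ⊆ B) : CompletePair G A' B' :=
  fun a ha b hb => h a (hA ha) b (hB hb)

/-- Many vertices with many neighbours in a bounded set contain one side of a large complete
bipartite graph. -/
theorem exists_completePair (G : SimpleGraph β) {V Y : Finset β} {k t M : ℕ} (hY : #Y ≤ M)
    (ht : ∀ v ∈ V, t ≤ #(nbrsIn G v Y)) (hk : 0 < k) (hV : k * 2 ^ M ≤ #V) :
    ∃ X ⊆ V, ∃ Y₁ ⊆ Y, #X = k ∧ #Y₁ = t ∧ CompletePair G X Y₁ := by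
  choose! f hf hfc using fun v hv => exists_subset_card_eq (ht v hv)
  have hmaps : ∀ v ∈ V, f v ∈ Y.powerset := fun v hv =>
    mem_powerset.2 ((hf v hv).trans (nbrsIn_subset _ _ _))
  obtain ⟨Y₁, hY₁, hc⟩ := exists_le_card_fiber_of_mul_le_card_of_maps_to (n := k) hmaps
    ⟨∅, by simp⟩ (by
      rw [card_powerset, mul_comm]
      exact (Nat.mul_le_mul_left _ (Nat.pow_le_pow_right (by norm_num) hY)).trans hV)
  obtain ⟨X, hX, hXc⟩ := exists_subset_card_eq hc
  have hX' : ∀ x ∈ X, x ∈ V ∧ f x = Y₁ := fun x hx => mem_filter.1 (hX hx)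
  refine ⟨X, fun x hx => (hX' x hx).1, Y₁, mem_powerset.1 hY₁, hXc, ?_, fun x hx y hy => ?_⟩
  · obtain ⟨x, hx⟩ := card_pos.1 (hXc ▸ hk)
    rw [← (hX' x hx).2]
    exact hfc x (hX' x hx).1
  · obtain ⟨hxV, hxf⟩ := hX' x hx
    exact (mem_nbrsIn.1 (hf x hxV (hxf ▸ hy))).2

/-- A family of disjoint balanced complete bipartite pairs in `U` with sides of sizes between
`s` and `S`. -/
structure IsTiling (G : SimpleGraph β) (U : Finset β) (s S : ℕ)
    (T : Finset (Finset β × Finset β)) : Prop where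
  left_subset : ∀ p ∈ T, p.1 ⊆ U
  right_subset : ∀ p ∈ T, p.2 ⊆ U
  card_eq : ∀ p ∈ T, #p.1 = #p.2
  le_card : ∀ p ∈ T, s ≤ #p.1
  card_le : ∀ p ∈ T, #p.1 ≤ S
  complete : ∀ p ∈ T, CompletePair G p.1 p.2
  disjoint : ∀ p ∈ T, ∀ p' ∈ T, p ≠ p' → Disjoint (p.1 ∪ p.2) (p'.1 ∪ p'.2)

/-- The vertices covered by a family of pairs. -/
noncomputable def tiled (T : Finset (Finset β × Finset β)) : Finset β :=
  T.biUnion fun p => p.1 ∪ p.2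

namespace IsTiling

variable {G : SimpleGraph β} {U : Finset β} {s S : ℕ} {T : Finset (Finset β × Finset β)}

theorem tiled_subset (h : IsTiling G U s S T) : tiled T ⊆ U :=
  biUnion_subset.2 fun p hp => union_subset (h.left_subset p hp) (h.right_subset p hp)

theorem mono (h : IsTiling G U s S T) {s' S' : ℕ} (hs : s' ≤ s) (hS : S ≤ S') :
    IsTiling G U s' S' T :=
  ⟨h.1, h.2, h.3, fun p hp => hs.trans (h.4 p hp), fun p hp => (h.5 p hp).trans hS, h.6, h.7⟩

theorem subset (h : IsTiling G U s S T) {T' : Finset (Finset β × Finset β)} (hT : T' ⊆ T) :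
    IsTiling G U s S T' :=
  ⟨fun p hp => h.1 p (hT hp), fun p hp => h.2 p (hT hp), fun p hp => h.3 p (hT hp),
    fun p hp => h.4 p (hT hp), fun p hp => h.5 p (hT hp), fun p hp => h.6 p (hT hp),
    fun p hp p' hp' => h.7 p (hT hp) p' (hT hp')⟩

theorem tiled_erase (h : IsTiling G U s S T) {p : Finset β × Finset β} (hp : p ∈ T) :
    tiled (T.erase p) = tiled T \ (p.1 ∪ p.2) := by
  ext x
  simp only [tiled, mem_biUnion, mem_sdiff, mem_erase]
  constructor
  · rintro ⟨q, ⟨hqp, hq⟩, hx⟩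
    exact ⟨⟨q, hq, hx⟩, Finset.disjoint_left.1 (h.disjoint q hq p hp hqp) hx⟩
  · rintro ⟨⟨q, hq, hx⟩, hxp⟩
    exact ⟨q, ⟨fun e => hxp (e ▸ hx), hq⟩, hx⟩

theorem tiled_insert (T : Finset (Finset β × Finset β)) (p : Finset β × Finset β) :
    tiled (insert p T) = p.1 ∪ p.2 ∪ tiled T := biUnion_insert

theorem insert (h : IsTiling G U s S T) {A B : Finset β} (hA : A ⊆ U) (hB : B ⊆ U)
    (hAB : #A = #B) (hs : s ≤ #A) (hS : #A ≤ S) (hc : CompletePair G A B)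
    (hd : Disjoint (A ∪ B) (tiled T)) : IsTiling G U s S (insert (A, B) T) := by
  have hd' : ∀ p ∈ T, Disjoint (A ∪ B) (p.1 ∪ p.2) := fun p hp =>
    disjoint_of_subset_right (subset_biUnion_of_mem (fun p : Finset β × Finset β => p.1 ∪ p.2) hp)
      hd
  constructor
  · simpa [hA] using h.1
  · simpa [hB] using h.2
  · simpa [hAB] using h.3
  · simpa [hs] using h.4
  · simpa [hS] using h.5
  · intro p hp
    rcases mem_insert.1 hp with rfl | hp
    exacts [hc, h.6 p hp]
  · intro p hp p' hp' hne
    rcases mem_insert.1 hp with rfl | hp <;> rcases mem_insert.1 hp' with rfl | hp'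
    · exact absurd rfl hne
    · exact hd' p' hp'
    · exact (hd' p hp).symm
    · exact h.7 p hp p' hp' hne

theorem card_tiled (h : IsTiling G U s S T) : #(tiled T) = ∑ p ∈ T, 2 * #p.1 := by
  rw [tiled, card_biUnion fun p hp p' hp' hne => h.disjoint p hp p' hp' hne]
  refine sum_congr rfl fun p hp => ?_
  rw [card_union_of_disjoint (h.complete p hp).disjoint, ← h.card_eq p hp]
  ring

theorem exists_maximal [Fintype β] (h : IsTiling G U s S T) :
    ∃ T', IsTiling G U s S T' ∧ #(tiled T) ≤ #(tiled T') ∧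
      ∀ T'', IsTiling G U s S T'' → #(tiled T'') ≤ #(tiled T') := by
  obtain ⟨T', hT', hmax⟩ := exists_max_image (univ.filter (IsTiling G U s S))
    (fun T => #(tiled T)) ⟨T, by simp [h]⟩
  exact ⟨T', (mem_filter.1 hT').2, hmax T (by simp [h]), fun T'' h'' => hmax T'' (by simp [h''])⟩

/-- A tile whose two sides both have large neighbourhoods outside of the tiling can be
replaced by three smaller tiles that cover more vertices. -/
theorem exchange (h : IsTiling G U s S T) {p : Finset β × Finset β} (hp : p ∈ T) {t : ℕ}
    {V : Finset β} (hVU : V ⊆ U \ tiled T) (hst : s ≤ t) (hst' : s + t ≤ #p.1) (ht0 : 0 < t)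
    (hV1 : ∀ v ∈ V, t ≤ #(nbrsIn G v p.1)) (hV2 : ∀ v ∈ V, t ≤ #(nbrsIn G v p.2))
    (hV : 2 * t * 2 ^ S ≤ #V) :
    ∃ T', IsTiling G U s S T' ∧ tiled T ⊆ tiled T' ∧ #(tiled T') = #(tiled T) + 2 * t ∧
      ∀ q ∈ T, q ≠ p → q ∈ T' := by
  have hpS := h.card_le p hp
  obtain ⟨X, hXV, A₁, hA₁, hXc, hA₁c, hXA⟩ := exists_completePair G hpS hV1 ht0 (by
    have : t * 2 ^ S ≤ 2 * t * 2 ^ S := Nat.mul_le_mul_right _ (by omega)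
    omega)
  obtain ⟨X', hXV', B₁, hB₁, hXc', hB₁c, hXB⟩ := exists_completePair G (V := V \ X)
    ((h.card_eq p hp).symm.le.trans hpS) (fun v hv => hV2 v (mem_sdiff.1 hv).1) ht0 (by
      rw [card_sdiff_of_subset hXV, hXc]
      have : t * 1 ≤ t * 2 ^ S := Nat.mul_le_mul_left _ Nat.one_le_two_pow
      have : 2 * t * 2 ^ S = t * 2 ^ S + t * 2 ^ S := by ring
      omega)
  have hXX' : Disjoint X X' := disjoint_of_subset_right hXV' disjoint_sdiff
  replace hXV' := hXV'.trans sdiff_subset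
  have hXU := (hXV.trans hVU).trans sdiff_subset
  have hXU' := (hXV'.trans hVU).trans sdiff_subset
  have hXT : ∀ x ∈ X, x ∉ tiled T := fun x hx => (mem_sdiff.1 (hVU (hXV hx))).2
  have hXT' : ∀ x ∈ X', x ∉ tiled T := fun x hx => (mem_sdiff.1 (hVU (hXV' hx))).2
  have hpT : p.1 ∪ p.2 ⊆ tiled T :=
    subset_biUnion_of_mem (fun p : Finset β × Finset β => p.1 ∪ p.2) hp
  have hpT1 : ∀ x ∈ p.1, x ∈ tiled T := fun x hx => hpT (mem_union_left _ hx)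
  have hpT2 : ∀ x ∈ p.2, x ∈ tiled T := fun x hx => hpT (mem_union_right _ hx)
  have hp12 := Finset.disjoint_left.1 (h.complete p hp).disjoint
  have hXX'l := Finset.disjoint_left.1 hXX'
  have e0 := h.tiled_erase hp
  have h0 := h.subset (erase_subset p T)
  have cA : #(p.1 \ A₁) = #p.1 - t := by rw [card_sdiff_of_subset hA₁, hA₁c]
  have cB : #(p.2 \ B₁) = #p.1 - t := by rw [card_sdiff_of_subset hB₁, hB₁c, h.card_eq p hp]
  have h1 := h0.insert (A := p.1 \ A₁) (B := p.2 \ B₁) (sdiff_subset.trans (h.left_subset p hp))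
    (sdiff_subset.trans (h.right_subset p hp)) (by omega) (by omega) (by omega)
    ((h.complete p hp).mono sdiff_subset sdiff_subset) (by
      rw [e0, Finset.disjoint_left]
      intro x hx
      grind)
  have e1 := tiled_insert (T.erase p) (p.1 \ A₁, p.2 \ B₁)
  rw [e0] at e1
  have h2 := h1.insert (A := X) (B := A₁) hXU (hA₁.trans (h.left_subset p hp)) (by omega)
    (by omega) (by omega) hXA (by
      rw [e1, Finset.disjoint_left]
      intro x hx
      have := hXT x
      have := @hA₁ x
      have := hpT1 x
      have := hpT2 x
      have := @hp12 x
      grind)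
  have e2 := tiled_insert (Insert.insert (p.1 \ A₁, p.2 \ B₁) (T.erase p)) (X, A₁)
  rw [e1] at e2
  have h3 := h2.insert (A := X') (B := B₁) hXU' (hB₁.trans (h.right_subset p hp)) (by omega)
    (by omega) (by omega) hXB (by
      rw [e2, Finset.disjoint_left]
      intro x hx
      have := hXT' x
      have := hXT x
      have := @hXX'l x
      have := @hB₁ x
      have := @hA₁ x
      have := hpT1 x
      have := hpT2 x
      have := @hp12 x
      grind)
  have e3 := tiled_insert (Insert.insert (X, A₁)
    (Insert.insert (p.1 \ A₁, p.2 \ B₁) (T.erase p))) (X', B₁)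
  rw [e2] at e3
  have e4 : tiled (Insert.insert (X', B₁) (Insert.insert (X, A₁)
      (Insert.insert (p.1 \ A₁, p.2 \ B₁) (T.erase p)))) = tiled T ∪ (X ∪ X') := by
    rw [e3]
    ext x
    have := hpT1 x
    have := hpT2 x
    have := @hA₁ x
    have := @hB₁ x
    grind
  refine ⟨_, h3, ?_, ?_, fun q hq hqp => ?_⟩
  · rw [e4]; exact subset_union_left
  · rw [e4, card_union_of_disjoint, card_union_of_disjoint hXX', hXc, hXc']
    · ring
    · rw [Finset.disjoint_right]
      intro x hx
      rcases mem_union.1 hx with hx | hx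
      exacts [hXT x hx, hXT' x hx]
  · simp [hq, hqp]

end IsTiling

/-- A set containing many vertices of linear degree contains a large balanced complete
bipartite graph. -/
theorem exists_completePair_of_dense (τ : ℝ) (hτ : 0 < τ) (s : ℕ) (hs : 0 < s) :
    ∃ m K : ℕ, ∀ (β : Type) (G : SimpleGraph β) (L V : Finset β) (N : ℕ), K ≤ N → #L ≤ N →
      V ⊆ L → m ≤ #V → (∀ v ∈ V, τ * N ≤ #(nbrsIn G v L)) →
      ∃ X ⊆ L, ∃ Y ⊆ L, #X = s ∧ #Y = s ∧ CompletePair G X Y := by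
  obtain ⟨m, hm⟩ := exists_nat_ge (2 * s / τ)
  obtain ⟨K, hK⟩ := exists_nat_ge (2 * (s * 2 ^ m) / τ)
  refine ⟨m, K, fun β G L V N hN hL hV hmV hdeg => ?_⟩
  rw [div_le_iff₀ hτ] at hm hK
  have hm0 : 0 < (m : ℝ) := by
    by_contra h
    have : (0 : ℝ) < s := by exact_mod_cast hs
    nlinarith
  obtain ⟨V', hV', hV'c⟩ := exists_subset_card_eq hmV
  set Y := L.filter fun y => s ≤ #(nbrsIn G y V') with hY
  have hdc : ∑ v ∈ V', #(nbrsIn G v L) = ∑ y ∈ L, #(nbrsIn G y V') := by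
    simp only [nbrsIn, card_filter]
    rw [sum_comm]
    simp only [G.adj_comm]
  have hup : ∑ y ∈ L, #(nbrsIn G y V') ≤ #Y * m + N * s := by
    calc ∑ y ∈ L, #(nbrsIn G y V') ≤ ∑ y ∈ L, ((if s ≤ #(nbrsIn G y V') then m else 0) + s) := by
          refine sum_le_sum fun y _ => ?_
          split_ifs with h
          · exact ((card_le_card (nbrsIn_subset _ _ _)).trans hV'c.le).trans (by omega)
          · omega
      _ = #Y * m + #L * s := by
          rw [sum_add_distrib, ← sum_filter, sum_const, sum_const, smul_eq_mul, smul_eq_mul]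
      _ ≤ _ := by gcongr
  have hlow : (m : ℝ) * (τ * N) ≤ ∑ v ∈ V', (#(nbrsIn G v L) : ℝ) := by
    rw [← hV'c, ← nsmul_eq_mul]
    exact card_nsmul_le_sum _ _ _ fun v hv => hdeg v (hV' hv)
  have h1 : (m : ℝ) * (τ * N) ≤ #Y * m + N * s := by
    refine hlow.trans ?_
    exact_mod_cast hdc.le.trans hup
  have hNK : (K : ℝ) ≤ N := by exact_mod_cast hN
  have h2 : τ * N / 2 ≤ #Y := by
    have h3 : (N : ℝ) * (2 * s) ≤ N * (m * τ) := by gcongr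
    have : m * (τ * N / 2) ≤ m * (#Y : ℝ) := by nlinarith
    exact le_of_mul_le_mul_left this hm0
  have h4 : ((s * 2 ^ m : ℕ) : ℝ) ≤ #Y := by
    push_cast
    nlinarith
  obtain ⟨X, hX, Y₁, hY₁, hXc, hYc, hXY⟩ := exists_completePair G (V := Y) (t := s) (k := s)
    hV'c.le (fun v hv => (mem_filter.1 hv).2) hs (by exact_mod_cast h4)
  exact ⟨X, hX.trans (filter_subset _ _), Y₁, (hY₁.trans hV').trans hV, hXc, hYc, hXY⟩

theorem sum_add_le_of_good {ι : Type*} (T : Finset ι) (a x y : ι → ℝ) (τ : ℝ) (hτ : 0 ≤ τ)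
    (ha : ∀ p ∈ T, 0 ≤ a p) (hx : ∀ p ∈ T, x p ≤ a p) (hy : ∀ p ∈ T, y p ≤ a p) :
    ∑ p ∈ T, (x p + y p) ≤ (1 + τ) * ∑ p ∈ T, a p +
      ∑ p ∈ T, if τ * a p ≤ x p ∧ τ * a p ≤ y p then a p else 0 := by
  rw [mul_sum, ← sum_add_distrib]
  refine sum_le_sum fun p hp => ?_
  have h1 := hx p hp
  have h2 := hy p hp
  have h3 := mul_nonneg hτ (ha p hp)
  split_ifs with h
  · linarith
  · rw [not_and_or, not_le, not_le] at h
    rcases h with h | h <;> linarith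

/-- If every `v ∈ V` is related to a large weight, then the elements related to many `v` carry a
large weight. -/
theorem le_sum_rich {ι β : Type*} (T : Finset ι) (V : Finset β) (hV : V.Nonempty)
    (good : β → ι → Prop) (a : ι → ℝ) (ha : ∀ p ∈ T, 0 ≤ a p) (τ N : ℝ) (hτ : 0 ≤ τ)
    (hN : ∑ p ∈ T, a p ≤ N / 2) (h : ∀ v ∈ V, τ * N ≤ ∑ p ∈ T, if good v p then a p else 0) :
    τ / 2 * N ≤ ∑ p ∈ T with τ * #V ≤ #{v ∈ V | good v p}, a p := by
  have hV0 : (0 : ℝ) < #V := by exact_mod_cast hV.card_pos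
  have h1 : #V * (τ * N) ≤ ∑ v ∈ V, ∑ p ∈ T, if good v p then a p else 0 := by
    rw [← nsmul_eq_mul]
    exact card_nsmul_le_sum _ _ _ h
  have h2 : ∑ v ∈ V, ∑ p ∈ T, (if good v p then a p else 0) =
      ∑ p ∈ T, #{v ∈ V | good v p} * a p := by
    rw [sum_comm]
    exact sum_congr rfl fun p _ => by rw [← sum_filter, sum_const, nsmul_eq_mul]
  have h3 : ∑ p ∈ T, #{v ∈ V | good v p} * a p ≤
      #V * ∑ p ∈ T with τ * #V ≤ #{v ∈ V | good v p}, a p + τ * #V * ∑ p ∈ T, a p := by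
    rw [sum_filter, mul_sum, mul_sum, ← sum_add_distrib]
    refine sum_le_sum fun p hp => ?_
    have h4 : (#{v ∈ V | good v p} : ℝ) ≤ #V := by
      exact_mod_cast card_filter_le _ _
    have h5 := ha p hp
    have h6 : 0 ≤ τ * #V * a p := by positivity
    split_ifs with h
    · linarith [mul_le_mul_of_nonneg_right h4 h5]
    · linarith [mul_le_mul_of_nonneg_right (not_le.1 h).le h5]
  have h7 : τ * #V * ∑ p ∈ T, a p ≤ τ * #V * (N / 2) := by gcongr
  refine le_of_mul_le_mul_left ?_ hV0
  linarith

set_option maxHeartbeats 800000 in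
/-- A maximal tiling that leaves a positive proportion uncovered can be refined to a tiling
that covers more. -/
theorem exists_larger_tiling (δ η : ℝ) (hδ : 0 < δ) (hδ1 : δ ≤ 1 / 2) (hη : 0 < η) (s : ℕ)
    (hs : 0 < s) :
    ∃ s' : ℕ, s ≤ s' ∧ ∀ S : ℕ, s' ≤ S → ∃ K : ℕ, ∀ (β : Type) (G : SimpleGraph β)
      (U : Finset β) (T : Finset (Finset β × Finset β)), DiracOn G δ U → K ≤ #U →
      IsTiling G U s' S T → (∀ T', IsTiling G U s' S T' → #(tiled T') ≤ #(tiled T)) →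
      (#(tiled T) : ℝ) < (1 - η) * #U →
      ∃ T', IsTiling G U s S T' ∧
        #(tiled T) + min (δ ^ 2 / 4) (δ * η / 8) * #U ≤ (#(tiled T') : ℝ) := by
  set γ := min (δ ^ 2 / 4) (δ * η / 8) with hγ
  obtain ⟨s₁, hs₁⟩ := exists_nat_ge (s / (δ / 2))
  refine ⟨max s₁ (2 * s + 2), by omega, fun S hS => ?_⟩
  set s' := max s₁ (2 * s + 2) with hs'
  have hs'1 : (s : ℝ) ≤ δ / 2 * s' := by
    rw [div_le_iff₀ (by positivity)] at hs₁
    have : (s₁ : ℝ) ≤ s' := by exact_mod_cast le_max_left _ _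
    nlinarith
  have hs'2 : 2 * s + 2 ≤ s' := le_max_right _ _
  obtain ⟨m, K₁, hmK⟩ := exists_completePair_of_dense (δ / 4) (by positivity) s' (by omega)
  obtain ⟨K₂, hK₂⟩ := exists_nat_ge (2 * m / η)
  obtain ⟨K₃, hK₃⟩ := exists_nat_ge (2 * S * 2 ^ S / (δ * η / 8))
  rw [div_le_iff₀ (by positivity)] at hK₂ hK₃
  refine ⟨max (max K₁ 1) (max K₂ K₃), fun β G U T hD hU hT hmax hcov => ?_⟩
  have hUK₁ : K₁ ≤ #U := by omega
  have hU0 : (0 : ℝ) < #U := by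
    have : 0 < #U := by omega
    exact_mod_cast this
  have hUK₂ : (K₂ : ℝ) ≤ #U := by
    have : K₂ ≤ #U := by omega
    exact_mod_cast this
  have hUK₃ : (K₃ : ℝ) ≤ #U := by
    have : K₃ ≤ #U := by omega
    exact_mod_cast this
  set N := #U with hN
  set L := U \ tiled T with hL
  have hLc : η * N < #L := by
    have h1 : #L + #(tiled T) = N := by
      rw [hL, card_sdiff_add_card_eq_card hT.tiled_subset]
    have h2 : (#L : ℝ) + #(tiled T) = N := by exact_mod_cast h1
    linarith
  set B := L.filter fun v => δ / 4 * N ≤ #(nbrsIn G v L) with hB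
  have hBm : #B < m := by
    by_contra hBm
    obtain ⟨X, hX, Y, hY, hXc, hYc, hXY⟩ := hmK β G L B N hUK₁ (card_le_card sdiff_subset)
      (filter_subset _ _) (not_lt.1 hBm) fun v hv => (mem_filter.1 hv).2
    have hd : Disjoint (X ∪ Y) (tiled T) :=
      disjoint_of_subset_left (union_subset hX hY) sdiff_disjoint
    have := hmax _ (hT.insert (hX.trans sdiff_subset) (hY.trans sdiff_subset) (by omega)
      (by omega) (by omega) hXY hd)
    rw [IsTiling.tiled_insert, card_union_of_disjoint hd, card_union_of_disjoint hXY.disjoint]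
      at this
    omega
  set V := L \ B with hV
  have hVc : η / 2 * N ≤ #V := by
    have h1 : #V + #B = #L := card_sdiff_add_card_eq_card (filter_subset _ _)
    have h2 : (#V : ℝ) + #B = #L := by exact_mod_cast h1
    have h3 : (#B : ℝ) < m := by exact_mod_cast hBm
    nlinarith
  have hV0 : (0 : ℝ) < #V := lt_of_lt_of_le (by positivity) hVc
  obtain ⟨good, hgood⟩ : ∃ good : β → Finset β × Finset β → Prop, ∀ v p, good v p ↔
    δ / 2 * #p.1 ≤ #(nbrsIn G v p.1) ∧ δ / 2 * #p.1 ≤ #(nbrsIn G v p.2) :=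
    ⟨_, fun _ _ => Iff.rfl⟩
  have hσ : ∑ p ∈ T, (#p.1 : ℝ) ≤ N / 2 := by
    have h1 := hT.card_tiled
    have h2 := card_le_card hT.tiled_subset
    rw [h1, ← mul_sum] at h2
    have : 2 * ∑ p ∈ T, (#p.1 : ℝ) ≤ N := by exact_mod_cast h2
    linarith
  have hgoodV : ∀ v ∈ V, δ / 2 * N ≤ ∑ p ∈ T, if good v p then (#p.1 : ℝ) else 0 := by
    intro v hv
    have hvL := (mem_sdiff.1 hv).1
    have hvU : v ∈ U := (mem_sdiff.1 hvL).1
    have hlow : (#(nbrsIn G v L) : ℝ) < δ / 4 * N := by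
      by_contra h
      exact (mem_sdiff.1 hv).2 (mem_filter.2 ⟨hvL, not_lt.1 h⟩)
    have h1 : #(nbrsIn G v U) ≤ #(nbrsIn G v L) +
        ∑ p ∈ T, (#(nbrsIn G v p.1) + #(nbrsIn G v p.2)) := by
      have : nbrsIn G v U ⊆ nbrsIn G v L ∪ T.biUnion fun p => nbrsIn G v p.1 ∪ nbrsIn G v p.2 := by
        intro x hx
        obtain ⟨hxU, hvx⟩ := mem_nbrsIn.1 hx
        by_cases hxT : x ∈ tiled T
        · obtain ⟨p, hp, hxp⟩ := mem_biUnion.1 hxT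
          refine mem_union_right _ (mem_biUnion.2 ⟨p, hp, ?_⟩)
          simp only [mem_union, mem_nbrsIn] at hxp ⊢
          tauto
        · exact mem_union_left _ (mem_nbrsIn.2 ⟨mem_sdiff.2 ⟨hxU, hxT⟩, hvx⟩)
      refine ((card_le_card this).trans (card_union_le _ _)).trans ?_
      gcongr
      exact card_biUnion_le.trans (sum_le_sum fun p _ => card_union_le _ _)
    have h2 : (#(nbrsIn G v U) : ℝ) ≤ #(nbrsIn G v L) +
        ∑ p ∈ T, ((#(nbrsIn G v p.1) : ℝ) + #(nbrsIn G v p.2)) := by exact_mod_cast h1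
    have h3 := sum_add_le_of_good T (fun p => (#p.1 : ℝ)) (fun p => (#(nbrsIn G v p.1) : ℝ))
      (fun p => (#(nbrsIn G v p.2) : ℝ)) (δ / 2) (by positivity) (fun p _ => by positivity)
      (fun p _ => by exact_mod_cast card_le_card (nbrsIn_subset _ _ _))
      (fun p hp => by
        rw [hT.card_eq p hp]
        exact_mod_cast card_le_card (nbrsIn_subset _ _ _))
    have h8 : (1 + δ / 2) * ∑ p ∈ T, (#p.1 : ℝ) ≤ (1 + δ / 2) * (N / 2) := by gcongr
    have h7 := hD v hvU
    have h9 : 0 ≤ δ * (N : ℝ) := by positivity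
    simp only [hgood]
    linarith
  set rich := T.filter fun p => δ / 2 * #V ≤ #(V.filter fun v => good v p) with hrich
  have hrichσ : δ / 4 * N ≤ ∑ p ∈ rich, (#p.1 : ℝ) := by
    have h := le_sum_rich T V (card_pos.1 (by exact_mod_cast hV0)) good
      (fun p => (#p.1 : ℝ)) (fun p _ => by positivity) (δ / 2) N (by positivity) hσ hgoodV
    exact (by ring : δ / 4 * (N : ℝ) = δ / 2 / 2 * N).trans_le h
  have main : ∀ P ⊆ rich, ∃ T', IsTiling G U s S T' ∧ tiled T ⊆ tiled T' ∧
      (∀ p ∈ T, p ∉ P → p ∈ T') ∧ (#(tiled T) + γ * N ≤ (#(tiled T') : ℝ) ∨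
        #(tiled T) + ∑ p ∈ P, δ * (#p.1 : ℝ) ≤ (#(tiled T') : ℝ)) := by
    intro P
    induction P using Finset.induction_on with
    | empty => exact fun _ => ⟨T, hT.mono (by omega) le_rfl, le_rfl, fun p hp _ => hp, by simp⟩
    | insert p P hpP ih =>
      intro hsub
      obtain ⟨T', hT', hTT', hkeep, hgain⟩ := ih ((subset_insert _ _).trans hsub)
      by_cases hg : #(tiled T) + γ * N ≤ (#(tiled T') : ℝ)
      · exact ⟨T', hT', hTT', fun q hq hqP => hkeep q hq fun h => hqP (mem_insert_of_mem h),
          Or.inl hg⟩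
      replace hgain := hgain.resolve_left hg
      obtain ⟨hpT, hpr⟩ := mem_filter.1 (hsub (mem_insert_self _ _))
      have hpT' := hkeep p hpT hpP
      set A := V.filter (fun v => good v p) \ tiled T' with hA
      have hAc : (#(V.filter fun v => good v p) : ℝ) ≤ #A + γ * N := by
        have h1 : #(V.filter fun v => good v p) ≤ #A + #(tiled T' \ tiled T) := by
          refine (card_le_card ?_).trans (card_union_le _ _)
          intro v hv
          by_cases hvT : v ∈ tiled T'
          · refine mem_union_right _ (mem_sdiff.2 ⟨hvT, ?_⟩)
            exact (mem_sdiff.1 (mem_sdiff.1 (mem_filter.1 hv).1).1).2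
          · exact mem_union_left _ (mem_sdiff.2 ⟨hv, hvT⟩)
        have h2 : #(tiled T' \ tiled T) + #(tiled T) = #(tiled T') :=
          card_sdiff_add_card_eq_card hTT'
        have h1' : (#(V.filter fun v => good v p) : ℝ) ≤ #A + #(tiled T' \ tiled T) := by
          exact_mod_cast h1
        have h2' : (#(tiled T' \ tiled T) : ℝ) + #(tiled T) = #(tiled T') := by exact_mod_cast h2
        linarith
      have hAlow : δ * η / 8 * N ≤ #A := by
        have h1 : γ ≤ δ * η / 8 := min_le_right _ _
        have h2 : γ * N ≤ δ * η / 8 * N := by gcongr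
        have h3 : δ / 2 * (η / 2 * N) ≤ δ / 2 * #V := by gcongr
        linarith
      have hps := hT.le_card p hpT
      have hps' : (s' : ℝ) ≤ #p.1 := by exact_mod_cast hps
      have hpS := hT.card_le p hpT
      set t := ⌈δ / 2 * (#p.1 : ℝ)⌉₊ with ht
      have ht1 : δ / 2 * (#p.1 : ℝ) ≤ t := Nat.le_ceil _
      have ht2 : (t : ℝ) < δ / 2 * (#p.1 : ℝ) + 1 := Nat.ceil_lt_add_one (by positivity)
      have hst : s ≤ t := by
        have h1 : δ / 2 * (s' : ℝ) ≤ δ / 2 * #p.1 := by gcongr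
        have : (s : ℝ) ≤ t := by linarith
        exact_mod_cast this
      have hst' : s + t ≤ #p.1 := by
        have h1 : (2 * s + 2 : ℝ) ≤ s' := by exact_mod_cast hs'2
        have h2 : δ / 2 * (#p.1 : ℝ) ≤ 1 / 4 * #p.1 :=
          mul_le_mul_of_nonneg_right (by linarith) (Nat.cast_nonneg _)
        have : (s : ℝ) + t ≤ #p.1 := by linarith
        exact_mod_cast this
      have hAS : 2 * t * 2 ^ S ≤ #A := by
        have h1 : (t : ℝ) ≤ S := by
          have : t ≤ S := by omega
          exact_mod_cast this
        have h2 : ((2 * t * 2 ^ S : ℕ) : ℝ) ≤ #A := by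
          push_cast
          calc 2 * (t : ℝ) * 2 ^ S ≤ 2 * S * 2 ^ S := by gcongr
            _ ≤ K₃ * (δ * η / 8) := hK₃
            _ ≤ N * (δ * η / 8) := by gcongr
            _ ≤ _ := by linarith
        exact_mod_cast h2
      have hAU : A ⊆ U \ tiled T' := by
        intro v hv
        obtain ⟨hv, hvT⟩ := mem_sdiff.1 hv
        exact mem_sdiff.2 ⟨(mem_sdiff.1 (mem_sdiff.1 (mem_filter.1 hv).1).1).1, hvT⟩
      have hgA : ∀ v ∈ A, good v p := fun v hv => (mem_filter.1 (mem_sdiff.1 hv).1).2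
      obtain ⟨T'', hT'', hTT'', hc, hk⟩ := hT'.exchange hpT' hAU hst hst' (by omega)
        (fun v hv => Nat.ceil_le.2 ((hgood v p).1 (hgA v hv)).1)
        (fun v hv => Nat.ceil_le.2 ((hgood v p).1 (hgA v hv)).2) hAS
      refine ⟨T'', hT'', hTT'.trans hTT'', fun q hq hqP => ?_, Or.inr ?_⟩
      · rw [mem_insert, not_or] at hqP
        exact hk q (hkeep q hq hqP.2) hqP.1
      · rw [sum_insert hpP, hc]
        push_cast
        linarith
  obtain ⟨T', hT', -, -, h | h⟩ := main rich le_rfl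
  · exact ⟨T', hT', h⟩
  · refine ⟨T', hT', le_trans ?_ h⟩
    rw [← mul_sum]
    have h1 : γ ≤ δ ^ 2 / 4 := min_le_left _ _
    refine add_le_add_right ?_ _
    calc γ * N ≤ δ ^ 2 / 4 * N := by gcongr
      _ = δ * (δ / 4 * N) := by ring
      _ ≤ _ := by gcongr

/-- Graphs of minimum degree above one half of their order have almost perfect tilings by
balanced complete bipartite graphs of bounded size. -/
theorem exists_tiling (δ η : ℝ) (hδ : 0 < δ) (hδ1 : δ ≤ 1 / 2) (hη : 0 < η) (s : ℕ)
    (hs : 0 < s) :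
    ∃ K S : ℕ, ∀ (β : Type) [Fintype β] (G : SimpleGraph β) (U : Finset β), DiracOn G δ U →
      K ≤ #U → ∃ T, IsTiling G U s S T ∧ (1 - η) * #U ≤ (#(tiled T) : ℝ) := by
  set γ := min (δ ^ 2 / 4) (δ * η / 8) with hγ
  have hγ0 : 0 < γ := lt_min (by positivity) (by positivity)
  have main : ∀ i : ℕ, ∀ s : ℕ, 0 < s → ∃ K S : ℕ, ∀ (β : Type) [Fintype β]
      (G : SimpleGraph β) (U : Finset β), DiracOn G δ U → K ≤ #U →
      ∃ T, IsTiling G U s S T ∧ min (i * γ * #U) ((1 - η) * #U) ≤ (#(tiled T) : ℝ) := by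
    intro i
    induction i with
    | zero =>
      refine fun s _ => ⟨0, 0, fun β _ G U _ _ => ⟨∅, ?_, ?_⟩⟩
      · constructor <;> simp
      · simp [tiled]
    | succ i ih =>
      intro s hs
      obtain ⟨s', hss', h⟩ := exists_larger_tiling δ η hδ hδ1 hη s hs
      obtain ⟨K₁, S, h₁⟩ := ih s' (by omega)
      obtain ⟨K₂, h₂⟩ := h (max S s') (le_max_right _ _)
      refine ⟨max K₁ K₂, max S s', fun β _ G U hD hU => ?_⟩
      obtain ⟨T₀, hT₀, hc₀⟩ := h₁ β G U hD (by omega)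
      obtain ⟨T, hT, hc, hmax⟩ := (hT₀.mono le_rfl (le_max_left S s')).exists_maximal
      have hc' : min (i * γ * #U) ((1 - η) * #U) ≤ (#(tiled T) : ℝ) :=
        hc₀.trans (by exact_mod_cast hc)
      by_cases hcov : (#(tiled T) : ℝ) < (1 - η) * #U
      · obtain ⟨T', hT', hg⟩ := h₂ β G U T hD (by omega) hT hmax hcov
        refine ⟨T', hT', (min_le_left _ _).trans ?_⟩
        have h3 : i * γ * #U ≤ (#(tiled T) : ℝ) := by
          rcases min_le_iff.1 hc' with h | h
          · exact h
          · linarith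
        push_cast
        linarith
      · exact ⟨T, hT.mono hss' le_rfl, (min_le_right _ _).trans (not_lt.1 hcov)⟩
  obtain ⟨i, hi⟩ := exists_nat_ge (1 / γ)
  obtain ⟨K, S, h⟩ := main i s hs
  refine ⟨K, S, fun β _ G U hD hU => ?_⟩
  obtain ⟨T, hT, hc⟩ := h β G U hD hU
  refine ⟨T, hT, le_trans (le_min ?_ le_rfl) hc⟩
  rw [div_le_iff₀ hγ0] at hi
  have : (0 : ℝ) ≤ #U := Nat.cast_nonneg _
  nlinarith

end Tiling

section Subtree

variable {α : Type} {π : α → α} {d : α → ℕ} {S : Finset α} {r : α}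

/-- The descendants of `x` in `S`. -/
noncomputable def branch (π : α → α) (d : α → ℕ) (S : Finset α) (x : α) : Finset α :=
  S.filter fun j => d x ≤ d j ∧ π^[d j - d x] j = x

theorem branch_subset (x : α) : branch π d S x ⊆ S := filter_subset _ _

theorem mem_branch_self {x : α} (hx : x ∈ S) : x ∈ branch π d S x :=
  mem_filter.2 ⟨hx, le_rfl, by simp⟩

theorem le_of_mem_branch {x j : α} (hj : j ∈ branch π d S x) : d x ≤ d j := (mem_filter.1 hj).2.1

theorem eq_of_mem_branch {x j : α} (hj : j ∈ branch π d S x) (h : d j ≤ d x) : j = x := by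
  have := (mem_filter.1 hj).2.2
  rwa [Nat.sub_eq_zero_of_le h, Function.iterate_zero, id] at this

theorem disjoint_branch {x y : α} (hd : d x = d y) (hxy : x ≠ y) :
    Disjoint (branch π d S x) (branch π d S y) := by
  rw [Finset.disjoint_left]
  intro j hx hy
  have h1 := (mem_filter.1 hx).2.2
  have h2 := (mem_filter.1 hy).2.2
  rw [hd] at h1
  exact hxy (h1.symm.trans h2)

namespace IsSubtree

theorem depth_lt (h : IsSubtree π d S r) {x : α} (hx : x ∈ S) (hxr : x ≠ r) : d r < d x := by
  induction hk : d x using Nat.strong_induction_on generalizing x with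
  | _ k ih =>
    have h1 := h.depth_eq x hx hxr
    by_cases hp : π x = r
    · rw [hp] at h1
      omega
    · have := ih (d (π x)) (by omega) (h.parent_mem x hx hxr) hp rfl
      omega

theorem depth_le (h : IsSubtree π d S r) {x : α} (hx : x ∈ S) : d r ≤ d x := by
  by_cases hxr : x = r
  · rw [hxr]
  · exact (h.depth_lt hx hxr).le

theorem iterate_eq (h : IsSubtree π d S r) {x j : α} (hj : j ∈ S) (hjr : j ≠ r)
    (hx : d x < d j) : π^[d j - d x] j = π^[d (π j) - d x] (π j) := by
  have h1 := h.depth_eq j hj hjr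
  rw [show d j - d x = (d (π j) - d x) + 1 by omega, Function.iterate_succ_apply]

theorem mem_branch_iff_parent (h : IsSubtree π d S r) {x j : α} (hj : j ∈ S) (hjr : j ≠ r)
    (hx : d x < d j) : j ∈ branch π d S x ↔ π j ∈ branch π d S x := by
  have h1 := h.depth_eq j hj hjr
  simp only [branch, mem_filter, hj, h.parent_mem j hj hjr, true_and, h.iterate_eq hj hjr hx]
  constructor
  · exact fun h => ⟨by omega, h.2⟩
  · exact fun h => ⟨by omega, h.2⟩

theorem mem_branch_of_parent (h : IsSubtree π d S r) {x j : α} (hj : j ∈ S) (hjr : j ≠ r)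
    (hp : π j ∈ branch π d S x) : j ∈ branch π d S x := by
  have h1 := h.depth_eq j hj hjr
  have h2 := le_of_mem_branch hp
  exact (h.mem_branch_iff_parent hj hjr (by omega)).2 hp

theorem branch_root (h : IsSubtree π d S r) : branch π d S r = S := by
  refine (branch_subset r).antisymm fun j hj => ?_
  induction hk : d j using Nat.strong_induction_on generalizing j with
  | _ k ih =>
    by_cases hjr : j = r
    · rw [hjr]; exact mem_branch_self h.root_mem
    · have h1 := h.depth_eq j hj hjr
      exact h.mem_branch_of_parent hj hjr
        (ih _ (by omega) _ (h.parent_mem j hj hjr) rfl)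

protected theorem branch (h : IsSubtree π d S r) {x : α} (hx : x ∈ S) :
    IsSubtree π d (branch π d S x) x := by
  have key : ∀ j ∈ branch π d S x, j ≠ x → d x < d j ∧ j ≠ r := by
    intro j hj hjx
    have h1 : d x < d j := by
      by_contra h1
      exact hjx (eq_of_mem_branch hj (not_lt.1 h1))
    refine ⟨h1, ?_⟩
    rintro rfl
    have := h.depth_le hx
    omega
  refine ⟨mem_branch_self hx, fun j hj hjx => ?_, fun j hj hjx => ?_⟩
  · obtain ⟨h1, h2⟩ := key j hj hjx
    exact (h.mem_branch_iff_parent (branch_subset _ hj) h2 h1).1 hj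
  · exact h.depth_eq j (branch_subset _ hj) (key j hj hjx).2

theorem sdiff_branch (h : IsSubtree π d S r) {x : α} (hx : x ∈ S) (hxr : x ≠ r) :
    IsSubtree π d (S \ branch π d S x) r := by
  refine ⟨mem_sdiff.2 ⟨h.root_mem, fun h' => ?_⟩, fun j hj hjr => ?_, fun j hj hjr => ?_⟩
  · have := le_of_mem_branch h'
    have := h.depth_lt hx hxr
    omega
  · rw [mem_sdiff] at hj ⊢
    exact ⟨h.parent_mem j hj.1 hjr, fun h' => hj.2 (h.mem_branch_of_parent hj.1 hjr h')⟩
  · exact h.depth_eq j (mem_sdiff.1 hj).1 hjr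

theorem parent_notMem_branch (h : IsSubtree π d S r) {x : α} (hx : x ∈ S) (hxr : x ≠ r) :
    π x ∉ branch π d S x := fun h' => by
  have := le_of_mem_branch h'
  have := h.depth_eq x hx hxr
  omega

theorem branch_eq (h : IsSubtree π d S r) {x : α} (hx : x ∈ S) :
    branch π d S x = insert x ({y ∈ S | y ≠ r ∧ π y = x}.biUnion (branch π d S)) := by
  ext j
  simp only [mem_insert, mem_biUnion, mem_filter]
  constructor
  · intro hj
    induction hk : d j using Nat.strong_induction_on generalizing j with
    | _ k ih =>
      by_cases hjx : j = x
      · exact Or.inl hjx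
      right
      have hB := h.branch hx
      have hjS := branch_subset _ hj
      have hjr : j ≠ r := by
        rintro rfl
        have := hB.depth_lt hj hjx
        have := h.depth_le hx
        omega
      have h1 := h.depth_eq j hjS hjr
      rcases ih (d (π j)) (by omega) _ (hB.parent_mem j hj hjx) rfl with h2 | ⟨y, hy, h2⟩
      · exact ⟨j, ⟨hjS, hjr, h2⟩, mem_branch_self hjS⟩
      · exact ⟨y, hy, h.mem_branch_of_parent hjS hjr h2⟩
  · rintro (rfl | ⟨y, ⟨hy, hyr, rfl⟩, hj⟩)
    · exact mem_branch_self hx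
    · have hB := h.branch hy
      have h0 := h.mem_branch_of_parent hy hyr (mem_branch_self hx)
      have h1 := h.depth_eq y hy hyr
      induction hk : d j using Nat.strong_induction_on generalizing j with
      | _ k ih =>
        by_cases hjy : j = y
        · rwa [hjy]
        · have h2 := hB.depth_eq j hj hjy
          have h3 := hB.depth_lt hj hjy
          refine h.mem_branch_of_parent (branch_subset _ hj) ?_
            (ih (d (π j)) (by omega) _ (hB.parent_mem j hj hjy) rfl)
          rintro rfl
          have := h.depth_le hy
          omega

/-- A large tree of bounded degree has a branch of prescribed order up to a constant factor. -/
theorem exists_branch (h : IsSubtree π d S r) [Fintype α] {Δ t : ℕ}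
    (hΔ : ∀ i, #{j | π j = i} ≤ Δ) (hΔ1 : 1 ≤ Δ) (ht : 1 ≤ t) (hS : Δ * t < #S) :
    ∃ x ∈ S, x ≠ r ∧ t ≤ #(branch π d S x) ∧ #(branch π d S x) ≤ Δ * t := by
  have hne : {x ∈ S | t ≤ #(branch π d S x)}.Nonempty := by
    refine ⟨r, mem_filter.2 ⟨h.root_mem, ?_⟩⟩
    rw [h.branch_root]
    nlinarith
  obtain ⟨x, hx, hmin⟩ := exists_min_image _ (fun x => #(branch π d S x)) hne
  obtain ⟨hxS, hxt⟩ := mem_filter.1 hx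
  have hle : #(branch π d S x) ≤ Δ * t := by
    have hch : ∀ y ∈ ({y ∈ S | y ≠ r ∧ π y = x} : Finset α), #(branch π d S y) ≤ t - 1 := by
      intro y hy
      by_contra hyt
      have hyS := (mem_filter.1 hy).1
      have h1 := hmin y (mem_filter.2 ⟨hyS, by omega⟩)
      have h2 : branch π d S y ⊂ branch π d S x := by
        refine (ssubset_iff_of_subset ?_).2 ⟨x, mem_branch_self hxS, ?_⟩
        · rw [h.branch_eq hxS]
          exact (subset_biUnion_of_mem (branch π d S) hy).trans (subset_insert _ _)
        · have h3 := (mem_filter.1 hy).2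
          rw [← h3.2]
          exact h.parent_notMem_branch hyS h3.1
      have := card_lt_card h2
      omega
    have hc : #({y ∈ S | y ≠ r ∧ π y = x} : Finset α) ≤ Δ := by
      refine (card_le_card fun y hy => ?_).trans (hΔ x)
      simp only [mem_filter, mem_univ, true_and] at hy ⊢
      exact hy.2.2
    calc #(branch π d S x)
        ≤ #({y ∈ S | y ≠ r ∧ π y = x}.biUnion (branch π d S)) + 1 := by
          rw [h.branch_eq hxS]
          exact card_insert_le _ _
      _ ≤ #({y ∈ S | y ≠ r ∧ π y = x} : Finset α) * (t - 1) + 1 := by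
          gcongr
          exact card_biUnion_le_card_mul _ _ _ hch
      _ ≤ Δ * (t - 1) + Δ := by gcongr
      _ = Δ * t := by
          obtain ⟨t, rfl⟩ := Nat.exists_eq_add_of_le' ht
          simp [mul_add]
  refine ⟨x, hxS, ?_, hxt, hle⟩
  rintro rfl
  rw [h.branch_root] at hle
  omega

end IsSubtree

end Subtree

/-- A finite set injects into any finite set that is at least as large. -/
theorem exists_injOn_of_card_le {α β : Type*} [Nonempty β] {X : Finset α} {Y : Finset β}
    (h : #X ≤ #Y) : ∃ f : α → β, (∀ x ∈ X, f x ∈ Y) ∧ Set.InjOn f X := by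
  obtain ⟨Z, hZ, hZc⟩ := exists_subset_card_eq h
  obtain ⟨f, hf⟩ := (X.finite_toSet).exists_bijOn_of_encard_eq (t := (Z : Set β))
    (by simp [hZc])
  exact ⟨f, fun x hx => hZ (hf.1 hx), hf.2.1⟩

section Sampling

/-- Almost all `k`-subsets of `U` meet each member of a small family of subsets of `U` about
proportionally. -/
theorem card_filter_exists_inter_lt_le {ι β : Type*} (I : Finset ι) (U : Finset β)
    (A : ι → Finset β) (hA : ∀ i ∈ I, A i ⊆ U) (k : ℕ) (hk : k ≤ #U) (t : ℝ) (ht : 0 ≤ t) :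
    (#{W ∈ powersetCard k U | ∃ i ∈ I, (#(A i ∩ W) : ℝ) < ((#(A i) : ℝ) / #U - t) * k} : ℝ) ≤
      #I * ((#U + 1) * Real.exp (-(t ^ 2 * k / 2))) * (#U).choose k := by
  have h : {W ∈ powersetCard k U | ∃ i ∈ I, (#(A i ∩ W) : ℝ) < ((#(A i) : ℝ) / #U - t) * k} ⊆
      I.biUnion fun i =>
        {W ∈ powersetCard k U | (#(A i ∩ W) : ℝ) < ((#(A i) : ℝ) / #U - t) * k} := by
    intro W hW
    obtain ⟨hW, i, hi, hlt⟩ := mem_filter.1 hW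
    exact mem_biUnion.2 ⟨i, hi, mem_filter.2 ⟨hW, hlt⟩⟩
  calc (#{W ∈ powersetCard k U | ∃ i ∈ I, (#(A i ∩ W) : ℝ) < ((#(A i) : ℝ) / #U - t) * k} : ℝ)
      ≤ ∑ i ∈ I, (#{W ∈ powersetCard k U |
          (#(A i ∩ W) : ℝ) < ((#(A i) : ℝ) / #U - t) * k} : ℝ) := by
        exact_mod_cast (card_le_card h).trans card_biUnion_le
    _ ≤ ∑ i ∈ I, (#U + 1) * Real.exp (-(t ^ 2 * k / 2)) * (#U).choose k :=
        sum_le_sum fun i hi => card_filter_inter_lt_le U (A i) (hA i hi) k hk t ht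
    _ = _ := by rw [sum_const, nsmul_eq_mul]; ring

/-- A subset meeting each member of a small family of subsets about proportionally exists. -/
theorem exists_proportional_subset (c t : ℝ) (hc : 0 < c) (ht : 0 < t) (B : ℕ) :
    ∃ K : ℕ, ∀ (ι β : Type) (I : Finset ι) (U : Finset β) (A : ι → Finset β) (k : ℕ),
      (∀ i ∈ I, A i ⊆ U) → K ≤ #U → #I ≤ #U + B → k ≤ #U → c * #U ≤ k →
      ∃ W ⊆ U, #W = k ∧ ∀ i ∈ I, ((#(A i) : ℝ) / #U - t) * k ≤ #(A i ∩ W) := by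
  have hlim : Filter.Tendsto (fun m : ℕ => ((m : ℝ) + B) * ((m + 1) *
      Real.exp (-(t ^ 2 * c / 2 * m)))) Filter.atTop (nhds 0) := by
    have h : ∀ j : ℕ, Filter.Tendsto (fun m : ℕ => (m : ℝ) ^ j *
        Real.exp (-(t ^ 2 * c / 2 * m))) Filter.atTop (nhds 0) := fun j => by
      have := (Real.tendsto_pow_mul_exp_neg_atTop_nhds_zero j).comp
        ((tendsto_natCast_atTop_atTop (R := ℝ)).const_mul_atTop
          (show 0 < t ^ 2 * c / 2 by positivity))
      have h2 := this.const_mul ((t ^ 2 * c / 2) ^ j)⁻¹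
      rw [mul_zero] at h2
      refine h2.congr fun m => ?_
      simp only [Function.comp_apply, mul_pow]
      field_simp
    have := (h 2).add (((h 1).const_mul (B + 1 : ℝ)).add ((h 0).const_mul (B : ℝ)))
    simp only [mul_zero, add_zero] at this
    refine this.congr fun m => ?_
    ring
  obtain ⟨K, hK⟩ := Filter.eventually_atTop.1 (hlim.eventually (gt_mem_nhds one_pos))
  refine ⟨K, fun ι β I U A k hA hU hI hk hck => ?_⟩
  by_contra! hcon
  have h1 := card_filter_exists_inter_lt_le I U A hA k hk t ht.le
  rw [filter_true_of_mem, card_powersetCard] at h1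
  · have h2 : (0 : ℝ) < (#U).choose k := by exact_mod_cast Nat.choose_pos hk
    have h3 : (#I : ℝ) * ((#U + 1) * Real.exp (-(t ^ 2 * k / 2))) ≤
        (#U + B) * ((#U + 1) * Real.exp (-(t ^ 2 * c / 2 * #U))) := by
      have h4 : (#I : ℝ) ≤ #U + B := by exact_mod_cast hI
      gcongr
      calc t ^ 2 * c / 2 * #U = t ^ 2 * (c * #U) / 2 := by ring
        _ ≤ _ := by gcongr
    have h5 := hK #U hU
    nlinarith
  · intro W hW
    obtain ⟨hWU, hWk⟩ := mem_powersetCard.1 hW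
    exact hcon W hWU hWk

end Sampling

section AlmostSpanning

variable {α β : Type} {G : SimpleGraph β} {π : α → α} {d : α → ℕ} {r : α}
  {R : Finset β} {T : Finset (Finset β × Finset β)} {M : ℕ} {X P : Finset α} {φ : α → β}

/-- A partial embedding of a tree that sends `P` into the reserve `R` and the other vertices of its
domain `X` into the tiles of `T`, using the two sides of each tile almost equally. -/
structure IsTileEmb (G : SimpleGraph β) (π : α → α) (r : α) (R : Finset β)
    (T : Finset (Finset β × Finset β)) (M : ℕ) (X P : Finset α) (φ : α → β) : Prop where
  subset : P ⊆ X
  inj : Set.InjOn φ X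
  mem_reserve : ∀ i ∈ P, φ i ∈ R
  mem_tiled : ∀ i ∈ X, i ∉ P → φ i ∈ tiled T
  balanced : ∀ p ∈ T, #(p.1 ∩ X.image φ) ≤ #(p.2 ∩ X.image φ) + M ∧
    #(p.2 ∩ X.image φ) ≤ #(p.1 ∩ X.image φ) + M
  parent_mem : ∀ i ∈ X, i ≠ r → π i ∈ X
  adj : ∀ i ∈ X, i ≠ r → G.Adj (φ (π i)) (φ i)

namespace IsTileEmb

theorem empty : IsTileEmb G π r R T M ∅ ∅ φ := by constructor <;> simp

theorem mem_of_mem_reserve (h : IsTileEmb G π r R T M X P φ) (hR : Disjoint R (tiled T)) {i : α}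
    (hi : i ∈ X) (hiR : φ i ∈ R) : i ∈ P := by
  by_contra hP
  exact Finset.disjoint_left.1 hR hiR (h.mem_tiled i hi hP)

theorem extend_single (h : IsTileEmb G π r R T M X P φ) (hR : Disjoint R (tiled T)) {x : α}
    (hx : x ∉ X) {c : β} (hc : c ∈ R) (hcP : c ∉ P.image φ)
    (hpar : x = r ∨ π x ∈ X ∧ G.Adj (φ (π x)) c) :
    IsTileEmb G π r R T M (insert x X) (insert x P) (Function.update φ x c) := by
  have hval : ∀ i ∈ X, Function.update φ x c i = φ i := fun i hi =>
    Function.update_of_ne (by rintro rfl; exact hx hi) _ _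
  have hcX : ∀ i ∈ X, φ i ≠ c := fun i hi e =>
    hcP (mem_image.2 ⟨i, h.mem_of_mem_reserve hR hi (e ▸ hc), e⟩)
  have him : (insert x X).image (Function.update φ x c) = insert c (X.image φ) := by
    rw [image_insert, Function.update_self]
    congr 1
    exact image_congr fun i hi => hval i hi
  have hcT : ∀ p ∈ T, c ∉ p.1 ∧ c ∉ p.2 := by
    intro p hp
    have h1 := Finset.disjoint_left.1 hR hc
    constructor <;> intro h2 <;> exact h1 (mem_biUnion.2 ⟨p, hp, by simp [h2]⟩)
  refine ⟨insert_subset_insert _ h.subset, ?_, ?_, ?_, ?_, ?_, ?_⟩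
  · rw [coe_insert, Set.injOn_insert (by exact_mod_cast hx)]
    refine ⟨fun i hi j hj hij => ?_, ?_⟩
    · rw [hval i hi, hval j hj] at hij
      exact h.inj hi hj hij
    · rintro ⟨i, hi, hic⟩
      rw [Function.update_self, hval i hi] at hic
      exact hcX i hi hic
  · intro i hi
    rcases mem_insert.1 hi with rfl | hi
    · rwa [Function.update_self]
    · rw [hval i (h.subset hi)]
      exact h.mem_reserve i hi
  · intro i hi hiP
    rw [mem_insert, not_or] at hiP
    have hiX := (mem_insert.1 hi).resolve_left hiP.1
    rw [hval i hiX]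
    exact h.mem_tiled i hiX hiP.2
  · intro p hp
    rw [him, inter_insert_of_notMem (hcT p hp).1, inter_insert_of_notMem (hcT p hp).2]
    exact h.balanced p hp
  · intro i hi hir
    rcases mem_insert.1 hi with rfl | hi
    · exact mem_insert_of_mem (hpar.resolve_left hir).1
    · exact mem_insert_of_mem (h.parent_mem i hi hir)
  · intro i hi hir
    rcases mem_insert.1 hi with rfl | hi
    · obtain ⟨h1, h2⟩ := hpar.resolve_left hir
      rwa [Function.update_self, hval _ h1]
    · rw [hval i hi, hval _ (h.parent_mem i hi hir)]
      exact h.adj i hi hir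

theorem extend_rest {U : Finset β} {s S : ℕ} (h : IsTileEmb G π r R T M X P φ)
    (hT : IsTiling G U s S T) {x : α} {Y : Finset α} (hY : IsSubtree π d Y x) (hx : x ∈ X)
    (hd : Disjoint X (Y.erase x)) {A B : Finset β}
    (hAB : (A, B) ∈ T ∨ (B, A) ∈ T) {o e : ℕ}
    (ho : o = #{y ∈ Y.erase x | Odd (d y - d x)}) (he : e = #{y ∈ Y.erase x | ¬ Odd (d y - d x)})
    (hoA : o ≤ #(nbrsIn G (φ x) (A \ X.image φ))) (heB : e ≤ #(B \ X.image φ))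
    (hbal : #(A ∩ X.image φ) + o ≤ #(B ∩ X.image φ) + e + M ∧
      #(B ∩ X.image φ) + e ≤ #(A ∩ X.image φ) + o + M) :
    ∃ φ', IsTileEmb G π r R T M (X ∪ Y.erase x) P φ' ∧ ∀ i ∈ X, φ' i = φ i := by
  set O := {y ∈ Y.erase x | Odd (d y - d x)} with hO
  set E := {y ∈ Y.erase x | ¬ Odd (d y - d x)} with hE
  have : Nonempty β := ⟨φ x⟩
  obtain ⟨f, hf, hfi⟩ := exists_injOn_of_card_le (ho ▸ hoA)
  obtain ⟨g, hg, hgi⟩ := exists_injOn_of_card_le (he ▸ heB)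
  have hfA : ∀ i ∈ O, f i ∈ A ∧ f i ∉ X.image φ ∧ G.Adj (φ x) (f i) := fun i hi => by
    have := mem_nbrsIn.1 (hf i hi)
    exact ⟨(mem_sdiff.1 this.1).1, (mem_sdiff.1 this.1).2, this.2⟩
  have hgB : ∀ i ∈ E, g i ∈ B ∧ g i ∉ X.image φ := fun i hi => mem_sdiff.1 (hg i hi)
  have hOE : ∀ i ∈ Y.erase x, i ∈ O ∨ i ∈ E := fun i hi => by
    by_cases h : Odd (d i - d x)
    · exact Or.inl (mem_filter.2 ⟨hi, h⟩)
    · exact Or.inr (mem_filter.2 ⟨hi, h⟩)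
  have hEO : ∀ i ∈ E, i ∉ O := fun i hi hi' => (mem_filter.1 hi).2 (mem_filter.1 hi').2
  have hOX : ∀ i ∈ X, i ∉ O := fun i hi hi' =>
    Finset.disjoint_left.1 hd hi (mem_filter.1 hi').1
  have hEX : ∀ i ∈ X, i ∉ E := fun i hi hi' =>
    Finset.disjoint_left.1 hd hi (mem_filter.1 hi').1
  have hsub : A ∪ B ⊆ tiled T ∧ CompletePair G A B := by
    rcases hAB with hp | hp
    · exact ⟨fun v hv => mem_biUnion.2 ⟨_, hp, hv⟩, hT.complete _ hp⟩
    · exact ⟨fun v hv => mem_biUnion.2 ⟨_, hp, by rwa [union_comm]⟩,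
        fun a ha b hb => (hT.complete _ hp b hb a ha).symm⟩
  have hdAB := Finset.disjoint_left.1 hsub.2.disjoint
  set φ' : α → β := fun i => if i ∈ O then f i else if i ∈ E then g i else φ i with hφ'
  have vO : ∀ i ∈ O, φ' i = f i := fun i hi => if_pos hi
  have vE : ∀ i ∈ E, φ' i = g i := fun i hi => by
    rw [hφ']; dsimp only; rw [if_neg (hEO i hi), if_pos hi]
  have vX : ∀ i ∈ X, φ' i = φ i := fun i hi => by
    rw [hφ']; dsimp only; rw [if_neg (hOX i hi), if_neg (hEX i hi)]
  have him : (X ∪ Y.erase x).image φ' = X.image φ ∪ (O.image f ∪ E.image g) := by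
    rw [image_union, image_congr fun i hi => vX i hi, ← image_congr fun i hi => vO i hi,
      ← image_congr fun i hi => vE i hi, ← image_union]
    congr 2
    ext i
    exact ⟨fun hi => mem_union.2 (hOE i hi), fun hi => by
      rcases mem_union.1 hi with hi | hi <;> exact (mem_filter.1 hi).1⟩
  have cA : #(A ∩ (X.image φ ∪ (O.image f ∪ E.image g))) = #(A ∩ X.image φ) + o := by
    have : A ∩ (X.image φ ∪ (O.image f ∪ E.image g)) = A ∩ X.image φ ∪ O.image f := by
      ext v
      simp only [mem_inter, mem_union, mem_image]
      grind
    rw [this, card_union_of_disjoint, card_image_of_injOn hfi, ho]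
    rw [Finset.disjoint_right]
    intro v hv hv'
    obtain ⟨i, hi, rfl⟩ := mem_image.1 hv
    exact (hfA i hi).2.1 (mem_inter.1 hv').2
  have cB : #(B ∩ (X.image φ ∪ (O.image f ∪ E.image g))) = #(B ∩ X.image φ) + e := by
    have : B ∩ (X.image φ ∪ (O.image f ∪ E.image g)) = B ∩ X.image φ ∪ E.image g := by
      ext v
      simp only [mem_inter, mem_union, mem_image]
      grind
    rw [this, card_union_of_disjoint, card_image_of_injOn hgi, he]
    rw [Finset.disjoint_right]
    intro v hv hv'
    obtain ⟨i, hi, rfl⟩ := mem_image.1 hv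
    exact (hgB i hi).2 (mem_inter.1 hv').2
  have hfgAB : O.image f ∪ E.image g ⊆ A ∪ B := by
    refine union_subset_union ?_ ?_ <;> intro v hv <;> obtain ⟨i, hi, rfl⟩ := mem_image.1 hv
    exacts [(hfA i hi).1, (hgB i hi).1]
  have hother : ∀ C : Finset β, Disjoint (A ∪ B) C →
      C ∩ (X.image φ ∪ (O.image f ∪ E.image g)) = C ∩ X.image φ := by
    intro C hC
    ext v
    have h1 := @hfgAB v
    have h2 : v ∈ A ∪ B → v ∉ C := fun h => Finset.disjoint_left.1 hC h
    grind
  refine ⟨φ', ⟨h.subset.trans subset_union_left, ?_, ?_, ?_, ?_, ?_, ?_⟩, vX⟩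
  · have hcase : ∀ i ∈ X ∪ Y.erase x, (i ∈ X ∧ φ' i = φ i) ∨ (i ∈ O ∧ φ' i = f i) ∨
        (i ∈ E ∧ φ' i = g i) := by
      intro i hi
      rcases mem_union.1 hi with hi | hi
      · exact Or.inl ⟨hi, vX i hi⟩
      · rcases hOE i hi with hi | hi
        exacts [Or.inr (Or.inl ⟨hi, vO i hi⟩), Or.inr (Or.inr ⟨hi, vE i hi⟩)]
    intro i hi j hj hij
    rcases hcase i (mem_coe.1 hi) with ⟨hi, e1⟩ | ⟨hi, e1⟩ | ⟨hi, e1⟩ <;>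
      rcases hcase j (mem_coe.1 hj) with ⟨hj, e2⟩ | ⟨hj, e2⟩ | ⟨hj, e2⟩ <;>
      rw [e1, e2] at hij
    · exact h.inj hi hj hij
    · exact absurd (mem_image.2 ⟨i, hi, hij⟩) (hfA j hj).2.1
    · exact absurd (mem_image.2 ⟨i, hi, hij⟩) (hgB j hj).2
    · exact absurd (mem_image.2 ⟨j, hj, hij.symm⟩) (hfA i hi).2.1
    · exact hfi hi hj hij
    · exact absurd (hij ▸ (hgB j hj).1) (hdAB (hfA i hi).1)
    · exact absurd (mem_image.2 ⟨j, hj, hij.symm⟩) (hgB i hi).2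
    · exact absurd (hij ▸ (hgB i hi).1) (hdAB (hfA j hj).1)
    · exact hgi hi hj hij
  · intro i hi
    rw [vX i (h.subset hi)]
    exact h.mem_reserve i hi
  · intro i hi hiP
    rcases mem_union.1 hi with hi | hi
    · rw [vX i hi]
      exact h.mem_tiled i hi hiP
    · rcases hOE i hi with hi | hi
      · rw [vO i hi]
        exact hsub.1 (mem_union_left _ (hfA i hi).1)
      · rw [vE i hi]
        exact hsub.1 (mem_union_right _ (hgB i hi).1)
  · intro p hp
    rw [him]
    by_cases h1 : p = (A, B)
    · subst h1
      dsimp only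
      rw [cA, cB]
      exact hbal
    by_cases h2 : p = (B, A)
    · subst h2
      dsimp only
      rw [cA, cB]
      exact hbal.symm
    have hdis : Disjoint (A ∪ B) (p.1 ∪ p.2) := by
      rcases hAB with hq | hq
      · exact hT.disjoint _ hq p hp (Ne.symm h1)
      · rw [union_comm]
        exact hT.disjoint _ hq p hp (Ne.symm h2)
    rw [hother p.1 (disjoint_of_subset_right subset_union_left hdis),
      hother p.2 (disjoint_of_subset_right subset_union_right hdis)]
    exact h.balanced p hp
  · intro i hi hir
    rcases mem_union.1 hi with hi | hi
    · exact mem_union_left _ (h.parent_mem i hi hir)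
    · obtain ⟨hix, hiY⟩ := mem_erase.1 hi
      have h1 := hY.parent_mem i hiY hix
      by_cases h2 : π i = x
      · rw [h2]
        exact mem_union_left _ hx
      · exact mem_union_right _ (mem_erase.2 ⟨h2, h1⟩)
  · intro i hi hir
    rcases mem_union.1 hi with hi | hi
    · rw [vX i hi, vX _ (h.parent_mem i hi hir)]
      exact h.adj i hi hir
    · obtain ⟨hix, hiY⟩ := mem_erase.1 hi
      have h1 := hY.parent_mem i hiY hix
      have h3 := hY.depth_eq i hiY hix
      by_cases h2 : π i = x
      · have hiO : i ∈ O := mem_filter.2 ⟨hi, by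
          rw [h3, h2]
          simp⟩
        rw [h2, vX x hx, vO i hiO]
        exact (hfA i hiO).2.2
      · have h4 : π i ∈ Y.erase x := mem_erase.2 ⟨h2, h1⟩
        have h5 := hY.depth_le h1
        have h6 : d i - d x = (d (π i) - d x) + 1 := by omega
        rcases hOE i hi with hi' | hi' <;> rcases hOE _ h4 with h4' | h4'
        · exact absurd (h6 ▸ (mem_filter.1 hi').2) (by
            have := (mem_filter.1 h4').2
            simpa [Nat.odd_add_one] using this)
        · rw [vO i hi', vE _ h4']
          exact (hsub.2 _ (hfA i hi').1 _ (hgB _ h4').1).symm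
        · rw [vE i hi', vO _ h4']
          exact hsub.2 _ (hfA _ h4').1 _ (hgB i hi').1
        · exact absurd (mem_filter.1 hi').2 (by
            have := (mem_filter.1 h4').2
            rw [h6]
            simpa [Nat.odd_add_one] using this)

end IsTileEmb

/-- If the vertices of `A` have many neighbours in `R`, many vertices of `R` have a positive
proportion of `A` as neighbours. -/
theorem le_card_rich (G : SimpleGraph β) {A R : Finset β} (hA : A.Nonempty) {κ τ : ℝ} (hτ : 0 ≤ τ)
    (h : ∀ a ∈ A, κ * #R ≤ #(nbrsIn G a R)) :
    (κ - τ) * #R ≤ #{c ∈ R | τ * #A ≤ #(nbrsIn G c A)} := by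
  have hA0 : (0 : ℝ) < #A := by exact_mod_cast hA.card_pos
  have hdc : ∑ a ∈ A, #(nbrsIn G a R) = ∑ c ∈ R, #(nbrsIn G c A) := by
    simp only [nbrsIn, card_filter]
    rw [sum_comm]
    simp only [G.adj_comm]
  have h1 : #A * (κ * #R) ≤ ∑ a ∈ A, (#(nbrsIn G a R) : ℝ) := by
    rw [← nsmul_eq_mul]
    exact card_nsmul_le_sum _ _ _ h
  have h2 : ∑ c ∈ R, (#(nbrsIn G c A) : ℝ) ≤
      #{c ∈ R | τ * #A ≤ #(nbrsIn G c A)} * #A + #R * (τ * #A) := by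
    calc ∑ c ∈ R, (#(nbrsIn G c A) : ℝ)
        ≤ ∑ c ∈ R, ((if τ * #A ≤ #(nbrsIn G c A) then (#A : ℝ) else 0) + τ * #A) := by
          refine sum_le_sum fun c _ => ?_
          have h3 : (#(nbrsIn G c A) : ℝ) ≤ #A := by
            exact_mod_cast card_le_card (nbrsIn_subset _ _ _)
          have h4 : 0 ≤ τ * #A := by positivity
          split_ifs with h5
          · linarith
          · linarith
      _ = _ := by
          rw [sum_add_distrib, ← sum_filter, sum_const, sum_const, nsmul_eq_mul, nsmul_eq_mul]
  have h3 : ∑ a ∈ A, (#(nbrsIn G a R) : ℝ) = ∑ c ∈ R, (#(nbrsIn G c A) : ℝ) := by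
    exact_mod_cast hdc
  refine le_of_mul_le_mul_left ?_ hA0
  linarith

/-- The tiles of `T`, whose two sides are complete to each other, together with a reserve `R` into
which every vertex has more than half of all possible neighbours. -/
structure TileEnv (G : SimpleGraph β) (U : Finset β) (s S : ℕ) (T : Finset (Finset β × Finset β))
    (R : Finset β) (τ : ℝ) (m M : ℕ) : Prop where
  tiling : IsTiling G U s S T
  disj : Disjoint R (tiled T)
  reserve_subset : R ⊆ U
  deg : ∀ v ∈ U, (1 / 2 + 2 * τ) * #R ≤ #(nbrsIn G v R)
  pos : 0 < τ
  le_one : τ ≤ 1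
  one_le : 1 ≤ m
  le : (M : ℝ) ≤ τ * m

namespace IsTileEmb

variable {U : Finset β} {s S m : ℕ} {τ : ℝ}

theorem mem_ground (h : IsTileEmb G π r R T M X P φ) (E : TileEnv G U s S T R τ m M) {i : α}
    (hi : i ∈ X) : φ i ∈ U := by
  by_cases hP : i ∈ P
  · exact E.reserve_subset (h.mem_reserve i hP)
  · exact E.tiling.tiled_subset (h.mem_tiled i hi hP)

theorem exists_tile (h : IsTileEmb G π r R T M X P φ) (E : TileEnv G U s S T R τ m M)
    (hcap : (m + M) * #(tiled T) + s * #X < s * #(tiled T)) :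
    ∃ p ∈ T, m ≤ #(p.1 \ X.image φ) ∧ m ≤ #(p.2 \ X.image φ) := by
  by_contra! hcon
  set I := X.image φ with hI
  have h1 : ∀ p ∈ T, s * (2 * #p.1) ≤ s * #((p.1 ∪ p.2) ∩ I) + (m + M) * (2 * #p.1) := by
    intro p hp
    have h2 := h.balanced p hp
    rw [← hI] at h2
    have h3 := hcon p hp
    have h4 := E.tiling.card_eq p hp
    have h5 := E.tiling.le_card p hp
    have h6 : #((p.1 ∪ p.2) ∩ I) = #(p.1 ∩ I) + #(p.2 ∩ I) := by
      rw [union_inter_distrib_right, card_union_of_disjoint]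
      exact disjoint_of_subset_left inter_subset_left
        (disjoint_of_subset_right inter_subset_left (E.tiling.complete p hp).disjoint)
    have h7 := card_sdiff_add_card_inter p.1 I
    have h8 := card_sdiff_add_card_inter p.2 I
    have h9 : 2 * #p.1 ≤ #((p.1 ∪ p.2) ∩ I) + 2 * (m + M) := by
      rw [h6]
      by_cases hm : m ≤ #(p.1 \ I)
      · have := h3 hm
        omega
      · omega
    nlinarith
  have h2 := sum_le_sum h1
  have h3 : ∑ p ∈ T, #((p.1 ∪ p.2) ∩ I) ≤ #X := by
    rw [← card_biUnion fun p hp p' hp' hne => disjoint_of_subset_left inter_subset_left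
      (disjoint_of_subset_right inter_subset_left (E.tiling.disjoint p hp p' hp' hne))]
    exact (card_le_card (biUnion_subset.2 fun p _ => inter_subset_right)).trans card_image_le
  have h4 : ∀ a : ℕ, ∑ p ∈ T, a * (2 * #p.1) = a * #(tiled T) := fun a => by
    rw [E.tiling.card_tiled, mul_sum]
  rw [sum_add_distrib, h4, h4, ← mul_sum] at h2
  nlinarith

theorem extend_piece (h : IsTileEmb G π r R T M X P φ) (E : TileEnv G U s S T R τ m M)
    {x : α} {Y : Finset α} (hY : IsSubtree π d Y x) (hYM : #Y ≤ M)
    (hd : Disjoint X Y) (hcap : (m + M) * #(tiled T) + s * #X < s * #(tiled T))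
    {D : Finset β} (hDR : D ⊆ R) (hD : (1 / 2 + 2 * τ) * #R ≤ #D) (hP : (#P : ℝ) < τ * #R)
    (hpar : x = r ∨ π x ∈ X ∧ ∀ c ∈ D, G.Adj (φ (π x)) c) :
    ∃ φ', IsTileEmb G π r R T M (X ∪ Y) (insert x P) φ' ∧ (∀ i ∈ X, φ' i = φ i) ∧ φ' x ∈ D := by
  obtain ⟨p, hp, hp1, hp2⟩ := h.exists_tile E hcap
  have hbal := h.balanced p hp
  set I := X.image φ with hI
  set o := #{y ∈ Y.erase x | Odd (d y - d x)} with ho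
  set e := #{y ∈ Y.erase x | ¬ Odd (d y - d x)} with he
  have hoM : o ≤ M := (card_filter_le _ _).trans ((card_le_card (erase_subset _ _)).trans hYM)
  have heM : e ≤ M := (card_filter_le _ _).trans ((card_le_card (erase_subset _ _)).trans hYM)
  obtain ⟨A, B, hAB, hA, hB, hbal'⟩ : ∃ A B, ((A, B) ∈ T ∨ (B, A) ∈ T) ∧ m ≤ #(A \ I) ∧
      m ≤ #(B \ I) ∧ (#(A ∩ I) + o ≤ #(B ∩ I) + e + M ∧ #(B ∩ I) + e ≤ #(A ∩ I) + o + M) := by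
    by_cases h1 : o ≤ e <;> by_cases h2 : #(p.1 ∩ I) ≤ #(p.2 ∩ I)
    · exact ⟨p.2, p.1, Or.inr hp, hp2, hp1, by omega⟩
    · exact ⟨p.1, p.2, Or.inl hp, hp1, hp2, by omega⟩
    · exact ⟨p.1, p.2, Or.inl hp, hp1, hp2, by omega⟩
    · exact ⟨p.2, p.1, Or.inr hp, hp2, hp1, by omega⟩
  have hsub : A ⊆ tiled T ∧ B ⊆ tiled T := by
    rcases hAB with hp | hp
    · exact ⟨fun v hv => mem_biUnion.2 ⟨_, hp, mem_union_left _ hv⟩,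
        fun v hv => mem_biUnion.2 ⟨_, hp, mem_union_right _ hv⟩⟩
    · exact ⟨fun v hv => mem_biUnion.2 ⟨_, hp, mem_union_right _ hv⟩,
        fun v hv => mem_biUnion.2 ⟨_, hp, mem_union_left _ hv⟩⟩
  have hm := E.one_le
  have hτ := E.pos
  have hrich := le_card_rich G (A := A \ I) (card_pos.1 (by omega)) hτ.le fun a ha =>
    E.deg a (E.tiling.tiled_subset (hsub.1 (mem_sdiff.1 ha).1))
  set N := {c ∈ R | τ * #(A \ I) ≤ #(nbrsIn G c (A \ I))} with hN
  have hDN : #D + #N ≤ #(D ∩ N) + #R := le_card_inter hDR (filter_subset _ _)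
  have hDN' : (#D : ℝ) + #N ≤ #(D ∩ N) + #R := by exact_mod_cast hDN
  have hR0 : (0 : ℝ) ≤ τ * #R := by positivity
  obtain ⟨c, hc, hcP⟩ : ∃ c ∈ D ∩ N, c ∉ P.image φ := by
    refine exists_mem_notMem_of_card_lt_card ?_
    have h1 : #(P.image φ) ≤ #P := card_image_le
    have h2 : (#P : ℝ) < #(D ∩ N) := by linarith
    have h3 : #P < #(D ∩ N) := by exact_mod_cast h2
    omega
  obtain ⟨hcD, hcN⟩ := mem_inter.1 hc
  have hcR := hDR hcD
  have hxX : x ∉ X := Finset.disjoint_right.1 hd hY.root_mem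
  have h1 := h.extend_single E.disj hxX hcR hcP (hpar.imp id fun h => ⟨h.1, h.2 c hcD⟩)
  have hval : ∀ i ∈ X, Function.update φ x c i = φ i := fun i hi =>
    Function.update_of_ne (by rintro rfl; exact hxX hi) _ _
  have him : (insert x X).image (Function.update φ x c) = insert c I := by
    rw [image_insert, Function.update_self]
    congr 1
    exact image_congr fun i hi => hval i hi
  have hcT := Finset.disjoint_left.1 E.disj hcR
  have hcA : c ∉ A := fun h => hcT (hsub.1 h)
  have hcB : c ∉ B := fun h => hcT (hsub.2 h)
  have hmA : (m : ℝ) ≤ #(A \ I) := by exact_mod_cast hA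
  have hM : (M : ℝ) ≤ #(nbrsIn G c (A \ I)) :=
    E.le.trans (le_trans (by gcongr) (mem_filter.1 hcN).2)
  have hM' : M ≤ #(nbrsIn G c (A \ I)) := by exact_mod_cast hM
  have hmM : e ≤ #(B \ I) := by
    have h3 : (M : ℝ) ≤ m := E.le.trans (mul_le_of_le_one_left (by positivity) E.le_one)
    have h4 : M ≤ m := by exact_mod_cast h3
    omega
  obtain ⟨φ', h2, h3⟩ := h1.extend_rest E.tiling hY (mem_insert_self _ _) (by
      rw [disjoint_insert_left]
      exact ⟨notMem_erase _ _, disjoint_of_subset_right (erase_subset _ _) hd⟩) hAB ho he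
    (by
      rw [him, Function.update_self, sdiff_insert_of_notMem hcA]
      exact hoM.trans hM')
    (by
      rw [him, sdiff_insert_of_notMem hcB]
      exact hmM)
    (by
      rw [him, inter_insert_of_notMem hcA, inter_insert_of_notMem hcB]
      exact hbal')
  have hXY : insert x X ∪ Y.erase x = X ∪ Y := by
    ext i
    have := hY.root_mem
    by_cases hi : i = x
    · subst hi
      simp [this]
    · simp [hi]
  rw [hXY] at h2
  refine ⟨φ', h2, fun i hi => ?_, ?_⟩
  · rw [h3 i (mem_insert_of_mem hi), hval i hi]
  · rw [h3 x (mem_insert_self _ _), Function.update_self]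
    exact hcD

theorem extend_tree [Fintype α] {Δ t : ℕ} (hΔ : ∀ i, #{j | π j = i} ≤ Δ) (hΔ1 : 1 ≤ Δ)
    (ht : 1 ≤ t) (hM : Δ * t ≤ M) (h : IsTileEmb G π r R T M X P φ)
    (E : TileEnv G U s S T R τ m M) {x : α} {Y : Finset α} (hY : IsSubtree π d Y x)
    (hd : Disjoint X Y) (hr : r ∉ Y.erase x)
    (hcap : (m + M) * #(tiled T) + s * (#X + #Y) < s * #(tiled T))
    {D : Finset β} (hDR : D ⊆ R) (hD : (1 / 2 + 2 * τ) * #R ≤ #D)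
    (hP : ((t * #P + #Y + t : ℕ) : ℝ) ≤ t * (τ * #R))
    (hpar : x = r ∨ π x ∈ X ∧ ∀ c ∈ D, G.Adj (φ (π x)) c) :
    ∃ P' φ', IsTileEmb G π r R T M (X ∪ Y) P' φ' ∧ (∀ i ∈ X, φ' i = φ i) ∧ φ' x ∈ D ∧
      t * #P' ≤ t * #P + #Y + t := by
  have ht0 : (0 : ℝ) < t := by exact_mod_cast ht
  induction hk : #Y using Nat.strong_induction_on generalizing Y with
  | _ k ih =>
  have hY0 : 0 < #Y := card_pos.2 ⟨x, hY.root_mem⟩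
  by_cases hYt : #Y ≤ Δ * t
  · have hP' : (#P : ℝ) < τ * #R := by
      refine lt_of_mul_lt_mul_left (lt_of_lt_of_le ?_ hP) ht0.le
      push_cast
      have : (0 : ℝ) < #Y := by exact_mod_cast hY0
      linarith
    obtain ⟨φ', h1, h2, h3⟩ := h.extend_piece E hY (hYt.trans hM) hd
      (lt_of_le_of_lt (by gcongr; omega) hcap) hDR hD hP' hpar
    refine ⟨_, φ', h1, h2, h3, ?_⟩
    have := Nat.mul_le_mul_left t (card_insert_le x P)
    rw [mul_add, mul_one] at this
    omega
  · obtain ⟨z, hz, hzx, hzt, hzM⟩ := hY.exists_branch hΔ hΔ1 ht (not_le.1 hYt)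
    have hbr := hY.branch hz
    set Z := branch π d Y z with hZ
    have hZY : Z ⊆ Y := branch_subset z
    have hc : #(Y \ Z) + #Z = #Y := card_sdiff_add_card_eq_card hZY
    have hzr : z ≠ r := fun e => hr (e ▸ mem_erase.2 ⟨hzx, hz⟩)
    have hle : #(X ∪ Y \ Z) ≤ #X + #(Y \ Z) := card_union_le _ _
    obtain ⟨P₁, φ₁, h1, h2, h3, h4⟩ := ih #(Y \ Z) (by omega) (hY.sdiff_branch hz hzx)
      (disjoint_of_subset_right sdiff_subset hd)
      (fun h => hr (erase_subset_erase _ sdiff_subset h))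
      (lt_of_le_of_lt (by gcongr; exact sdiff_subset) hcap)
      (le_trans (by gcongr; exact sdiff_subset) hP) rfl
    have hpz : π z ∈ Y \ Z := mem_sdiff.2 ⟨hY.parent_mem z hz hzx,
      hY.parent_notMem_branch hz hzx⟩
    have hpX : π z ∈ X ∪ Y \ Z := mem_union_right _ hpz
    have hP₁ : (#P₁ : ℝ) < τ * #R := by
      refine lt_of_mul_lt_mul_left (lt_of_lt_of_le ?_ hP) ht0.le
      have : t * #P₁ < t * #P + #Y + t := by omega
      exact_mod_cast this
    obtain ⟨φ', h5, h6, h7⟩ := h1.extend_piece E hbr (hzM.trans hM)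
      (disjoint_union_left.2 ⟨disjoint_of_subset_right hZY hd, sdiff_disjoint⟩)
      (lt_of_le_of_lt (by
        gcongr
        exact hle.trans (Nat.add_le_add_left (card_le_card sdiff_subset) _)) hcap)
      (nbrsIn_subset G (φ₁ (π z)) R)
      (E.deg _ (h1.mem_ground E hpX)) hP₁
      (Or.inr ⟨hpX, fun c hc => (mem_nbrsIn.1 hc).2⟩)
    rw [union_assoc, sdiff_union_of_subset hZY] at h5
    refine ⟨_, φ', h5, fun i hi => ?_, ?_, ?_⟩
    · rw [h6 i (mem_union_left _ hi), h2 i hi]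
    · rw [h6 x (mem_union_right _ (hY.sdiff_branch hz hzx).root_mem)]
      exact h3
    · have := Nat.mul_le_mul_left t (card_insert_le z P₁)
      rw [mul_add, mul_one] at this
      omega

end IsTileEmb

/-- In the setting of `TileEnv`, a tree that is not too large embeds with prescribed constraints on
the images of its root and of one further vertex. -/
theorem exists_isTreeEmb_of_tileEnv [Fintype α] [Nonempty β] {U : Finset β} {s S' m Δ t : ℕ}
    {τ : ℝ} (hΔ : ∀ i, #{j | π j = i} ≤ Δ) (hΔ1 : 1 ≤ Δ) (ht : 1 ≤ t) (hM : Δ * t ≤ M)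
    (E : TileEnv G U s S' T R τ m M) {S : Finset α} (hS : IsSubtree π d S r)
    (hcap : (m + M) * #(tiled T) + s * #S < s * #(tiled T)) {D₁ D₂ : Finset β}
    (hD₁ : (1 / 2 + 2 * τ) * #R ≤ #(D₁ ∩ R)) (hD₂ : (1 / 2 + 2 * τ) * #R ≤ #(D₂ ∩ R))
    (hR : ((#S + (Δ + 2) * t : ℕ) : ℝ) ≤ t * (τ * #R)) {q : α} (hq : q ∈ S) :
    ∃ φ, IsTreeEmb G π S r U φ ∧ φ r ∈ D₁ ∧ φ q ∈ D₂ := by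
  have ht0 : (0 : ℝ) < t := by exact_mod_cast ht
  have hτ := E.pos
  have hS0 : 0 < #S := card_pos.2 ⟨q, hq⟩
  have hR0 : 0 < (#R : ℝ) := by
    by_contra h
    have h1 : (0 : ℝ) < ((#S + (Δ + 2) * t : ℕ) : ℝ) := by
      have : 0 < #S + (Δ + 2) * t := by omega
      exact_mod_cast this
    have h2 : (#R : ℝ) = 0 := le_antisymm (not_lt.1 h) (by positivity)
    rw [h2] at hR
    linarith
  set Q := branch π d S q with hQ
  have hQS : Q ⊆ S := branch_subset q
  have hc : #(S \ Q) + #Q = #S := card_sdiff_add_card_eq_card hQS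
  have hqQ : q ∈ Q := mem_branch_self hq
  have hqn : q ∉ S \ Q := fun h => (mem_sdiff.1 h).2 hqQ
  have hbr := hS.branch hq
  have hrQ : r ∉ Q.erase q := fun h => by
    obtain ⟨h1, h2⟩ := mem_erase.1 h
    have := hbr.depth_lt h2 h1
    have := hS.depth_le hq
    omega
  have hQ1 : 0 < #Q := card_pos.2 ⟨q, hqQ⟩
  -- the part of the tree that is not below `q`, together with `q`
  obtain ⟨P₀, φ₀, h0, hr0, hq0, hP0⟩ : ∃ P₀ φ₀, IsTileEmb G π r R T M (insert q (S \ Q)) P₀ φ₀ ∧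
      φ₀ r ∈ D₁ ∧ φ₀ q ∈ D₂ ∧ t * #P₀ ≤ #(insert q (S \ Q)) + 2 * t := by
    by_cases hqr : q = r
    · have hDR : #(D₁ ∩ R) + #(D₂ ∩ R) ≤ #(D₁ ∩ R ∩ (D₂ ∩ R)) + #R :=
        le_card_inter inter_subset_right inter_subset_right
      have hDR' : (#(D₁ ∩ R) : ℝ) + #(D₂ ∩ R) ≤ #(D₁ ∩ R ∩ (D₂ ∩ R)) + #R := by
        exact_mod_cast hDR
      have : (0 : ℝ) < #(D₁ ∩ R ∩ (D₂ ∩ R)) := by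
        have : 0 < τ * #R := by positivity
        linarith
      obtain ⟨c, hc⟩ := card_pos.1 (by exact_mod_cast this :
        0 < #(D₁ ∩ R ∩ (D₂ ∩ R)))
      have hSQ : S \ Q = ∅ := by rw [hQ, hqr, hS.branch_root, sdiff_self]; rfl
      rw [hSQ]
      obtain ⟨h1, h2⟩ := mem_inter.1 hc
      refine ⟨_, _, (IsTileEmb.empty (φ := fun _ => c)).extend_single E.disj (notMem_empty q)
        (mem_inter.1 h1).2 (by simp) (Or.inl hqr), ?_, ?_, ?_⟩
      · rw [← hqr, Function.update_self]; exact (mem_inter.1 h1).1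
      · rw [Function.update_self]; exact (mem_inter.1 h2).1
      · simp only [insert_empty, card_singleton]; omega
    · obtain ⟨c₀⟩ := ‹Nonempty β›
      obtain ⟨P₁, φ₁, h1, -, h3, h4⟩ := (IsTileEmb.empty (φ := fun _ => c₀)).extend_tree hΔ hΔ1 ht
        hM E (hS.sdiff_branch hq hqr) (disjoint_empty_left _) (notMem_erase _ _)
        (lt_of_le_of_lt (by rw [card_empty, zero_add]; gcongr; exact sdiff_subset) hcap)
        inter_subset_right hD₁ (le_trans (by
          rw [card_empty]
          have h2 : #(S \ branch π d S q) ≤ #S := card_le_card sdiff_subset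
          have : t * 0 + #(S \ branch π d S q) + t ≤ #S + (Δ + 2) * t := by nlinarith
          exact_mod_cast this) hR) (Or.inl rfl)
      rw [empty_union] at h1
      rw [card_empty, ← hQ] at h4
      have hpq : π q ∈ S \ Q := mem_sdiff.2 ⟨hS.parent_mem q hq hqr,
        hS.parent_notMem_branch hq hqr⟩
      have hDR : #(nbrsIn G (φ₁ (π q)) R) + #(D₂ ∩ R) ≤
          #(nbrsIn G (φ₁ (π q)) R ∩ (D₂ ∩ R)) + #R :=
        le_card_inter (nbrsIn_subset _ _ _) inter_subset_right
      have hDR' : (#(nbrsIn G (φ₁ (π q)) R) : ℝ) + #(D₂ ∩ R) ≤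
          #(nbrsIn G (φ₁ (π q)) R ∩ (D₂ ∩ R)) + #R := by exact_mod_cast hDR
      have hdeg := E.deg _ (h1.mem_ground E hpq)
      have hP₁ : (#P₁ : ℝ) ≤ τ * #R := by
        refine le_of_mul_le_mul_left (le_trans ?_ hR) ht0
        have : t * #P₁ ≤ #S + (Δ + 2) * t := by nlinarith
        exact_mod_cast this
      obtain ⟨c, hc, hcP⟩ : ∃ c ∈ nbrsIn G (φ₁ (π q)) R ∩ (D₂ ∩ R), c ∉ P₁.image φ₁ := by
        refine exists_mem_notMem_of_card_lt_card ?_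
        have h1 : #(P₁.image φ₁) ≤ #P₁ := card_image_le
        have h2 : (#P₁ : ℝ) < #(nbrsIn G (φ₁ (π q)) R ∩ (D₂ ∩ R)) := by
          have : 0 < τ * #R := by positivity
          linarith
        have h3 : #P₁ < #(nbrsIn G (φ₁ (π q)) R ∩ (D₂ ∩ R)) := by exact_mod_cast h2
        omega
      obtain ⟨hc1, hc2⟩ := mem_inter.1 hc
      refine ⟨_, _, h1.extend_single E.disj hqn (mem_inter.1 hc2).2 hcP
        (Or.inr ⟨hpq, (mem_nbrsIn.1 hc1).2⟩), ?_, ?_, ?_⟩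
      · rw [Function.update_of_ne (Ne.symm hqr)]
        exact (mem_inter.1 h3).1
      · rw [Function.update_self]
        exact (mem_inter.1 hc2).1
      · have := Nat.mul_le_mul_left t (card_insert_le q P₁)
        rw [mul_add, mul_one] at this
        rw [card_insert_of_notMem hqn]
        omega
  -- the branches below `q` are added one by one
  set X₀ := insert q (S \ Q) with hX₀
  set ch := {y ∈ S | y ≠ r ∧ π y = q} with hch
  have hchΔ : #ch ≤ Δ := (card_le_card fun y hy => by
    simp only [hch, mem_filter, mem_univ, true_and] at hy ⊢
    exact hy.2.2).trans (hΔ q)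
  have hchS : ∀ y ∈ ch, y ∈ S ∧ y ≠ r ∧ π y = q ∧ d y = d q + 1 := fun y hy => by
    obtain ⟨h1, h2, h3⟩ := mem_filter.1 hy
    exact ⟨h1, h2, h3, h3 ▸ hS.depth_eq y h1 h2⟩
  have hbQ : ∀ y ∈ ch, branch π d S y ⊆ Q.erase q := fun y hy z hz => by
    obtain ⟨h1, h2, h3, h4⟩ := hchS y hy
    refine mem_erase.2 ⟨fun e => ?_, ?_⟩
    · have := le_of_mem_branch hz
      rw [e] at this
      omega
    · rw [hQ, hS.branch_eq hq]
      exact mem_insert_of_mem (mem_biUnion.2 ⟨y, hy, hz⟩)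
  have hX₀Q : Disjoint X₀ (Q.erase q) := by
    rw [hX₀, disjoint_insert_left]
    exact ⟨notMem_erase _ _, disjoint_of_subset_right (erase_subset _ _) sdiff_disjoint⟩
  have main : ∀ C ⊆ ch, ∃ P φ, IsTileEmb G π r R T M (X₀ ∪ C.biUnion (branch π d S)) P φ ∧
      (∀ i ∈ X₀, φ i = φ₀ i) ∧
      t * #P ≤ #(X₀ ∪ C.biUnion (branch π d S)) + (2 + #C) * t := by
    intro C
    induction C using Finset.induction_on with
    | empty => exact fun _ => ⟨P₀, φ₀, by simpa using h0, fun _ _ => rfl, by simpa using hP0⟩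
    | insert y C hyC ih =>
      intro hsub
      obtain ⟨P, φ, h1, h2, h3⟩ := ih ((subset_insert _ _).trans hsub)
      have hy := hsub (mem_insert_self _ _)
      obtain ⟨hyS, hyr, hyq, hyd⟩ := hchS y hy
      set X := X₀ ∪ C.biUnion (branch π d S) with hX
      have hdis : Disjoint X (branch π d S y) := by
        rw [hX, disjoint_union_left, disjoint_biUnion_left]
        refine ⟨disjoint_of_subset_right (hbQ y hy) hX₀Q, fun z hz => ?_⟩
        refine disjoint_branch ?_ (fun e => hyC (e ▸ hz))
        rw [hyd, (hchS z (hsub (mem_insert_of_mem hz))).2.2.2]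
      have hXS : X ∪ branch π d S y ⊆ S := by
        refine union_subset (union_subset ?_ (biUnion_subset.2 fun z _ => branch_subset z))
          (branch_subset y)
        exact insert_subset hq sdiff_subset
      have hXc : #X + #(branch π d S y) ≤ #S := by
        rw [← card_union_of_disjoint hdis]
        exact card_le_card hXS
      have hqX : q ∈ X := mem_union_left _ (mem_insert_self _ _)
      have hCc : #C + 1 ≤ Δ := by
        rw [← card_insert_of_notMem hyC]
        exact (card_le_card hsub).trans hchΔ
      have hCt : (2 + #C) * t + t ≤ (Δ + 2) * t := by
        have : (2 + #C) * t + t = (2 + (#C + 1)) * t := by ring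
        rw [this]
        gcongr ?_ * t
        omega
      obtain ⟨P', φ', h4, h5, -, h7⟩ := h1.extend_tree hΔ hΔ1 ht hM E (hS.branch hyS) hdis
        (fun h => hrQ (hbQ y hy (mem_erase.1 h).2))
        (lt_of_le_of_lt (by gcongr) hcap) (nbrsIn_subset G (φ q) R)
        (E.deg _ (h1.mem_ground E hqX)) (le_trans (by
          have : t * #P + #(branch π d S y) + t ≤ #S + (Δ + 2) * t := by omega
          exact_mod_cast this) hR)
        (Or.inr ⟨hyq ▸ hqX, fun c hc => hyq ▸ (mem_nbrsIn.1 hc).2⟩)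
      have e1 : X₀ ∪ (insert y C).biUnion (branch π d S) = X ∪ branch π d S y := by
        rw [biUnion_insert, hX, union_assoc, union_comm (branch π d S y)]
      rw [e1]
      refine ⟨P', φ', h4, fun i hi => ?_, ?_⟩
      · rw [h5 i (mem_union_left _ hi), h2 i hi]
      · rw [card_union_of_disjoint hdis, card_insert_of_notMem hyC]
        have : (2 + (#C + 1)) * t = (2 + #C) * t + t := by ring
        omega
  obtain ⟨P, φ, h1, h2, -⟩ := main ch le_rfl
  have e1 : X₀ ∪ ch.biUnion (branch π d S) = S := by
    have : insert q (ch.biUnion (branch π d S)) = Q := (hS.branch_eq hq).symm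
    rw [hX₀, insert_union, ← union_insert, this, sdiff_union_of_subset hQS]
  rw [e1] at h1
  refine ⟨φ, ⟨fun i hi => h1.mem_ground E hi, h1.inj, h1.adj⟩, ?_, ?_⟩
  · have : r ∈ X₀ := by
      by_cases hqr : q = r
      · exact hqr ▸ mem_insert_self _ _
      · exact mem_insert_of_mem (hS.sdiff_branch hq hqr).root_mem
    rw [h2 r this]
    exact hr0
  · rw [h2 q (mem_insert_self _ _)]
    exact hq0

set_option maxHeartbeats 1000000 in
/-- Trees of bounded degree that leave a small proportion of a graph with large minimum degree
uncovered embed into it, with prescribed constraints on the images of the root and of one further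
vertex. -/
theorem exists_isTreeEmb_almostSpanning (Δ : ℕ) (hΔ1 : 1 ≤ Δ) (δ η : ℝ) (hδ : 0 < δ)
    (hδ1 : δ ≤ 1 / 2) (hη : 0 < η) (hη1 : η ≤ 1) :
    ∃ K : ℕ, ∀ (α β : Type) [Fintype α] [Fintype β] (π : α → α) (d : α → ℕ),
      (∀ i, #{j | π j = i} ≤ Δ) → ∀ (G : SimpleGraph β) (U : Finset β), DiracOn G δ U →
      K ≤ #U → ∀ (S : Finset α) (r : α), IsSubtree π d S r → (#S : ℝ) ≤ (1 - η) * #U →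
      ∀ D₁ ⊆ U, ∀ D₂ ⊆ U, (1 / 2 + δ) * #U ≤ (#D₁ : ℝ) → (1 / 2 + δ) * #U ≤ (#D₂ : ℝ) →
      ∀ q ∈ S, ∃ φ, IsTreeEmb G π S r U φ ∧ φ r ∈ D₁ ∧ φ q ∈ D₂ := by
  obtain ⟨ρ, hρ⟩ : ∃ ρ, ρ = η * δ / 4 := ⟨_, rfl⟩
  obtain ⟨τ, hτ⟩ : ∃ τ, τ = δ / 4 := ⟨_, rfl⟩
  have hρ0 : 0 < ρ := by rw [hρ]; positivity
  have hτ0 : 0 < τ := by rw [hτ]; positivity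
  have hρδ : ρ ≤ δ / 4 := by rw [hρ]; nlinarith
  have hρη : ρ ≤ η / 8 := by rw [hρ]; nlinarith
  obtain ⟨t, ht⟩ := exists_nat_ge (4 / (τ * ρ) + 1)
  have ht' : 4 ≤ t * (τ * ρ) := by
    rw [← div_le_iff₀ (by positivity)]
    linarith
  have ht1 : 1 ≤ t := by
    have : (0 : ℝ) < 4 / (τ * ρ) := by positivity
    have : (1 : ℝ) ≤ t := by linarith
    exact_mod_cast this
  obtain ⟨M, hM⟩ : ∃ M, M = Δ * t := ⟨_, rfl⟩
  obtain ⟨m, hm⟩ := exists_nat_ge ((M : ℝ) / τ + 1)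
  have hMm : (M : ℝ) ≤ τ * m := by
    rw [← div_le_iff₀' hτ0]
    linarith
  have hm1 : 1 ≤ m := by
    have : (0 : ℝ) ≤ M / τ := by positivity
    have : (1 : ℝ) ≤ m := by linarith
    exact_mod_cast this
  obtain ⟨s, hs⟩ := exists_nat_ge (4 * (m + M : ℝ) / η)
  rw [div_le_iff₀ hη] at hs
  have hs0 : 0 < s := by
    rcases Nat.eq_zero_or_pos s with rfl | h
    · have : (0 : ℝ) < m := by exact_mod_cast hm1
      have : (0 : ℝ) ≤ M := by positivity
      norm_num at hs
      linarith
    · exact h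
  obtain ⟨K₁, S', hK₁⟩ := exists_tiling (δ / 2) (η / 4) (by positivity) (by linarith)
    (by positivity) s hs0
  obtain ⟨K₂, hK₂⟩ := exists_proportional_subset (ρ / 2) (δ / 2) (by positivity) (by positivity) 2
  obtain ⟨K₃, hK₃⟩ := exists_nat_ge (2 / ρ + 1)
  refine ⟨2 * K₁ + K₂ + K₃ + (Δ + 2) * t, ?_⟩
  intro α β _ _ π d hΔ G U hG hK S r hS hSU D₁ hD₁U D₂ hD₂U hD₁ hD₂ q hq
  obtain ⟨N, hN⟩ : ∃ N : ℝ, N = #U := ⟨_, rfl⟩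
  have hKN : 2 * (K₁ : ℝ) + K₂ + K₃ + (Δ + 2) * t ≤ N := by
    rw [hN]
    exact_mod_cast hK
  have hN3 : (K₃ : ℝ) ≤ N := by
    have : (0 : ℝ) ≤ 2 * K₁ + K₂ + (Δ + 2) * t := by positivity
    linarith
  have hN4 : (Δ + 2) * (t : ℝ) ≤ N := by
    have : (0 : ℝ) ≤ 2 * K₁ + K₂ + K₃ := by positivity
    linarith
  have hN0 : 0 < N := by
    have : 0 < 2 / ρ := by positivity
    linarith
  have hρN : 2 ≤ ρ * N := by
    rw [← div_le_iff₀' hρ0]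
    linarith
  obtain ⟨k, hk⟩ : ∃ k, k = ⌊ρ * N⌋₊ := ⟨_, rfl⟩
  have hk1 : (k : ℝ) ≤ ρ * N := by rw [hk]; exact Nat.floor_le (by positivity)
  have hk2 : ρ / 2 * N ≤ k := by
    have := Nat.lt_floor_add_one (ρ * N)
    rw [← hk] at this
    linarith
  have hkU : k ≤ #U := by
    have : (k : ℝ) ≤ #U := by
      rw [← hN]
      nlinarith
    exact_mod_cast this
  obtain ⟨R, hRU, hRk, hR⟩ := hK₂ (Finset β) β (U.image (fun v => nbrsIn G v U) ∪ {D₁, D₂}) U id k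
    (by
      intro A hA
      rcases mem_union.1 hA with hA | hA
      · obtain ⟨v, -, rfl⟩ := mem_image.1 hA
        exact nbrsIn_subset _ _ _
      · rcases mem_insert.1 hA with rfl | hA
        exacts [hD₁U, mem_singleton.1 hA ▸ hD₂U])
    (by omega)
    ((card_union_le _ _).trans (Nat.add_le_add card_image_le card_le_two)) hkU (by rwa [← hN])
  have hR' : ∀ A ∈ U.image (fun v => nbrsIn G v U) ∪ {D₁, D₂}, (1 / 2 + δ) * #U ≤ (#A : ℝ) →
      (1 / 2 + 2 * τ) * #R ≤ #(A ∩ R) := by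
    intro A hA hA'
    refine le_trans ?_ (hR A hA)
    rw [hRk]
    gcongr
    have : 1 / 2 + δ ≤ (#A : ℝ) / #U := by
      rw [le_div_iff₀ (by rwa [← hN])]
      exact hA'
    simp only [id]
    linarith
  have hU₁ : (#(U \ R) : ℝ) = N - k := by
    rw [card_sdiff_of_subset hRU, Nat.cast_sub (card_le_card hRU), hRk, hN]
  have hG₁ : DiracOn G (δ / 2) (U \ R) := by
    intro v hv
    have h1 := hG v (mem_sdiff.1 hv).1
    have h2 : (#(nbrsIn G v U) : ℝ) ≤ #(nbrsIn G v (U \ R)) + k := by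
      rw [← hRk]
      exact_mod_cast card_nbrsIn_le_sdiff G v U R
    rw [hU₁]
    rw [← hN] at h1
    have h3 : (k : ℝ) ≤ δ / 4 * N := hk1.trans (by gcongr)
    have h4 : 0 ≤ (1 / 2 + δ / 2) * (k : ℝ) := by positivity
    linarith
  obtain ⟨T, hT, hTη⟩ := hK₁ β G (U \ R) hG₁ (by
    have : (K₁ : ℝ) ≤ #(U \ R) := by
      rw [hU₁]
      have : ρ * N ≤ 1 / 8 * N := by gcongr; linarith
      have : (0 : ℝ) ≤ K₂ + K₃ + (Δ + 2) * t := by positivity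
      linarith
    exact_mod_cast this)
  have hTU : (#(tiled T) : ℝ) ≤ N := by
    rw [hN]
    exact_mod_cast card_le_card (hT.tiled_subset.trans sdiff_subset)
  have hTN : (1 - η / 2) * N ≤ #(tiled T) := by
    refine le_trans ?_ hTη
    rw [hU₁]
    have h1 : (1 - η / 8) * N ≤ N - k := by nlinarith
    have h2 : (1 - η / 4) * ((1 - η / 8) * N) ≤ (1 - η / 4) * (N - k) := by
      gcongr
      linarith
    nlinarith
  have hR0 : ρ / 2 * N ≤ #R := by rw [hRk]; exact hk2
  have E : TileEnv G U s S' T R τ m M := by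
    refine ⟨⟨fun p hp => (hT.left_subset p hp).trans sdiff_subset,
      fun p hp => (hT.right_subset p hp).trans sdiff_subset, hT.card_eq, hT.le_card, hT.card_le,
      hT.complete, hT.disjoint⟩, ?_, hRU, fun v hv => ?_, hτ0, by linarith, hm1, hMm⟩
    · exact disjoint_of_subset_right hT.tiled_subset disjoint_sdiff
    · rw [← nbrsIn_inter G v hRU]
      exact hR' _ (mem_union_left _ (mem_image_of_mem _ hv)) (hG v hv)
  have : Nonempty β := by
    obtain ⟨v, -⟩ := card_pos.1 (by
      have : (0 : ℝ) < #U := by rwa [← hN]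
      exact_mod_cast this : 0 < #U)
    exact ⟨v⟩
  refine exists_isTreeEmb_of_tileEnv hΔ hΔ1 ht1 hM.ge E hS ?_
    (hR' D₁ (mem_union_right _ (by simp)) hD₁) (hR' D₂ (mem_union_right _ (by simp)) hD₂) ?_ hq
  · have hs0' : (0 : ℝ) < s := by exact_mod_cast hs0
    rw [← hN] at hSU
    have h1 : ((m : ℝ) + M) * #(tiled T) ≤ s * η / 4 * N := by
      gcongr
      linarith
    have h2 : (s : ℝ) * #S ≤ s * ((1 - η) * N) := by gcongr
    have h3 : (s : ℝ) * ((1 - η / 2) * N) ≤ s * #(tiled T) := by gcongr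
    have h4 : 0 < s * (η * N) := by positivity
    have : ((m : ℝ) + M) * #(tiled T) + s * #S < s * #(tiled T) := by linarith
    exact_mod_cast this
  · push_cast
    have h1 : (#S : ℝ) ≤ N := by
      refine hSU.trans ?_
      rw [← hN]
      nlinarith
    have h2 : t * (τ * (ρ / 2 * N)) ≤ t * (τ * #R) := by gcongr
    have h3 : 4 * N ≤ t * (τ * ρ) * N := by gcongr
    linarith

end AlmostSpanning

section Absorbers

/-- Greedy choice of a family of pairwise compatible elements such that every test in `𝒬` is passed
by many members: if every test is passed by an `ε` fraction of all elements even after excluding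
those incompatible with earlier choices, the exponential potential of the tests decays. -/
theorem exists_family_potential {ι X Θ : Type} (P : Finset X) (𝒬 : Finset Θ) (good : Θ → X → Prop)
    (compat : X → X → Prop) (hsymm : ∀ x y, compat x y → compat y x) (m : ℕ) (ε : ℝ) (hε : 0 < ε)
    (hP : P.Nonempty) (hQ : 𝒬.Nonempty)
    (h : ∀ F ⊆ P, #F < m → ∀ θ ∈ 𝒬, ε * #P ≤ #{x ∈ P | (∀ y ∈ F, compat y x) ∧ good θ x})
    (Z : Finset ι) (hZ : #Z ≤ m) :
    ∃ f : ι → X, (∀ z ∈ Z, f z ∈ P) ∧ (∀ z ∈ Z, ∀ z' ∈ Z, z ≠ z' → compat (f z) (f z')) ∧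
      ∑ θ ∈ 𝒬, (1 / 2 : ℝ) ^ #{z ∈ Z | good θ (f z)} ≤ #𝒬 * (1 - ε / 2) ^ #Z := by
  induction Z using Finset.induction_on with
  | empty =>
    obtain ⟨x, -⟩ := hP
    exact ⟨fun _ => x, by simp⟩
  | insert a Z ha ih =>
    rw [card_insert_of_notMem ha] at hZ
    obtain ⟨f, hfP, hfc, hf⟩ := ih (by omega)
    have hFP : Z.image f ⊆ P := image_subset_iff.2 hfP
    have hF : #(Z.image f) < m := lt_of_le_of_lt card_image_le (by omega)
    set pool := {x ∈ P | ∀ y ∈ Z.image f, compat y x} with hpool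
    have hgood : ∀ θ ∈ 𝒬, ε * #P ≤ #{x ∈ pool | good θ x} := fun θ hθ => by
      rw [hpool, filter_filter]
      exact h _ hFP hF θ hθ
    have hpP : (#pool : ℝ) ≤ #P := by exact_mod_cast card_le_card (filter_subset _ _)
    have hP0 : (0 : ℝ) < #P := by exact_mod_cast hP.card_pos
    have hne : pool.Nonempty := by
      obtain ⟨θ, hθ⟩ := hQ
      have h1 := hgood θ hθ
      have h2 : (0 : ℝ) < #{x ∈ pool | good θ x} := lt_of_lt_of_le (by positivity) h1
      exact (card_pos.1 (by exact_mod_cast h2)).mono (filter_subset _ _)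
    set g : Θ → ℝ := fun θ => (1 / 2 : ℝ) ^ #{z ∈ Z | good θ (f z)} with hg
    obtain ⟨x, hx, hxle⟩ : ∃ x ∈ pool, ∑ θ ∈ 𝒬, g θ * (if good θ x then 1 / 2 else 1) ≤
        (1 - ε / 2) * ∑ θ ∈ 𝒬, g θ := by
      refine exists_le_of_sum_le hne ?_
      rw [sum_comm, sum_const, nsmul_eq_mul, mul_sum, mul_sum]
      refine sum_le_sum fun θ hθ => ?_
      have h1 : ∑ x ∈ pool, (if good θ x then (1 / 2 : ℝ) else 1) =
          #pool - #{x ∈ pool | good θ x} / 2 := by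
        have : ∀ x ∈ pool, (if good θ x then (1 / 2 : ℝ) else 1) =
            1 - (if good θ x then 1 else 0) / 2 := fun x _ => by split_ifs <;> norm_num
        rw [sum_congr rfl this, sum_sub_distrib, ← sum_div, sum_boole]
        simp
      rw [← mul_sum, h1]
      have h2 : 0 ≤ g θ := by positivity
      have h3 := hgood θ hθ
      have h4 : ε * #pool ≤ ε * #P := by gcongr
      calc g θ * (#pool - #{x ∈ pool | good θ x} / 2) ≤ g θ * (#pool - ε * #pool / 2) := by
            gcongr
            linarith
        _ = _ := by ring
    have hval : ∀ z ∈ Z, Function.update f a x z = f z := fun z hz =>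
      Function.update_of_ne (by rintro rfl; exact ha hz) _ _
    have hxc : ∀ z ∈ Z, compat (f z) x := fun z hz =>
      (mem_filter.1 hx).2 _ (mem_image_of_mem f hz)
    have hnn : 0 ≤ 1 - ε / 2 := by
      obtain ⟨θ, hθ⟩ := hQ
      have h1 := h _ hFP hF θ hθ
      have h2 : (#{x ∈ P | (∀ y ∈ Z.image f, compat y x) ∧ good θ x} : ℝ) ≤ #P := by
        exact_mod_cast card_le_card (filter_subset _ _)
      have : ε ≤ 1 := by
        by_contra hc
        nlinarith
      linarith
    refine ⟨Function.update f a x, ?_, ?_, ?_⟩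
    · intro z hz
      rcases mem_insert.1 hz with rfl | hz
      · rw [Function.update_self]
        exact (mem_filter.1 hx).1
      · rw [hval z hz]
        exact hfP z hz
    · intro z hz z' hz' hne
      rw [mem_insert] at hz hz'
      rcases hz with rfl | hz <;> rcases hz' with rfl | hz'
      · exact absurd rfl hne
      · rw [Function.update_self, hval z' hz']
        exact hsymm _ _ (hxc z' hz')
      · rw [Function.update_self, hval z hz]
        exact hxc z hz
      · rw [hval z hz, hval z' hz']
        exact hfc z hz z' hz' hne
    · have h1 : ∀ θ ∈ 𝒬, (1 / 2 : ℝ) ^ #{z ∈ insert a Z | good θ (Function.update f a x z)} =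
          g θ * (if good θ x then 1 / 2 else 1) := by
        intro θ _
        have h2 : {z ∈ Z | good θ (Function.update f a x z)} = {z ∈ Z | good θ (f z)} :=
          filter_congr fun z hz => by rw [hval z hz]
        rw [filter_insert, Function.update_self, h2]
        split_ifs with h3
        · rw [card_insert_of_notMem fun h => ha (mem_filter.1 h).1, pow_succ]
        · rw [mul_one]
      rw [sum_congr rfl h1, card_insert_of_notMem ha, pow_succ]
      calc _ ≤ (1 - ε / 2) * ∑ θ ∈ 𝒬, g θ := hxle
        _ ≤ (1 - ε / 2) * (#𝒬 * (1 - ε / 2) ^ #Z) := by gcongr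
        _ = _ := by ring

variable {α β : Type}

/-- A family of disjoint paths `v z, y z, w z` of length two in `U` such that for all `u`, `a` and
`b` in `U` many indices `z` allow `y z` to be replaced by `u` and to be adjacent to `a` and `b`. -/
structure IsAbsorber (G : SimpleGraph β) (κ : ℝ) (U : Finset β) (Z : Finset α) (v y w : α → β) :
    Prop where
  mem : ∀ z ∈ Z, v z ∈ U ∧ y z ∈ U ∧ w z ∈ U
  adj : ∀ z ∈ Z, G.Adj (v z) (y z) ∧ G.Adj (w z) (y z)
  ne : ∀ z ∈ Z, v z ≠ w z
  disj : ∀ z ∈ Z, ∀ z' ∈ Z, z ≠ z' →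
    Disjoint ({v z, y z, w z} : Finset β) {v z', y z', w z'}
  many : ∀ u ∈ U, ∀ a ∈ U, ∀ b ∈ U, κ * #Z ≤
    #{z ∈ Z | G.Adj (v z) u ∧ G.Adj (w z) u ∧ G.Adj a (y z) ∧ G.Adj b (y z)}

theorem DiracOn.le_card_inter {G : SimpleGraph β} {δ : ℝ} {U : Finset β} (hG : DiracOn G δ U)
    {a b : β} (ha : a ∈ U) (hb : b ∈ U) :
    2 * δ * #U ≤ #(nbrsIn G a U ∩ nbrsIn G b U) := by
  have h1 := hG a ha
  have h2 := hG b hb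
  have h3 : (#(nbrsIn G a U) : ℝ) + #(nbrsIn G b U) ≤
      #(nbrsIn G a U ∩ nbrsIn G b U) + #U := by
    exact_mod_cast _root_.le_card_inter (nbrsIn_subset G a U) (nbrsIn_subset G b U)
  linarith

/-- The number of paths of length two avoiding a small set `W`, with both ends in the neighbourhood
of `u` and the middle vertex in the common neighbourhood of `a` and `b`. -/
theorem DiracOn.le_card_paths {G : SimpleGraph β} {δ : ℝ} {U : Finset β} (hG : DiracOn G δ U)
    (hU : 2 ≤ δ * #U) {W : Finset β} (hW : #W ≤ δ * #U) {u a b : β}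
    (hu : u ∈ U) (ha : a ∈ U) (hb : b ∈ U) :
    δ ^ 3 / 2 * (#U : ℝ) ^ 3 ≤ #{x ∈ U ×ˢ U ×ˢ U | (G.Adj x.2.1 x.1 ∧ G.Adj x.2.2 x.1 ∧
      x.2.1 ≠ x.2.2) ∧ (x.1 ∉ W ∧ x.2.1 ∉ W ∧ x.2.2 ∉ W) ∧
      G.Adj x.2.1 u ∧ G.Adj x.2.2 u ∧ G.Adj a x.1 ∧ G.Adj b x.1} := by
  have key : ∀ a ∈ U, ∀ b ∈ U, δ * #U ≤ #((nbrsIn G a U ∩ nbrsIn G b U) \ W) := by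
    intro a ha b hb
    have h1 := hG.le_card_inter ha hb
    have h2 : (#(nbrsIn G a U ∩ nbrsIn G b U) : ℝ) ≤
        #((nbrsIn G a U ∩ nbrsIn G b U) \ W) + #W := by
      have := le_card_sdiff W (nbrsIn G a U ∩ nbrsIn G b U)
      exact_mod_cast (by omega)
    linarith
  set A := (nbrsIn G a U ∩ nbrsIn G b U) \ W with hA
  set B : β → Finset β := fun y => (nbrsIn G u U ∩ nbrsIn G y U) \ W with hB
  have h1 : #(A.sigma fun y => (B y).offDiag) ≤ #{x ∈ U ×ˢ U ×ˢ U | (G.Adj x.2.1 x.1 ∧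
      G.Adj x.2.2 x.1 ∧ x.2.1 ≠ x.2.2) ∧ (x.1 ∉ W ∧ x.2.1 ∉ W ∧ x.2.2 ∉ W) ∧
      G.Adj x.2.1 u ∧ G.Adj x.2.2 u ∧ G.Adj a x.1 ∧ G.Adj b x.1} := by
    refine card_le_card_of_injOn (fun p => (p.1, p.2)) ?_ ?_
    · rintro ⟨y, v, w⟩ hp
      simp only [hA, hB, coe_sigma, Set.mem_sigma_iff, mem_coe, mem_sdiff, mem_inter, mem_nbrsIn,
        mem_offDiag, mem_filter, mem_product] at hp ⊢
      obtain ⟨⟨⟨⟨h1, h2⟩, h3, h4⟩, h5⟩, ⟨⟨⟨h6, h7⟩, -, h8⟩, h9⟩, ⟨⟨⟨h10, h11⟩, -, h12⟩, h13⟩, h14⟩ := hp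
      exact ⟨⟨h1, h6, h10⟩, ⟨h8.symm, h12.symm, h14⟩, ⟨h5, h9, h13⟩, h7.symm, h11.symm, h2, h4⟩
    · rintro ⟨y, p⟩ - ⟨y', p'⟩ - h
      simp only [Prod.mk.injEq] at h
      obtain ⟨rfl, rfl⟩ := h
      rfl
  rw [card_sigma] at h1
  have h2 : ∀ y ∈ A, (δ * #U) ^ 2 / 2 ≤ (#(B y).offDiag : ℝ) := by
    intro y hy
    have h3 := key u hu y (mem_nbrsIn.1 (mem_inter.1 (mem_sdiff.1 hy).1).1).1
    have h4 : (#(B y).offDiag : ℝ) = #(B y) * #(B y) - #(B y) := by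
      rw [offDiag_card, Nat.cast_sub (Nat.le_mul_self _)]
      push_cast
      rfl
    rw [h4]
    have h5 : δ * #U ≤ (#(B y) : ℝ) := h3
    nlinarith
  have h3 := key a ha b hb
  calc δ ^ 3 / 2 * (#U : ℝ) ^ 3 = δ * #U * ((δ * #U) ^ 2 / 2) := by ring
    _ ≤ #A * ((δ * #U) ^ 2 / 2) := by gcongr
    _ ≤ ∑ y ∈ A, (#(B y).offDiag : ℝ) := by
      rw [← nsmul_eq_mul]
      exact card_nsmul_le_sum _ _ _ h2
    _ ≤ _ := by exact_mod_cast h1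

theorem exists_le_of_half_pow_le (ε c : ℝ) (hε : 0 < ε) (hc : 0 < c) (hε1 : ε ≤ 1) :
    ∃ K : ℕ, ∀ N m k : ℕ, K ≤ N → c * N ≤ m →
      (1 / 2 : ℝ) ^ k ≤ (N : ℝ) ^ 3 * (1 - ε / 2) ^ m → ε / 4 * m ≤ k := by
  have hlim : Filter.Tendsto (fun m : ℕ => (m : ℝ) ^ 3 * Real.exp (-(ε * c / 4 * m)))
      Filter.atTop (nhds 0) := by
    have := (Real.tendsto_pow_mul_exp_neg_atTop_nhds_zero 3).comp
      ((tendsto_natCast_atTop_atTop (R := ℝ)).const_mul_atTop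
        (by positivity : 0 < ε * c / 4))
    have h2 := this.const_mul ((ε * c / 4) ^ 3)⁻¹
    rw [mul_zero] at h2
    refine h2.congr fun m => ?_
    simp only [Function.comp, mul_pow]
    field_simp
  obtain ⟨K, hK⟩ := Filter.eventually_atTop.1 (hlim.eventually_lt_const one_pos)
  refine ⟨K, fun N m k hN hm h => ?_⟩
  by_contra! hcon
  have h3 : (1 - ε / 2) ^ m ≤ Real.exp (-(ε / 2 * m)) := by
    have := pow_le_pow_left₀ (by linarith) (Real.one_sub_le_exp_neg (ε / 2)) m
    rw [← Real.exp_nat_mul] at this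
    refine this.trans_eq ?_
    congr 1
    ring
  have h4 : Real.exp (-(ε / 4 * m)) ≤ (1 / 2 : ℝ) ^ k := by
    have h5 : Real.exp (-1) ≤ 1 / 2 := by
      rw [Real.exp_neg, inv_eq_one_div]
      gcongr
      have := Real.add_one_le_exp 1
      linarith
    calc Real.exp (-(ε / 4 * m)) ≤ Real.exp (-k) := by gcongr
      _ = Real.exp (-1) ^ k := by rw [← Real.exp_nat_mul]; simp
      _ ≤ _ := by gcongr
  have h6 : (N : ℝ) ^ 3 * Real.exp (-(ε / 4 * m)) < 1 := by
    refine lt_of_le_of_lt (mul_le_mul_of_nonneg_left (Real.exp_le_exp.2 ?_) (by positivity))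
      (hK N hN)
    have : ε / 4 * (c * N) ≤ ε / 4 * m := by gcongr
    linarith
  have h7 : Real.exp (-(ε / 4 * m)) ≤ (N : ℝ) ^ 3 * (Real.exp (-(ε / 4 * m)) *
      Real.exp (-(ε / 4 * m))) := by
    rw [← Real.exp_add]
    refine h4.trans (h.trans ?_)
    gcongr
    refine h3.trans_eq ?_
    congr 1
    ring
  have h8 : 0 < Real.exp (-(ε / 4 * m)) := Real.exp_pos _
  nlinarith

theorem exists_isAbsorber (δ c : ℝ) (hδ : 0 < δ) (hδ1 : δ ≤ 1) (hc : 0 < c) :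
    ∃ K : ℕ, ∀ (α β : Type) (G : SimpleGraph β) (U : Finset β) (Z : Finset α),
      DiracOn G δ U → K ≤ #U → c * #U ≤ #Z → 3 * (#Z : ℝ) ≤ δ * #U →
      ∃ v y w, IsAbsorber G (δ ^ 3 / 8) U Z v y w := by
  obtain ⟨K₁, hK₁⟩ := exists_le_of_half_pow_le (δ ^ 3 / 2) c (by positivity) hc (by
    have : δ ^ 3 ≤ 1 := pow_le_one₀ hδ.le hδ1
    linarith)
  obtain ⟨K₂, hK₂⟩ := exists_nat_ge (2 / δ)
  refine ⟨K₁ + K₂, fun α β G U Z hG hK hcZ hZ => ?_⟩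
  have hδN : 2 ≤ δ * #U := by
    rw [← div_le_iff₀' hδ]
    refine hK₂.trans ?_
    exact_mod_cast (Nat.le_add_left _ _).trans hK
  have hU0 : 0 < (#U : ℝ) := by
    by_contra h
    nlinarith
  obtain ⟨u₀, hu₀⟩ := card_pos.1 (by exact_mod_cast hU0 : 0 < #U)
  set P := {x ∈ U ×ˢ U ×ˢ U | G.Adj x.2.1 x.1 ∧ G.Adj x.2.2 x.1 ∧ x.2.1 ≠ x.2.2} with hPdef
  set vs : β × β × β → Finset β := fun x => {x.2.1, x.1, x.2.2} with hvs
  obtain ⟨good, hgood⟩ : ∃ good : β × β × β → β × β × β → Prop, ∀ θ x, good θ x ↔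
      G.Adj x.2.1 θ.1 ∧ G.Adj x.2.2 θ.1 ∧ G.Adj θ.2.1 x.1 ∧ G.Adj θ.2.2 x.1 :=
    ⟨_, fun _ _ => Iff.rfl⟩
  obtain ⟨compat, hcompat⟩ : ∃ compat : β × β × β → β × β × β → Prop, ∀ x y, compat x y ↔
      Disjoint (vs x) (vs y) := ⟨_, fun _ _ => Iff.rfl⟩
  have hPc : (#P : ℝ) ≤ (#U : ℝ) ^ 3 := by
    have := card_le_card (filter_subset (fun x : β × β × β => G.Adj x.2.1 x.1 ∧
      G.Adj x.2.2 x.1 ∧ x.2.1 ≠ x.2.2) (U ×ˢ U ×ˢ U))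
    rw [card_product, card_product] at this
    calc (#P : ℝ) ≤ (#U * (#U * #U) : ℕ) := by exact_mod_cast this
      _ = _ := by push_cast; ring
  have hh : ∀ F ⊆ P, #F < #Z → ∀ θ ∈ U ×ˢ U ×ˢ U, δ ^ 3 / 2 * #P ≤
      #{x ∈ P | (∀ y ∈ F, compat y x) ∧ good θ x} := by
    rintro F - hFZ ⟨u, a, b⟩ hθ
    simp only [mem_product] at hθ
    have hW : #(F.biUnion vs) ≤ δ * #U := by
      have h1 : #(F.biUnion vs) ≤ #F * 3 := card_biUnion_le_card_mul _ _ _ fun x _ => card_le_three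
      have h2 : (#(F.biUnion vs) : ℝ) ≤ #F * 3 := by exact_mod_cast h1
      have h3 : (#F : ℝ) ≤ #Z := by exact_mod_cast hFZ.le
      linarith
    refine le_trans (by gcongr) ((hG.le_card_paths hδN hW hθ.1 hθ.2.1 hθ.2.2).trans ?_)
    rw [hPdef, filter_filter]
    refine Nat.cast_le.2 (card_le_card (monotone_filter_right _ ?_))
    rintro ⟨y, v, w⟩ - ⟨h1, ⟨h2, h3, h4⟩, h5⟩
    refine ⟨h1, fun x hx => (hcompat _ _).2 ?_, (hgood _ _).2 h5⟩
    have h6 : vs x ⊆ F.biUnion vs := subset_biUnion_of_mem vs hx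
    refine disjoint_of_subset_left h6 (Finset.disjoint_right.2 fun t ht => ?_)
    simp only [hvs, mem_insert, mem_singleton] at ht
    rcases ht with rfl | rfl | rfl <;> assumption
  have hQne : (U ×ˢ U ×ˢ U).Nonempty := ⟨(u₀, u₀, u₀), by simp [hu₀]⟩
  have hPne : P.Nonempty := by
    have h1 := hG.le_card_paths hδN (W := ∅) (by rw [card_empty]; push_cast; positivity)
      hu₀ hu₀ hu₀
    have h2 : 0 < δ ^ 3 / 2 * (#U : ℝ) ^ 3 := by positivity
    obtain ⟨x, hx⟩ := card_pos.1 (by exact_mod_cast h2.trans_le h1)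
    obtain ⟨h3, h4, -⟩ := mem_filter.1 hx
    exact ⟨x, mem_filter.2 ⟨h3, h4⟩⟩
  obtain ⟨f, hfP, hfc, hf⟩ := exists_family_potential P (U ×ˢ U ×ˢ U) good
    compat (fun x y h => (hcompat _ _).2 ((hcompat _ _).1 h).symm) #Z (δ ^ 3 / 2) (by positivity) hPne
    hQne hh Z le_rfl
  have hfP' : ∀ z ∈ Z, ((f z).1 ∈ U ∧ (f z).2.1 ∈ U ∧ (f z).2.2 ∈ U) ∧
      G.Adj (f z).2.1 (f z).1 ∧ G.Adj (f z).2.2 (f z).1 ∧ (f z).2.1 ≠ (f z).2.2 := fun z hz => by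
    simpa [hPdef] using hfP z hz
  refine ⟨fun z => (f z).2.1, fun z => (f z).1, fun z => (f z).2.2, fun z hz => ?_, fun z hz => ?_,
    fun z hz => (hfP' z hz).2.2.2, fun z hz z' hz' hne => (hcompat _ _).1 (hfc z hz z' hz' hne),
    fun u hu a ha b hb => ?_⟩
  · obtain ⟨⟨h1, h2, h3⟩, -⟩ := hfP' z hz
    exact ⟨h2, h1, h3⟩
  · obtain ⟨-, h1, h2, -⟩ := hfP' z hz
    exact ⟨h1, h2⟩
  · have h1 : (1 / 2 : ℝ) ^ #{z ∈ Z | good (u, a, b) (f z)} ≤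
        #(U ×ˢ U ×ˢ U) * (1 - δ ^ 3 / 2 / 2) ^ #Z :=
      le_trans (single_le_sum (f := fun θ => (1 / 2 : ℝ) ^ #{z ∈ Z | good θ (f z)})
        (fun θ _ => by positivity) (by simp [hu, ha, hb] : (u, a, b) ∈ U ×ˢ U ×ˢ U)) hf
    have h2 : (#(U ×ˢ U ×ˢ U) : ℝ) = (#U : ℝ) ^ 3 := by
      rw [card_product, card_product]
      push_cast
      ring
    rw [h2] at h1
    have h3 := hK₁ _ _ _ ((Nat.le_add_right _ _).trans hK) hcZ h1
    have h4 : #{z ∈ Z | good (u, a, b) (f z)} ≤ #{z ∈ Z | G.Adj (f z).2.1 u ∧ G.Adj (f z).2.2 u ∧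
        G.Adj a (f z).1 ∧ G.Adj b (f z).1} :=
      card_le_card fun z hz => mem_filter.2
        ⟨(mem_filter.1 hz).1, (hgood _ _).1 (mem_filter.1 hz).2⟩
    refine le_trans (le_of_eq (by ring)) (h3.trans (Nat.cast_le.2 h4))

end Absorbers

section Prescribed

variable {α β : Type} {G : SimpleGraph β} {π : α → α} {d : α → ℕ}

/-- A small tree embeds with prescribed images of the vertices in `Q`, as long as every other vertex
has at most one child in `Q`. -/
theorem exists_isTreeEmb_prescribed {δ : ℝ} {S Q : Finset α} {x : α} {U : Finset β} {f : α → β}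
    (hS : IsSubtree π d S x) (hQ : Q ⊆ S) (hf : Set.InjOn f Q) (hfU : ∀ i ∈ Q, f i ∈ U)
    (hadj : ∀ i ∈ Q, i ≠ x → π i ∈ Q → G.Adj (f (π i)) (f i))
    (hone : ∀ i ∈ Q, ∀ j ∈ Q, i ≠ x → j ≠ x → π i = π j → π i ∉ Q → i = j)
    (hG : DiracOn G δ U) (hsmall : #S < 2 * δ * #U) :
    ∃ φ, IsTreeEmb G π S x U φ ∧ ∀ i ∈ Q, φ i = f i := by
  have hU0 : 0 < #U := by
    by_contra h
    have : #U = 0 := by omega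
    rw [this] at hsmall
    have : (0 : ℝ) ≤ #S := by positivity
    simp at hsmall
    linarith
  obtain ⟨u₀, hu₀⟩ := card_pos.1 hU0
  have main : ∀ P : Finset α, P ⊆ S \ Q → ∃ φ : α → β, Set.InjOn φ (P ∪ Q : Finset α) ∧
      (∀ i ∈ P ∪ Q, φ i ∈ U) ∧ (∀ i ∈ Q, φ i = f i) ∧
      ∀ i ∈ P ∪ Q, i ≠ x → π i ∈ P ∪ Q → G.Adj (φ (π i)) (φ i) := by
    intro P
    induction P using Finset.induction_on_max_value d with
    | empty =>
      intro _
      simp only [empty_union]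
      exact ⟨f, hf, hfU, fun _ _ => rfl, hadj⟩
    | insert a P ha hmax ih =>
      intro hP
      have haS := hP (mem_insert_self a P)
      obtain ⟨haS, haQ⟩ := mem_sdiff.1 haS
      have hPS : P ⊆ S \ Q := (subset_insert a P).trans hP
      obtain ⟨φ, hinj, hU, hφf, hφ⟩ := ih hPS
      have haPQ : a ∉ P ∪ Q := by simp [ha, haQ]
      obtain ⟨b₁, hb₁, hb₁'⟩ : ∃ b ∈ U, π a ∈ P ∪ Q → b = φ (π a) := by
        by_cases h : π a ∈ P ∪ Q
        · exact ⟨_, hU _ h, fun _ => rfl⟩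
        · exact ⟨u₀, hu₀, fun h' => absurd h' h⟩
      obtain ⟨b₂, hb₂, hb₂'⟩ : ∃ b ∈ U, ∀ i ∈ Q, i ≠ x → π i = a → b = f i := by
        by_cases h : ∃ i ∈ Q, i ≠ x ∧ π i = a
        · obtain ⟨i, hi, hix, hia⟩ := h
          refine ⟨f i, hfU i hi, fun j hj hjx hja => ?_⟩
          rw [hone i hi j hj hix hjx (hia.trans hja.symm) (hia ▸ haQ)]
        · exact ⟨u₀, hu₀, fun i h1 h2 h3 => absurd ⟨i, h1, h2, h3⟩ h⟩
      obtain ⟨c, hc, hcn⟩ : ∃ c ∈ nbrsIn G b₁ U ∩ nbrsIn G b₂ U, c ∉ (P ∪ Q).image φ := by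
        refine exists_mem_notMem_of_card_lt_card ?_
        have h1 : #((P ∪ Q).image φ) ≤ #S := card_image_le.trans
          (card_le_card (union_subset (hPS.trans sdiff_subset) hQ))
        have h2 := hG.le_card_inter hb₁ hb₂
        have h3 : (#S : ℝ) < #(nbrsIn G b₁ U ∩ nbrsIn G b₂ U) := by linarith
        have h4 : #S < #(nbrsIn G b₁ U ∩ nbrsIn G b₂ U) := by exact_mod_cast h3
        omega
      obtain ⟨hc1, hc2⟩ := mem_inter.1 hc
      have hval : ∀ i ∈ P ∪ Q, Function.update φ a c i = φ i := fun i hi =>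
        Function.update_of_ne (by rintro rfl; exact haPQ hi) _ _
      rw [insert_union]
      refine ⟨Function.update φ a c, ?_, ?_, ?_, ?_⟩
      · rw [coe_insert, Set.injOn_insert (by exact_mod_cast haPQ)]
        refine ⟨fun i hi j hj hij => ?_, ?_⟩
        · rw [hval i hi, hval j hj] at hij
          exact hinj hi hj hij
        · rintro ⟨i, hi, hic⟩
          rw [Function.update_self, hval i hi] at hic
          exact hcn (mem_image.2 ⟨i, hi, hic⟩)
      · intro i hi
        rcases mem_insert.1 hi with rfl | hi
        · rw [Function.update_self]
          exact (mem_nbrsIn.1 hc1).1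
        · rw [hval i hi]
          exact hU i hi
      · intro i hi
        rw [hval i (mem_union_right _ hi)]
        exact hφf i hi
      · intro i hi hix hπi
        have hiS : i ∈ S := by
          rcases mem_insert.1 hi with rfl | hi
          · exact haS
          · exact union_subset (hPS.trans sdiff_subset) hQ hi
        have hd := hS.depth_eq i hiS hix
        have hne : π i ≠ i := fun e => by rw [e] at hd; omega
        rw [mem_insert] at hi hπi
        rcases hi with hia | hi
        · have h1 : π a ∈ P ∪ Q := by
            rcases hπi with h | h
            · exact absurd (h.trans hia.symm) hne
            · exact hia ▸ h
          rw [hia, Function.update_self, hval _ h1, ← hb₁' h1]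
          exact (mem_nbrsIn.1 hc1).2
        · rcases hπi with h | h
          · have hiQ : i ∈ Q := by
              rcases mem_union.1 hi with h' | h'
              · have := hmax i h'
                rw [h] at hd
                omega
              · exact h'
            rw [h, Function.update_self, hval i hi, hφf i hiQ, ← hb₂' i hiQ hix h]
            exact (mem_nbrsIn.1 hc2).2.symm
          · rw [hval _ h, hval i hi]
            exact hφ i hi hix h
  obtain ⟨φ, h1, h2, h3, h4⟩ := main (S \ Q) le_rfl
  rw [sdiff_union_of_subset hQ] at h1 h2 h4
  exact ⟨φ, ⟨h2, h1, fun i hi hix => h4 i hi hix (hS.parent_mem i hi hix)⟩, h3⟩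

/-- The vertex `z` and its first three ancestors. -/
noncomputable def ancestors (π : α → α) (z : α) : Finset α := {z, π z, π (π z), π (π (π z))}

theorem card_filter_mem_ancestors_le [Fintype α] {Δ : ℕ} (hΔ1 : 1 ≤ Δ)
    (hΔ : ∀ i, #{j | π j = i} ≤ Δ) (w : α) : #{z | w ∈ ancestors π z} ≤ 4 * Δ ^ 3 := by
  have step : ∀ (A : Finset α), #{z | π z ∈ A} ≤ #A * Δ := fun A => by
    have : ({z | π z ∈ A} : Finset α) ⊆ A.biUnion fun i => {j | π j = i} := fun z hz => by
      simpa using hz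
    exact (card_le_card this).trans (card_biUnion_le_card_mul _ _ _ fun i _ => hΔ i)
  set A₁ : Finset α := {z | π z ∈ ({w} : Finset α)} with hA₁
  set A₂ : Finset α := {z | π z ∈ A₁} with hA₂
  set A₃ : Finset α := {z | π z ∈ A₂} with hA₃
  have h1 : #A₁ ≤ Δ := by simpa [hA₁] using step {w}
  have h2 : #A₂ ≤ Δ ^ 2 := (step A₁).trans (by rw [pow_two]; gcongr)
  have h3 : #A₃ ≤ Δ ^ 3 := (step A₂).trans (by rw [pow_succ]; gcongr)
  have hsub : ({z | w ∈ ancestors π z} : Finset α) ⊆ {w} ∪ (A₁ ∪ (A₂ ∪ A₃)) := fun z hz => by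
    simp only [ancestors, mem_filter, mem_univ, true_and, mem_insert, mem_singleton] at hz
    simp only [hA₁, hA₂, hA₃, mem_union, mem_filter, mem_univ, true_and, mem_singleton]
    grind
  have e1 : 1 ≤ Δ ^ 3 := Nat.one_le_pow _ _ hΔ1
  have e2 : Δ ≤ Δ ^ 3 := Nat.le_self_pow (by norm_num) _
  have e3 : Δ ^ 2 ≤ Δ ^ 3 := Nat.pow_le_pow_right hΔ1 (by norm_num)
  have h4 := card_le_card hsub
  have h5 := card_union_le {w} (A₁ ∪ (A₂ ∪ A₃))
  have h6 := card_union_le A₁ (A₂ ∪ A₃)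
  have h7 := card_union_le A₂ A₃
  rw [card_singleton] at h5
  omega

/-- Many vertices of a tree with bounded degrees have at most one child each and pairwise disjoint
sets of nearby ancestors. -/
theorem IsSubtree.exists_scattered [Fintype α] {Δ : ℕ} (hΔ1 : 1 ≤ Δ)
    (hΔ : ∀ i, #{j | π j = i} ≤ Δ) {S : Finset α} {x : α} (hS : IsSubtree π d S x) :
    ∃ Z ⊆ S.erase x, (∀ z ∈ Z, #{j ∈ S.erase x | π j = z} ≤ 1) ∧
      (∀ z ∈ Z, ∀ z' ∈ Z, z ≠ z' → Disjoint (ancestors π z) (ancestors π z')) ∧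
      #S ≤ 32 * Δ ^ 3 * #Z + 1 := by
  set L := {z ∈ S.erase x | #{j ∈ S.erase x | π j = z} ≤ 1} with hL
  have hLS : L ⊆ S.erase x := filter_subset _ _
  have hSc : #(S.erase x) + 1 = #S := card_erase_add_one hS.root_mem
  have hLc : #(S.erase x) ≤ 2 * #L := by
    have h1 : #(S.erase x) = ∑ z ∈ S, #{j ∈ S.erase x | π j = z} :=
      card_eq_sum_card_fiberwise fun j hj =>
        hS.parent_mem j (mem_erase.1 hj).2 (mem_erase.1 hj).1
    have h2 : 2 * #(S.erase x \ L) ≤ ∑ z ∈ S.erase x \ L, #{j ∈ S.erase x | π j = z} := by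
      rw [mul_comm, ← smul_eq_mul]
      refine card_nsmul_le_sum _ _ _ fun z hz => ?_
      obtain ⟨h3, h4⟩ := mem_sdiff.1 hz
      by_contra h5
      exact h4 (mem_filter.2 ⟨h3, by omega⟩)
    have h3 : ∑ z ∈ S.erase x \ L, #{j ∈ S.erase x | π j = z} ≤
        ∑ z ∈ S, #{j ∈ S.erase x | π j = z} :=
      sum_le_sum_of_subset (sdiff_subset.trans (erase_subset _ _))
    have h4 := card_sdiff_add_card_eq_card hLS
    omega
  obtain ⟨Z, hZ, hmax⟩ := exists_max_image
    {Z ∈ L.powerset | ∀ z ∈ Z, ∀ z' ∈ Z, z ≠ z' → Disjoint (ancestors π z) (ancestors π z')}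
    card ⟨∅, by simp⟩
  simp only [mem_filter, mem_powerset] at hZ hmax
  obtain ⟨hZL, hZd⟩ := hZ
  refine ⟨Z, hZL.trans hLS, fun z hz => (mem_filter.1 (hZL hz)).2, hZd, ?_⟩
  have hcov : L ⊆ Z.biUnion fun z => (ancestors π z).biUnion fun w => {y | w ∈ ancestors π y} := by
    intro y hy
    by_contra hcon
    simp only [mem_biUnion, mem_filter, mem_univ, true_and, not_exists, not_and] at hcon
    have hself : ∀ z, z ∈ ancestors π z := fun z => mem_insert_self _ _
    have hyZ : y ∉ Z := fun h => hcon y h y (hself y) (hself y)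
    have := hmax (insert y Z) ⟨insert_subset hy hZL, fun z hz z' hz' hne => ?_⟩
    · rw [card_insert_of_notMem hyZ] at this
      omega
    · rw [mem_insert] at hz hz'
      rcases hz with rfl | hz <;> rcases hz' with rfl | hz'
      · exact absurd rfl hne
      · exact Finset.disjoint_right.2 fun w hw => hcon z' hz' w hw
      · exact Finset.disjoint_left.2 fun w hw => hcon z hz w hw
      · exact hZd z hz z' hz' hne
  have hLZ : #L ≤ #Z * (4 * (4 * Δ ^ 3)) := by
    refine (card_le_card hcov).trans (card_biUnion_le_card_mul _ _ _ fun z _ => ?_)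
    refine (card_biUnion_le_card_mul _ _ _ fun w _ =>
      card_filter_mem_ancestors_le hΔ1 hΔ w).trans ?_
    gcongr
    exact card_le_four
  nlinarith

end Prescribed

section Spanning

variable {α β : Type} {G : SimpleGraph β} {π : α → α} {d : α → ℕ}

/-- A small tree embeds so that the images of the vertices in a scattered set `Z`, together with
their neighbours, form an absorber. -/
theorem exists_isTreeEmb_absorber {δ κ : ℝ} {S Z : Finset α} {x : α} {U : Finset β}
    {v y w : α → β} (hS : IsSubtree π d S x) (hZ : Z ⊆ S.erase x)
    (hchild : ∀ z ∈ Z, #{j ∈ S.erase x | π j = z} ≤ 1)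
    (hanc : ∀ z ∈ Z, ∀ z' ∈ Z, z ≠ z' → Disjoint (ancestors π z) (ancestors π z'))
    (hG : DiracOn G δ U) (hsmall : #S < 2 * δ * #U) (hA : IsAbsorber G κ U Z v y w) :
    ∃ φ, IsTreeEmb G π S x U φ ∧ (∀ z ∈ Z, φ z = y z) ∧
      ∀ Y : α → β, (∀ z ∈ Z, G.Adj (v z) (Y z) ∧ G.Adj (w z) (Y z)) →
        ∀ i ∈ S, i ≠ x → G.Adj (Z.piecewise Y φ (π i)) (Z.piecewise Y φ i) := by
  have hdis : ∀ z ∈ Z, ∀ z' ∈ Z, ∀ a, a ∈ ancestors π z → a ∈ ancestors π z' → z = z' := by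
    intro z hz z' hz' a ha ha'
    by_contra hne
    exact Finset.disjoint_left.1 (hanc z hz z' hz' hne) ha ha'
  have m0 : ∀ z, z ∈ ancestors π z := fun z => by simp [ancestors]
  have m1 : ∀ z, π z ∈ ancestors π z := fun z => by simp [ancestors]
  have m2 : ∀ z, π (π z) ∈ ancestors π z := fun z => by simp [ancestors]
  have m3 : ∀ z, π (π (π z)) ∈ ancestors π z := fun z => by simp [ancestors]
  have hZS : ∀ z ∈ Z, z ∈ S ∧ z ≠ x ∧ π z ∈ S ∧ d z = d (π z) + 1 := fun z hz => by
    obtain ⟨h1, h2⟩ := mem_erase.1 (hZ hz)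
    exact ⟨h2, h1, hS.parent_mem z h2 h1, hS.depth_eq z h2 h1⟩
  have hpZ : ∀ z ∈ Z, π z ∉ Z := fun z hz h => by
    have h1 := hdis z hz _ h _ (m1 z) (m0 _)
    have h2 := (hZS z hz).2.2.2
    rw [← h1] at h2
    omega
  have hppZ : ∀ z ∈ Z, π z ≠ x → π (π z) ∉ Z := fun z hz hx h => by
    have h1 := hdis z hz _ h _ (m2 z) (m0 _)
    have h2 := (hZS z hz).2.2.2
    have h3 := hS.depth_eq _ (hZS z hz).2.2.1 hx
    rw [← h1] at h3
    omega
  have hinjπ : Set.InjOn π Z := fun z hz z' hz' h => hdis z hz z' hz' _ (m1 z) (h ▸ m1 z')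
  set Q := {i ∈ S | i ∈ Z ∨ (∃ z ∈ Z, π z = i) ∨ i ≠ x ∧ π i ∈ Z} with hQ
  have hQS : Q ⊆ S := filter_subset _ _
  obtain ⟨f, hf⟩ : ∃ f : α → β, ∀ i, f i = if i ∈ Z then y i else if i ≠ x ∧ π i ∈ Z then w (π i)
      else if h : ∃ z ∈ Z, π z = i then v h.choose else y i := ⟨_, fun _ => rfl⟩
  have f0 : ∀ z ∈ Z, f z = y z := fun z hz => by rw [hf, if_pos hz]
  have f1 : ∀ z ∈ Z, f (π z) = v z := fun z hz => by
    have h : ∃ z' ∈ Z, π z' = π z := ⟨z, hz, rfl⟩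
    rw [hf, if_neg (hpZ z hz), if_neg fun h => hppZ z hz h.1 h.2, dif_pos h]
    rw [hinjπ h.choose_spec.1 hz h.choose_spec.2]
  have f2 : ∀ i ∈ S, i ≠ x → π i ∈ Z → f i = w (π i) := fun i hi hix h => by
    rw [hf, if_neg fun h' => hpZ i h' h, if_pos ⟨hix, h⟩]
  have hrole : ∀ i ∈ Q, ∃ z ∈ Z, (i = z ∧ f i = y z) ∨ (i = π z ∧ f i = v z) ∨
      (i ∈ S ∧ i ≠ x ∧ π i = z ∧ f i = w z) := by
    intro i hi
    obtain ⟨hiS, hi⟩ := mem_filter.1 hi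
    rcases hi with hi | ⟨z, hz, rfl⟩ | ⟨hix, hi⟩
    · exact ⟨i, hi, Or.inl ⟨rfl, f0 i hi⟩⟩
    · exact ⟨z, hz, Or.inr (Or.inl ⟨rfl, f1 z hz⟩)⟩
    · exact ⟨π i, hi, Or.inr (Or.inr ⟨hiS, hix, rfl, f2 i hiS hix hi⟩)⟩
  have zQ : ∀ z ∈ Z, z ∈ Q := fun z hz => mem_filter.2 ⟨(hZS z hz).1, Or.inl hz⟩
  have pQ : ∀ z ∈ Z, π z ∈ Q := fun z hz =>
    mem_filter.2 ⟨(hZS z hz).2.2.1, Or.inr (Or.inl ⟨z, hz, rfl⟩)⟩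
  have hinj : Set.InjOn f Q := by
    intro i hi j hj hij
    obtain ⟨z, hz, hi⟩ := hrole i hi
    obtain ⟨z', hz', hj⟩ := hrole j hj
    by_cases hzz : z = z'
    · subst hzz
      obtain ⟨a1, a2⟩ := hA.adj z hz
      have a3 := hA.ne z hz
      have a1 := a1.ne
      have a2 := a2.ne
      rcases hi with ⟨hi, hi'⟩ | ⟨hi, hi'⟩ | ⟨hiS, hix, hi, hi'⟩ <;>
        rcases hj with ⟨hj, hj'⟩ | ⟨hj, hj'⟩ | ⟨hjS, hjx, hj, hj'⟩ <;> rw [hi', hj'] at hij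
      · rw [hi, hj]
      · exact absurd hij.symm a1
      · exact absurd hij.symm a2
      · exact absurd hij a1
      · rw [hi, hj]
      · exact absurd hij a3
      · exact absurd hij a2
      · exact absurd hij.symm a3
      · exact card_le_one.1 (hchild z hz) i (by simp [hiS, hix, hi]) j (by simp [hjS, hjx, hj])
    · have h1 : f i ∈ ({v z, y z, w z} : Finset β) := by
        rcases hi with ⟨-, h⟩ | ⟨-, h⟩ | ⟨-, -, -, h⟩ <;> simp [h]
      have h2 : f j ∈ ({v z', y z', w z'} : Finset β) := by
        rcases hj with ⟨-, h⟩ | ⟨-, h⟩ | ⟨-, -, -, h⟩ <;> simp [h]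
      exact absurd (hij ▸ h2) (Finset.disjoint_left.1 (hA.disj z hz z' hz' hzz) h1)
  have hfU : ∀ i ∈ Q, f i ∈ U := by
    intro i hi
    obtain ⟨z, hz, hi⟩ := hrole i hi
    obtain ⟨h1, h2, h3⟩ := hA.mem z hz
    rcases hi with ⟨-, h⟩ | ⟨-, h⟩ | ⟨-, -, -, h⟩ <;> rw [h] <;> assumption
  have hadj : ∀ i ∈ Q, i ≠ x → π i ∈ Q → G.Adj (f (π i)) (f i) := by
    intro i hi hix hπi
    obtain ⟨z, hz, hi⟩ := hrole i hi
    rcases hi with ⟨rfl, h⟩ | ⟨rfl, h⟩ | ⟨-, -, rfl, h⟩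
    · rw [h, f1 i hz]
      exact (hA.adj i hz).1
    · exfalso
      have d1 := (hZS z hz).2.2.2
      have d2 := hS.depth_eq _ (hZS z hz).2.2.1 hix
      obtain ⟨z', hz', h'⟩ := hrole _ hπi
      have hzz : z = z' := by
        rcases h' with ⟨h, -⟩ | ⟨h, -⟩ | ⟨-, -, h, -⟩
        · exact hdis z hz z' hz' _ (m2 z) (h ▸ m0 _)
        · exact hdis z hz z' hz' _ (m2 z) (h ▸ m1 z')
        · exact hdis z hz z' hz' _ (m3 z) (h ▸ m0 _)
      subst hzz
      rcases h' with ⟨h, -⟩ | ⟨h, -⟩ | ⟨h1, h2, h, -⟩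
      · rw [h] at d2; omega
      · rw [h] at d2; omega
      · have := hS.depth_eq _ h1 h2
        rw [h] at this
        omega
    · rw [h, f0 _ hz]
      exact (hA.adj _ hz).2.symm
  have hone : ∀ i ∈ Q, ∀ j ∈ Q, i ≠ x → j ≠ x → π i = π j → π i ∉ Q → i = j := by
    have key : ∀ i ∈ Q, π i ∉ Q → ∃ z ∈ Z, i = π z := by
      intro i hi hn
      obtain ⟨z, hz, hi⟩ := hrole i hi
      rcases hi with ⟨rfl, h⟩ | ⟨rfl, h⟩ | ⟨-, -, rfl, h⟩
      · exact absurd (pQ i hz) hn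
      · exact ⟨z, hz, rfl⟩
      · exact absurd (zQ _ hz) hn
    intro i hi j hj hix hjx hij hn
    obtain ⟨z, hz, rfl⟩ := key i hi hn
    obtain ⟨z', hz', rfl⟩ := key j hj (hij ▸ hn)
    rw [hdis z hz z' hz' _ (m2 z) (hij ▸ m2 z')]
  obtain ⟨φ, hφ, hφf⟩ := exists_isTreeEmb_prescribed hS hQS hinj hfU hadj hone hG hsmall
  refine ⟨φ, hφ, fun z hz => by rw [hφf z (zQ z hz), f0 z hz], fun Y hY i hi hix => ?_⟩
  by_cases hiZ : i ∈ Z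
  · rw [piecewise_eq_of_mem _ _ _ hiZ, piecewise_eq_of_notMem _ _ _ (hpZ i hiZ),
      hφf _ (pQ i hiZ), f1 i hiZ]
    exact (hY i hiZ).1
  · by_cases hπZ : π i ∈ Z
    · rw [piecewise_eq_of_notMem _ _ _ hiZ, piecewise_eq_of_mem _ _ _ hπZ,
        hφf i (mem_filter.2 ⟨hi, Or.inr (Or.inr ⟨hix, hπZ⟩)⟩), f2 i hi hix hπZ]
      exact (hY _ hπZ).2.symm
    · rw [piecewise_eq_of_notMem _ _ _ hiZ, piecewise_eq_of_notMem _ _ _ hπZ]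
      exact hφ.adj i hi hix

/-- An absorber can accommodate any set `X` of new vertices in place of the vertices `y z` with
`z ∈ J`. -/
theorem IsAbsorber.exists_absorb {κ : ℝ} {Z J : Finset α} {U X : Finset β} {v y w : α → β}
    (hA : IsAbsorber G κ U Z v y w) (hJ : J ⊆ Z) (hJc : 2 * (#J : ℝ) ≤ κ * #Z) (hX : X ⊆ U)
    (hXJ : #X = #J) (hXy : Disjoint X ((Z \ J).image y)) :
    ∃ Y : α → β, Set.InjOn Y Z ∧ (∀ z ∈ Z, Y z ∈ X ∪ (Z \ J).image y) ∧
      ∀ z ∈ Z, G.Adj (v z) (Y z) ∧ G.Adj (w z) (Y z) := by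
  rcases J.eq_empty_or_nonempty with rfl | ⟨j₀, hj₀⟩
  · refine ⟨y, ?_, fun z hz => ?_, hA.adj⟩
    · intro z hz z' hz' h
      by_contra hne
      exact Finset.disjoint_left.1 (hA.disj z hz z' hz' hne) (by simp : y z ∈ _) (by simp [h])
    · rw [sdiff_empty]
      exact mem_union_right _ (mem_image_of_mem y hz)
  have hyinj : Set.InjOn y Z := by
    intro z hz z' hz' h
    by_contra hne
    exact Finset.disjoint_left.1 (hA.disj z hz z' hz' hne) (by simp : y z ∈ _) (by simp [h])
  have : Nonempty β := ⟨y j₀⟩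
  obtain ⟨u, huX, huinj⟩ := exists_injOn_of_card_le (X := J) (Y := X) hXJ.ge
  obtain ⟨k, hkinj, hk⟩ : ∃ k : α → α, Set.InjOn k J ∧ ∀ i ∈ J, k i ∈ Z \ J ∧
      G.Adj (v (k i)) (u i) ∧ G.Adj (w (k i)) (u i) ∧ G.Adj (v i) (y (k i)) ∧
      G.Adj (w i) (y (k i)) := by
    set t : {i // i ∈ J} → Finset α := fun i => {z ∈ Z | G.Adj (v z) (u i) ∧ G.Adj (w z) (u i) ∧
      G.Adj (v i) (y z) ∧ G.Adj (w i) (y z)} \ J with ht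
    have htc : ∀ i, #J ≤ #(t i) := by
      rintro ⟨i, hi⟩
      obtain ⟨h1, -, h2⟩ := hA.mem i (hJ hi)
      have h3 := hA.many (u i) (hX (huX i hi)) (v i) h1 (w i) h2
      have h4 : 2 * #J ≤ #{z ∈ Z | G.Adj (v z) (u i) ∧ G.Adj (w z) (u i) ∧
          G.Adj (v i) (y z) ∧ G.Adj (w i) (y z)} := by
        exact_mod_cast hJc.trans h3
      have h5 := le_card_sdiff J {z ∈ Z | G.Adj (v z) (u i) ∧ G.Adj (w z) (u i) ∧
          G.Adj (v i) (y z) ∧ G.Adj (w i) (y z)}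
      simp only [ht]
      omega
    obtain ⟨k, hk, hkt⟩ := (all_card_le_biUnion_card_iff_exists_injective t).1 (by
      intro s
      rcases s.eq_empty_or_nonempty with rfl | ⟨i, hi⟩
      · simp
      · calc #s ≤ Fintype.card {i // i ∈ J} := card_le_univ s
          _ = #J := Fintype.card_coe J
          _ ≤ #(t i) := htc i
          _ ≤ _ := card_le_card (subset_biUnion_of_mem t hi))
    refine ⟨fun i => if h : i ∈ J then k ⟨i, h⟩ else i, fun i hi j hj hij => ?_, fun i hi => ?_⟩
    · rw [mem_coe] at hi hj
      simp only [hi, hj, dif_pos] at hij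
      exact Subtype.mk.inj (hk hij)
    · simp only [hi, dif_pos]
      obtain ⟨h1, h2⟩ := mem_sdiff.1 (hkt ⟨i, hi⟩)
      obtain ⟨h3, h4⟩ := mem_filter.1 h1
      exact ⟨mem_sdiff.2 ⟨h3, h2⟩, h4⟩
  obtain ⟨Y, hY⟩ : ∃ Y : α → β, ∀ z, Y z = if z ∈ J then y (k z) else
      if h : ∃ i ∈ J, k i = z then u h.choose else y z := ⟨_, fun _ => rfl⟩
  have Y0 : ∀ i ∈ J, Y i = y (k i) := fun i hi => by rw [hY, if_pos hi]
  have Y1 : ∀ i ∈ J, Y (k i) = u i := fun i hi => by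
    have h : ∃ j ∈ J, k j = k i := ⟨i, hi, rfl⟩
    rw [hY, if_neg (mem_sdiff.1 (hk i hi).1).2, dif_pos h, hkinj h.choose_spec.1 hi h.choose_spec.2]
  have Y2 : ∀ z, z ∉ J → (∀ i ∈ J, k i ≠ z) → Y z = y z := fun z hz hz' => by
    rw [hY, if_neg hz, dif_neg (by push Not; exact hz')]
  have hrole : ∀ z ∈ Z, (z ∈ J ∧ Y z = y (k z)) ∨ (∃ i ∈ J, z = k i ∧ Y z = u i) ∨
      (z ∈ Z \ J ∧ (∀ i ∈ J, k i ≠ z) ∧ Y z = y z) := by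
    intro z hz
    by_cases h1 : z ∈ J
    · exact Or.inl ⟨h1, Y0 z h1⟩
    by_cases h2 : ∃ i ∈ J, k i = z
    · obtain ⟨i, hi, rfl⟩ := h2
      exact Or.inr (Or.inl ⟨i, hi, rfl, Y1 i hi⟩)
    · push Not at h2
      exact Or.inr (Or.inr ⟨mem_sdiff.2 ⟨hz, h1⟩, h2, Y2 z h1 h2⟩)
  have hkZ : ∀ i ∈ J, k i ∈ Z := fun i hi => (mem_sdiff.1 (hk i hi).1).1
  have huy : ∀ i ∈ J, ∀ z ∈ Z \ J, u i ≠ y z := fun i hi z hz h =>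
    Finset.disjoint_left.1 hXy (huX i hi) (h ▸ mem_image_of_mem y hz)
  refine ⟨Y, ?_, ?_, ?_⟩
  · intro z hz z' hz' h
    rcases hrole z hz with ⟨h1, h2⟩ | ⟨i, h1, rfl, h2⟩ | ⟨h1, h3, h2⟩ <;>
      rcases hrole z' hz' with ⟨h1', h2'⟩ | ⟨i', h1', rfl, h2'⟩ | ⟨h1', h3', h2'⟩ <;>
      rw [h2, h2'] at h
    · exact hkinj h1 h1' (hyinj (hkZ z h1) (hkZ z' h1') h)
    · exact absurd h.symm (huy _ h1' _ (hk z h1).1)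
    · exact absurd (hyinj (hkZ z h1) hz' h) (h3' z h1)
    · exact absurd h (huy _ h1 _ (hk _ h1').1)
    · rw [huinj h1 h1' h]
    · exact absurd h (huy _ h1 _ h1')
    · exact absurd (hyinj hz (hkZ _ h1') h).symm (h3 _ h1')
    · exact absurd h.symm (huy _ h1' _ h1)
    · exact hyinj hz hz' h
  · intro z hz
    rcases hrole z hz with ⟨h1, h2⟩ | ⟨i, h1, rfl, h2⟩ | ⟨h1, h3, h2⟩ <;> rw [h2]
    · exact mem_union_right _ (mem_image_of_mem y (hk z h1).1)
    · exact mem_union_left _ (huX i h1)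
    · exact mem_union_right _ (mem_image_of_mem y h1)
  · intro z hz
    rcases hrole z hz with ⟨h1, h2⟩ | ⟨i, h1, rfl, h2⟩ | ⟨h1, h3, h2⟩ <;> rw [h2]
    · exact (hk z h1).2.2.2
    · exact ⟨(hk i h1).2.1, (hk i h1).2.2.1⟩
    · exact hA.adj z hz

end Spanning

section SpanningEmbedding

set_option maxHeartbeats 1000000 in
/-- A graph with minimum degree well above half its order contains every spanning tree of bounded
degree, with the root in any prescribed large set. -/
theorem exists_isTreeEmb_spanning (Δ : ℕ) (hΔ1 : 1 ≤ Δ) (δ : ℝ) (hδ : 0 < δ) (hδ1 : δ ≤ 1 / 2) :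
    ∃ K : ℕ, ∀ (α β : Type) [Fintype α] [Fintype β] (π : α → α) (d : α → ℕ),
      (∀ i, #{j | π j = i} ≤ Δ) → ∀ (G : SimpleGraph β) (U : Finset β), DiracOn G δ U →
      K ≤ #U → ∀ (S : Finset α) (r : α), IsSubtree π d S r → #S = #U →
      ∀ D ⊆ U, (1 / 2 + δ) * #U ≤ (#D : ℝ) → ∃ φ, IsTreeEmb G π S r U φ ∧ φ r ∈ D := by
  have hΔ0 : (1 : ℝ) ≤ Δ := by exact_mod_cast hΔ1
  obtain ⟨c, hc⟩ : ∃ c, c = δ / (1024 * (Δ : ℝ) ^ 4) := ⟨_, rfl⟩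
  have hc0 : 0 < c := by rw [hc]; positivity
  obtain ⟨κ, hκ⟩ : ∃ κ, κ = δ ^ 3 / 8 := ⟨_, rfl⟩
  have hκ0 : 0 < κ := by rw [hκ]; positivity
  have hκ1 : κ ≤ 1 := by
    have : δ ^ 3 ≤ 1 := pow_le_one₀ hδ.le (by linarith)
    rw [hκ]; linarith
  have hc1 : c ≤ 1 := by
    rw [hc, div_le_one (by positivity)]
    have : (1 : ℝ) ≤ (Δ : ℝ) ^ 4 := one_le_pow₀ hΔ0
    linarith
  obtain ⟨η, hη⟩ : ∃ η, η = κ * c / 4 := ⟨_, rfl⟩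
  have hη0 : 0 < η := by rw [hη]; positivity
  have hη1 : η ≤ 1 := by rw [hη]; nlinarith
  obtain ⟨K₁, hK₁⟩ := exists_isAbsorber δ c hδ (by linarith) hc0
  obtain ⟨K₂, hK₂⟩ := exists_isTreeEmb_almostSpanning Δ hΔ1 (δ / 2) η (by positivity)
    (by linarith) hη0 hη1
  obtain ⟨K₃, hK₃⟩ := exists_nat_ge (4 / (κ * c) + 16 * Δ / δ)
  refine ⟨K₁ + 2 * K₂ + K₃ + 1, fun α β _ _ π d hΔ G U hG hK S r hS hSU D hDU hD => ?_⟩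
  have hN : 4 / (κ * c) + 16 * Δ / δ ≤ #U := hK₃.trans (by exact_mod_cast (by omega : K₃ ≤ #U))
  have hN0 : (1 : ℝ) ≤ #U := by exact_mod_cast (by omega : 1 ≤ #U)
  have hN1 : 4 ≤ κ * c * #U := by
    rw [← div_le_iff₀' (by positivity)]
    have : 0 ≤ 16 * Δ / δ := by positivity
    linarith
  have hN2 : 2 ≤ δ * #U / (8 * Δ) := by
    rw [le_div_iff₀ (by positivity)]
    have : 16 * Δ / δ ≤ #U := by
      have : 0 ≤ 4 / (κ * c) := by positivity
      linarith
    rw [div_le_iff₀' hδ] at this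
    linarith
  obtain ⟨t, ht⟩ : ∃ t, t = ⌊δ * #U / (8 * Δ)⌋₊ := ⟨_, rfl⟩
  have ht2 : 2 ≤ t := by rw [ht]; exact Nat.le_floor (by exact_mod_cast hN2)
  have htle : (t : ℝ) ≤ δ * #U / (8 * Δ) := by rw [ht]; exact Nat.floor_le (by positivity)
  have htge : δ * #U / (8 * Δ) < t + 1 := by rw [ht]; exact Nat.lt_floor_add_one _
  have hΔt : (Δ : ℝ) * t ≤ δ / 8 * #U := by
    rw [le_div_iff₀ (by positivity)] at htle
    linarith
  obtain ⟨x, hxS, hxr, hxt, hxle⟩ := hS.exists_branch (t := t) hΔ hΔ1 (by omega) (by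
    rw [hSU]
    have : (Δ : ℝ) * t < #U := by nlinarith
    exact_mod_cast this)
  have hB := hS.branch hxS
  have hS' := hS.sdiff_branch hxS hxr
  have hπx := hS.parent_notMem_branch hxS hxr
  have hBS : branch π d S x ⊆ S := branch_subset x
  set B := branch π d S x with hBdef
  have hBN : (#B : ℝ) ≤ δ / 8 * #U := by
    refine le_trans ?_ hΔt
    exact_mod_cast hxle
  obtain ⟨Z, hZ, hchild, hanc, hZc⟩ := hB.exists_scattered hΔ1 hΔ
  have hZB : Z ⊆ B := hZ.trans (erase_subset _ _)
  have hxZ : x ∉ Z := fun h => (mem_erase.1 (hZ h)).1 rfl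
  have hcZ : c * #U ≤ #Z := by
    have h1 : (t : ℝ) ≤ 32 * Δ ^ 3 * #Z + 1 := by exact_mod_cast hxt.trans hZc
    have h2 : δ * #U / (16 * Δ) ≤ 32 * Δ ^ 3 * #Z := by
      have h3 : (2 : ℝ) ≤ t := by exact_mod_cast ht2
      have h4 : δ * #U / (8 * Δ) = 2 * (δ * #U / (16 * Δ)) := by field_simp; norm_num
      have h5 : δ * #U / (8 * Δ) ≤ 2 * (t - 1) ∨ t < 3 := by
        by_cases h : t < 3
        · exact Or.inr h
        · left
          have : (3 : ℝ) ≤ t := by exact_mod_cast not_lt.1 h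
          linarith
      rcases h5 with h5 | h5
      · linarith
      · have h6 : (t : ℝ) = 2 := by
          have : t = 2 := by omega
          exact_mod_cast this
        rw [h6] at h1 htge
        have h7 : 1 ≤ #Z := by
          by_contra h8
          have h8 : #Z = 0 := by omega
          rw [h8] at h1
          norm_num at h1
        have h8 : (1 : ℝ) ≤ #Z := by exact_mod_cast h7
        have h9 : (1 : ℝ) ≤ (Δ : ℝ) ^ 3 := one_le_pow₀ hΔ0
        nlinarith
    have h3 : c * #U = δ * #U / (16 * Δ) / (64 * Δ ^ 3) := by
      rw [hc]; field_simp; norm_num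
    rw [h3, div_le_iff₀ (by positivity)]
    have h9 : (0 : ℝ) ≤ (Δ : ℝ) ^ 3 * #Z := by positivity
    nlinarith
  have hZB' : (#Z : ℝ) ≤ #B := by exact_mod_cast card_le_card hZB
  have hδN : 0 < δ * #U := by positivity
  obtain ⟨v, y, w, hA⟩ := hK₁ α β G U Z hG (by omega) hcZ (by linarith)
  rw [← hκ] at hA
  obtain ⟨φ₀, hφ₀, hφy, hswap⟩ :=
    exists_isTreeEmb_absorber hB hZ hchild hanc hG (by linarith) hA
  have hκZ : κ * c * #U ≤ κ * #Z := by
    rw [mul_assoc]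
    exact mul_le_mul_of_nonneg_left hcZ hκ0.le
  obtain ⟨J, hJZ, hJ⟩ := exists_subset_card_eq (s := Z) (n := ⌊κ * #Z / 2⌋₊) (by
    refine Nat.floor_le_of_le ?_
    have : κ * #Z ≤ 1 * #Z := mul_le_mul_of_nonneg_right hκ1 (by positivity)
    have : (0 : ℝ) ≤ #Z := by positivity
    linarith)
  have hJ1 : 2 * (#J : ℝ) ≤ κ * #Z := by
    have := Nat.floor_le (by positivity : 0 ≤ κ * #Z / 2)
    rw [hJ]; linarith
  have hJ2 : η * #U ≤ #J := by
    have := Nat.lt_floor_add_one (κ * #Z / 2)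
    rw [← hJ] at this
    have h3 : η * #U = κ * c * #U / 4 := by rw [hη]; ring
    linarith
  have hJB : J ⊆ B := hJZ.trans hZB
  have hinj : Set.InjOn φ₀ ↑(B \ J) := hφ₀.inj.mono (by exact_mod_cast sdiff_subset)
  set W := (B \ J).image φ₀ with hW
  have hWU : W ⊆ U := image_subset_iff.2 fun i hi => hφ₀.mem i (mem_sdiff.1 hi).1
  have hWc : #W + #J = #B := by
    rw [hW, card_image_of_injOn hinj, card_sdiff_add_card_eq_card hJB]
  have hU'c : #(U \ W) + #W = #U := card_sdiff_add_card_eq_card hWU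
  have hS'c : #(S \ B) + #B = #S := card_sdiff_add_card_eq_card hBS
  have hWB : (#W : ℝ) ≤ δ / 8 * #U := by
    refine le_trans ?_ hBN
    exact_mod_cast (by omega : #W ≤ #B)
  have hU'N : (#(U \ W) : ℝ) ≤ #U := by exact_mod_cast (by omega : #(U \ W) ≤ #U)
  have hdeg : ∀ a ∈ U, (1 / 2 + δ / 2) * (#(U \ W) : ℝ) ≤ #(nbrsIn G a (U \ W)) := by
    intro a ha
    have h1 := hG a ha
    have h2 : (#(nbrsIn G a U) : ℝ) ≤ #(nbrsIn G a (U \ W)) + #W := by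
      exact_mod_cast card_nbrsIn_le_sdiff G a U W
    have h3 : (1 / 2 + δ / 2) * (#(U \ W) : ℝ) ≤ (1 / 2 + δ / 2) * #U :=
      mul_le_mul_of_nonneg_left hU'N (by linarith)
    linarith
  obtain ⟨φ', hφ', hφr, hφq⟩ := hK₂ α β π d hΔ G (U \ W) (fun a ha => hdeg a (mem_sdiff.1 ha).1)
    (by
      have h1 : (2 : ℝ) * #W ≤ #U := by nlinarith
      have h2 : 2 * #W ≤ #U := by exact_mod_cast h1
      omega)
    (S \ B) r hS' (by
      have h1 : (#(S \ B) : ℝ) + #J = #(U \ W) := by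
        exact_mod_cast (by omega : #(S \ B) + #J = #(U \ W))
      have h2 : η * #(U \ W) ≤ η * #U := mul_le_mul_of_nonneg_left hU'N hη0.le
      linarith)
    (D \ W) (sdiff_subset_sdiff hDU le_rfl) (nbrsIn G (φ₀ x) (U \ W)) (nbrsIn_subset _ _ _) (by
      have h2 : (#D : ℝ) ≤ #(D \ W) + #W := by
        have := card_le_card_sdiff_add_card (s := D) (t := W)
        exact_mod_cast this
      have h3 : (1 / 2 + δ / 2) * (#(U \ W) : ℝ) ≤ (1 / 2 + δ / 2) * #U :=
        mul_le_mul_of_nonneg_left hU'N (by linarith)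
      linarith)
    (hdeg _ (hφ₀.mem x hB.root_mem)) (π x)
    (mem_sdiff.2 ⟨hS.parent_mem x hxS hxr, hπx⟩)
  set X := (U \ W) \ (S \ B).image φ' with hX
  have hXU' : X ⊆ U \ W := sdiff_subset
  have hXc : #X = #J := by
    have h1 : #X + #((S \ B).image φ') = #(U \ W) :=
      card_sdiff_add_card_eq_card (image_subset_iff.2 fun i hi => hφ'.mem i hi)
    rw [card_image_of_injOn hφ'.inj] at h1
    omega
  have hyW : (Z \ J).image y ⊆ W := by
    refine image_subset_iff.2 fun z hz => ?_
    obtain ⟨h1, h2⟩ := mem_sdiff.1 hz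
    rw [← hφy z h1]
    exact mem_image_of_mem _ (mem_sdiff.2 ⟨hZB h1, h2⟩)
  obtain ⟨Y, hYinj, hYmem, hYadj⟩ := hA.exists_absorb hJZ hJ1 (hXU'.trans sdiff_subset) hXc
    (Finset.disjoint_left.2 fun a ha ha' => (mem_sdiff.1 (hXU' ha)).2 (hyW ha'))
  have hg := hswap Y hYadj
  obtain ⟨g, hgdef⟩ : ∃ g, g = Z.piecewise Y φ₀ := ⟨_, rfl⟩
  rw [← hgdef] at hg
  have gZ : ∀ z ∈ Z, g z = Y z := fun z hz => by rw [hgdef, piecewise_eq_of_mem _ _ _ hz]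
  have gZ' : ∀ z, z ∉ Z → g z = φ₀ z := fun z hz => by
    rw [hgdef, piecewise_eq_of_notMem _ _ _ hz]
  have hWmem : ∀ i ∈ B, i ∉ Z → φ₀ i ∈ W := fun i hi hiZ =>
    mem_image_of_mem _ (mem_sdiff.2 ⟨hi, fun h => hiZ (hJZ h)⟩)
  have gmem : ∀ i ∈ B, g i ∈ X ∪ W := by
    intro i hi
    by_cases hiZ : i ∈ Z
    · rw [gZ i hiZ]
      exact union_subset_union_right hyW (hYmem i hiZ)
    · rw [gZ' i hiZ]
      exact mem_union_right _ (hWmem i hi hiZ)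
  have hmix : ∀ z ∈ Z, ∀ i ∈ B, i ∉ Z → Y z ≠ φ₀ i := by
    intro z hz i hi hiZ h
    rcases mem_union.1 (hYmem z hz) with h1 | h1
    · rw [h] at h1
      exact (mem_sdiff.1 (hXU' h1)).2 (hWmem i hi hiZ)
    · obtain ⟨z', hz', h2⟩ := mem_image.1 h1
      have h3 := (mem_sdiff.1 hz').1
      rw [← hφy z' h3, h] at h2
      exact hiZ (hφ₀.inj (hZB h3) hi h2 ▸ h3)
  have ginj : Set.InjOn g B := by
    intro i hi j hj hij
    by_cases hiZ : i ∈ Z <;> by_cases hjZ : j ∈ Z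
    · rw [gZ i hiZ, gZ j hjZ] at hij
      exact hYinj hiZ hjZ hij
    · rw [gZ i hiZ, gZ' j hjZ] at hij
      exact absurd hij (hmix i hiZ j hj hjZ)
    · rw [gZ' i hiZ, gZ j hjZ] at hij
      exact absurd hij.symm (hmix j hjZ i hi hiZ)
    · rw [gZ' i hiZ, gZ' j hjZ] at hij
      exact hφ₀.inj hi hj hij
  have hcross : ∀ i ∈ B, ∀ j ∈ S \ B, g i ≠ φ' j := by
    intro i hi j hj h
    rcases mem_union.1 (gmem i hi) with h1 | h1
    · exact (mem_sdiff.1 h1).2 (h ▸ mem_image_of_mem _ hj)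
    · exact (mem_sdiff.1 (hφ'.mem j hj)).2 (h ▸ h1)
  have hrB : r ∉ B := (mem_sdiff.1 hS'.root_mem).2
  refine ⟨B.piecewise g φ', ⟨fun i hi => ?_, fun i hi j hj hij => ?_, fun i hi hir => ?_⟩, ?_⟩
  · by_cases hiB : i ∈ B
    · rw [piecewise_eq_of_mem _ _ _ hiB]
      exact union_subset (hXU'.trans sdiff_subset) hWU (gmem i hiB)
    · rw [piecewise_eq_of_notMem _ _ _ hiB]
      exact (mem_sdiff.1 (hφ'.mem i (mem_sdiff.2 ⟨hi, hiB⟩))).1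
  · by_cases hiB : i ∈ B <;> by_cases hjB : j ∈ B
    · rw [piecewise_eq_of_mem _ _ _ hiB, piecewise_eq_of_mem _ _ _ hjB] at hij
      exact ginj hiB hjB hij
    · rw [piecewise_eq_of_mem _ _ _ hiB, piecewise_eq_of_notMem _ _ _ hjB] at hij
      exact absurd hij (hcross i hiB j (mem_sdiff.2 ⟨hj, hjB⟩))
    · rw [piecewise_eq_of_notMem _ _ _ hiB, piecewise_eq_of_mem _ _ _ hjB] at hij
      exact absurd hij.symm (hcross j hjB i (mem_sdiff.2 ⟨hi, hiB⟩))
    · rw [piecewise_eq_of_notMem _ _ _ hiB, piecewise_eq_of_notMem _ _ _ hjB] at hij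
      exact hφ'.inj (mem_sdiff.2 ⟨hi, hiB⟩) (mem_sdiff.2 ⟨hj, hjB⟩) hij
  · by_cases hiB : i ∈ B
    · rw [piecewise_eq_of_mem _ _ _ hiB]
      by_cases hix : i = x
      · subst hix
        rw [piecewise_eq_of_notMem _ _ _ hπx, gZ' _ hxZ]
        exact (mem_nbrsIn.1 hφq).2.symm
      · rw [piecewise_eq_of_mem _ _ _ (hB.parent_mem i hiB hix)]
        exact hg i hiB hix
    · have hiS := mem_sdiff.2 ⟨hi, hiB⟩
      rw [piecewise_eq_of_notMem _ _ _ hiB,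
        piecewise_eq_of_notMem _ _ _ (mem_sdiff.1 (hS'.parent_mem i hiS hir)).2]
      exact hφ'.adj i hiS hir
  · rw [piecewise_eq_of_notMem _ _ _ hrB]
    exact (mem_sdiff.1 hφr).1

end SpanningEmbedding

section VertexSpread

variable {α β : Type} {G : SimpleGraph β} {π : α → α}

theorem descFactorial_add_mul_choose (a b s t : ℕ) :
    (a + s + (b + t)).descFactorial (s + t) * (a + b).choose a =
      (a + s + (b + t)).choose (a + s) * ((a + s).descFactorial s * (b + t).descFactorial t) := by
  have h1 := Nat.factorial_mul_descFactorial (n := a + s) (k := s) (by omega)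
  have h2 := Nat.factorial_mul_descFactorial (n := b + t) (k := t) (by omega)
  have h3 := Nat.factorial_mul_descFactorial (n := a + s + (b + t)) (k := s + t) (by omega)
  have h4 := Nat.add_choose_mul_factorial_mul_factorial a b
  have h5 := Nat.add_choose_mul_factorial_mul_factorial (a + s) (b + t)
  rw [← Nat.choose_symm_add] at h4 h5
  rw [Nat.add_sub_cancel] at h1 h2
  rw [show a + s + (b + t) - (s + t) = a + b by omega] at h3
  refine Nat.eq_of_mul_eq_mul_left (Nat.mul_pos a.factorial_pos b.factorial_pos) ?_
  calc _ = (a + b).choose a * a.factorial * b.factorial *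
        (a + s + (b + t)).descFactorial (s + t) := by ring
    _ = (a + s + (b + t)).choose (a + s) * (a + s).factorial * (b + t).factorial := by
        rw [h4, h3, h5]
    _ = _ := by rw [← h1, ← h2]; ring

theorem card_filter_subset_disjoint_le {U P Q : Finset β} (hP : P ⊆ U) (hQ : Q ⊆ U)
    (hPQ : Disjoint P Q) (k : ℕ) :
    #{W ∈ powersetCard k U | P ⊆ W ∧ Disjoint Q W} ≤ (#U - (#P + #Q)).choose (k - #P) := by
  have h : #(U \ (P ∪ Q)) = #U - (#P + #Q) := by
    rw [card_sdiff_of_subset (union_subset hP hQ), card_union_of_disjoint hPQ]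
  rw [← h, ← card_powersetCard]
  refine card_le_card_of_injOn (fun W => W \ P) (fun W hW => ?_) fun W hW W' hW' hWW => ?_
  · obtain ⟨h1, h2, h3⟩ := mem_filter.1 hW
    obtain ⟨h4, h5⟩ := mem_powersetCard.1 h1
    refine mem_powersetCard.2 ⟨fun a ha => ?_, by rw [card_sdiff_of_subset h2, h5]⟩
    obtain ⟨h6, h7⟩ := mem_sdiff.1 ha
    refine mem_sdiff.2 ⟨h4 h6, fun h8 => (mem_union.1 h8).elim h7 fun h9 => ?_⟩
    exact Finset.disjoint_left.1 h3 h9 h6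
  · have h1 := (mem_filter.1 hW).2.1
    have h2 := (mem_filter.1 hW').2.1
    rw [← sdiff_union_of_subset h1, ← sdiff_union_of_subset h2]
    exact congrArg (· ∪ P) hWW

/-- Embeddings of a branch and of the rest of the tree fit together. -/
theorem IsTreeEmb.piecewise {d : α → ℕ} {S : Finset α} {r x : α} {U W : Finset β} {φ ψ : α → β}
    (hS : IsSubtree π d S r) (hx : x ∈ S) (hxr : x ≠ r) (hW : W ⊆ U)
    (hφ : IsTreeEmb G π (S \ branch π d S x) r (U \ W) φ)
    (hψ : IsTreeEmb G π (branch π d S x) x W ψ) (hadj : G.Adj (φ (π x)) (ψ x)) :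
    IsTreeEmb G π S r U ((branch π d S x).piecewise ψ φ) := by
  have hB := hS.branch hx
  have hS' := hS.sdiff_branch hx hxr
  have hπx := hS.parent_notMem_branch hx hxr
  set B := branch π d S x
  have hcross : ∀ i ∈ B, ∀ j ∈ S \ B, ψ i ≠ φ j := fun i hi j hj h =>
    (mem_sdiff.1 (hφ.mem j hj)).2 (h ▸ hψ.mem i hi)
  refine ⟨fun i hi => ?_, fun i hi j hj hij => ?_, fun i hi hir => ?_⟩
  · by_cases hiB : i ∈ B
    · rw [piecewise_eq_of_mem _ _ _ hiB]
      exact hW (hψ.mem i hiB)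
    · rw [piecewise_eq_of_notMem _ _ _ hiB]
      exact (mem_sdiff.1 (hφ.mem i (mem_sdiff.2 ⟨hi, hiB⟩))).1
  · by_cases hiB : i ∈ B <;> by_cases hjB : j ∈ B
    · rw [piecewise_eq_of_mem _ _ _ hiB, piecewise_eq_of_mem _ _ _ hjB] at hij
      exact hψ.inj hiB hjB hij
    · rw [piecewise_eq_of_mem _ _ _ hiB, piecewise_eq_of_notMem _ _ _ hjB] at hij
      exact absurd hij (hcross i hiB j (mem_sdiff.2 ⟨hj, hjB⟩))
    · rw [piecewise_eq_of_notMem _ _ _ hiB, piecewise_eq_of_mem _ _ _ hjB] at hij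
      exact absurd hij.symm (hcross j hjB i (mem_sdiff.2 ⟨hi, hiB⟩))
    · rw [piecewise_eq_of_notMem _ _ _ hiB, piecewise_eq_of_notMem _ _ _ hjB] at hij
      exact hφ.inj (mem_sdiff.2 ⟨hi, hiB⟩) (mem_sdiff.2 ⟨hj, hjB⟩) hij
  · by_cases hiB : i ∈ B
    · rw [piecewise_eq_of_mem _ _ _ hiB]
      by_cases hix : i = x
      · subst hix
        rwa [piecewise_eq_of_notMem _ _ _ hπx]
      · rw [piecewise_eq_of_mem _ _ _ (hB.parent_mem i hiB hix)]
        exact hψ.adj i hiB hix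
    · have hiS := mem_sdiff.2 ⟨hi, hiB⟩
      rw [piecewise_eq_of_notMem _ _ _ hiB,
        piecewise_eq_of_notMem _ _ _ (mem_sdiff.1 (hS'.parent_mem i hiS hir)).2]
      exact hφ.adj i hiS hir

variable [Fintype α] [Fintype β]

/-- `μ` is a probability distribution on the embeddings of the subtree `S` into `U` with the root
in `D`, under which prescribing the images of `k` vertices has probability at most
`A ^ k / (#U).descFactorial k`. -/
structure IsSpreadEmb (G : SimpleGraph β) (π : α → α) (S : Finset α) (r : α) (U D : Finset β)
    (A : ℝ) (μ : (α → β) → ℝ) : Prop where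
  nonneg : ∀ φ, 0 ≤ μ φ
  sum_eq_one : ∑ φ, μ φ = 1
  emb : ∀ φ, 0 < μ φ → IsTreeEmb G π S r U φ ∧ φ r ∈ D
  spread : ∀ X ⊆ S, ∀ y : α → β,
    (#U).descFactorial #X * ∑ φ with ∀ i ∈ X, φ i = y i, μ φ ≤ A ^ #X

theorem IsSpreadEmb.mono {S : Finset α} {r : α} {U D : Finset β} {A B : ℝ} {μ : (α → β) → ℝ}
    (h : IsSpreadEmb G π S r U D A μ) (hA : 0 ≤ A) (hAB : A ≤ B) :
    IsSpreadEmb G π S r U D B μ :=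
  ⟨h.nonneg, h.sum_eq_one, h.emb, fun X hX y => (h.spread X hX y).trans (by gcongr)⟩

/-- The point mass at an embedding is spread, trivially. -/
theorem IsTreeEmb.exists_isSpreadEmb {S : Finset α} {r : α} {U D : Finset β} {φ : α → β}
    (h : IsTreeEmb G π S r U φ) (hr : φ r ∈ D) {A : ℝ} (hA : #U ≤ A) :
    ∃ μ, IsSpreadEmb G π S r U D A μ := by
  refine ⟨fun ψ => if ψ = φ then 1 else 0, fun ψ => by positivity, by simp, fun ψ hψ => ?_,
    fun X hX y => ?_⟩
  · by_cases hψφ : ψ = φ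
    · exact hψφ ▸ ⟨h, hr⟩
    · simp [hψφ] at hψ
  · have h1 : ∑ ψ with ∀ i ∈ X, ψ i = y i, (if ψ = φ then (1 : ℝ) else 0) ≤ 1 := by
      calc _ ≤ ∑ ψ, (if ψ = φ then (1 : ℝ) else 0) :=
            sum_le_sum_of_subset_of_nonneg (filter_subset _ _) fun _ _ _ => by positivity
        _ = 1 := by simp
    have h2 : ((#U).descFactorial #X : ℝ) ≤ (#U : ℝ) ^ #X := by
      exact_mod_cast Nat.descFactorial_le_pow _ _
    calc _ ≤ ((#U).descFactorial #X : ℝ) * 1 := by gcongr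
      _ ≤ (#U : ℝ) ^ #X := by rwa [mul_one]
      _ ≤ A ^ #X := by gcongr

set_option maxHeartbeats 1000000 in
/-- Spread distributions on embeddings of a branch and of the rest of the tree into random
complementary sets combine to a spread distribution. -/
theorem exists_isSpreadEmb_glue {d : α → ℕ} {S : Finset α} {r x : α} {U D : Finset β}
    (hS : IsSubtree π d S r) (hx : x ∈ S) (hxr : x ≠ r) (hSU : #S = #U) {A A' θ : ℝ}
    (hθ0 : 0 ≤ θ) (hθ : θ < 1) (hA' : 0 ≤ A') (hAA : A' ≤ (1 - θ) * A)
    (𝒲 : Finset (Finset β)) (h𝒲 : 𝒲 ⊆ powersetCard #(branch π d S x) U)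
    (hcard : (1 - θ) * (#U).choose #(branch π d S x) ≤ #𝒲)
    (h₁ : ∀ W ∈ 𝒲, ∃ μ, IsSpreadEmb G π (S \ branch π d S x) r (U \ W) (D \ W) A' μ)
    (h₂ : ∀ W ∈ 𝒲, ∀ a ∈ U, ∃ μ, IsSpreadEmb G π (branch π d S x) x W (nbrsIn G a W) A' μ) :
    ∃ μ, IsSpreadEmb G π S r U D A μ := by
  have hBS : branch π d S x ⊆ S := branch_subset x
  have hπB := hS.parent_notMem_branch hx hxr
  have hπS := hS.parent_mem x hx hxr
  have hrB := (mem_sdiff.1 (hS.sdiff_branch hx hxr).root_mem).2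
  have hmerge := fun W φ ψ (hW : W ⊆ U) => IsTreeEmb.piecewise (G := G) (U := U) (W := W) (φ := φ)
    (ψ := ψ) hS hx hxr hW
  generalize branch π d S x = B at h𝒲 hcard h₁ h₂ hBS hπB hmerge hrB
  choose! μ₁ h₁ using h₁
  choose! μ₂ h₂ using h₂
  have hBU : #B ≤ #U := hSU ▸ card_le_card hBS
  have hch : (0 : ℝ) < (#U).choose #B := by exact_mod_cast Nat.choose_pos hBU
  have h𝒲0 : (0 : ℝ) < #𝒲 := by
    refine lt_of_lt_of_le ?_ hcard
    exact mul_pos (by linarith) hch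
  have hWU : ∀ W ∈ 𝒲, W ⊆ U ∧ #W = #B := fun W hW => mem_powersetCard.1 (h𝒲 hW)
  have hA : 0 ≤ A := by
    by_contra h
    nlinarith
  obtain ⟨ν, hν⟩ : ∃ ν : Finset β × (α → β) × (α → β) → ℝ, ∀ ω, ν ω =
      if ω.1 ∈ 𝒲 then (#𝒲 : ℝ)⁻¹ * (μ₁ ω.1 ω.2.1 * μ₂ ω.1 (ω.2.1 (π x)) ω.2.2) else 0 :=
    ⟨_, fun _ => rfl⟩
  obtain ⟨f, hf⟩ : ∃ f : Finset β × (α → β) × (α → β) → α → β, ∀ ω, f ω =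
      B.piecewise ω.2.2 ω.2.1 := ⟨_, fun _ => rfl⟩
  have hrange : ∀ W ∈ 𝒲, ∀ φ, 0 < μ₁ W φ → φ (π x) ∈ U := fun W hW φ h =>
    (mem_sdiff.1 (((h₁ W hW).emb φ h).1.mem _ (mem_sdiff.2 ⟨hπS, hπB⟩))).1
  have hν0 : ∀ ω, 0 ≤ ν ω := by
    rintro ⟨W, φ, ψ⟩
    rw [hν]
    split_ifs with hW
    · refine mul_nonneg (by positivity) ?_
      rcases ((h₁ W hW).nonneg φ).eq_or_lt with h | h
      · simp [← h]
      · exact mul_nonneg h.le ((h₂ W hW _ (hrange W hW φ h)).nonneg ψ)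
    · exact le_rfl
  have hνpos : ∀ W φ ψ, ν (W, φ, ψ) ≠ 0 → W ∈ 𝒲 ∧
      (IsTreeEmb G π (S \ B) r (U \ W) φ ∧ φ r ∈ D \ W) ∧
      (IsTreeEmb G π B x W ψ ∧ ψ x ∈ nbrsIn G (φ (π x)) W) := by
    intro W φ ψ h
    rw [hν] at h
    by_cases hW : W ∈ 𝒲
    · rw [if_pos hW] at h
      have h3 := right_ne_zero_of_mul h
      have h4 : 0 < μ₁ W φ := ((h₁ W hW).nonneg φ).lt_of_ne' (left_ne_zero_of_mul h3)
      have h5 := h₂ W hW _ (hrange W hW φ h4)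
      exact ⟨hW, (h₁ W hW).emb φ h4,
        h5.emb ψ ((h5.nonneg ψ).lt_of_ne' (right_ne_zero_of_mul h3))⟩
    · rw [if_neg hW] at h
      exact absurd rfl h
  have hfemb : ∀ ω, ν ω ≠ 0 → IsTreeEmb G π S r U (f ω) ∧ f ω r ∈ D := by
    rintro ⟨W, φ, ψ⟩ h
    obtain ⟨hW, ⟨h3, h4⟩, h5, h6⟩ := hνpos W φ ψ h
    rw [hf]
    refine ⟨hmerge W φ ψ (hWU W hW).1 h3 h5 (mem_nbrsIn.1 h6).2, ?_⟩
    rw [piecewise_eq_of_notMem _ _ _ hrB]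
    exact (mem_sdiff.1 h4).1
  have hsum : ∀ P : (α → β) → Prop, ∑ φ with P φ, ∑ ω with f ω = φ, ν ω =
      ∑ W ∈ 𝒲, (#𝒲 : ℝ)⁻¹ * ∑ φ, μ₁ W φ * ∑ ψ, if P (f (W, φ, ψ))
        then μ₂ W (φ (π x)) ψ else 0 := by
    intro P
    calc _ = ∑ ω with P (f ω), ν ω := by
          rw [← sum_fiberwise_of_maps_to (s := {ω | P (f ω)}) (t := {φ | P φ}) (g := f)
            (fun ω hω => by simpa using hω)]
          refine sum_congr rfl fun φ hφ => ?_
          rw [filter_filter]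
          refine sum_congr (filter_congr fun ω _ => ?_) fun _ _ => rfl
          exact ⟨fun h => ⟨h ▸ (mem_filter.1 hφ).2, h⟩, fun h => h.2⟩
      _ = ∑ W, if W ∈ 𝒲 then (#𝒲 : ℝ)⁻¹ * ∑ φ, μ₁ W φ * ∑ ψ, if P (f (W, φ, ψ))
          then μ₂ W (φ (π x)) ψ else 0 else 0 := by
          rw [sum_filter, Fintype.sum_prod_type]
          refine sum_congr rfl fun W _ => ?_
          rw [Fintype.sum_prod_type]
          split_ifs with hW
          · rw [mul_sum]
            refine sum_congr rfl fun φ _ => ?_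
            rw [mul_sum, mul_sum]
            refine sum_congr rfl fun ψ _ => ?_
            rw [hν, if_pos hW]
            split_ifs <;> simp
          · exact sum_eq_zero fun φ _ => sum_eq_zero fun ψ _ => by rw [hν, if_neg hW, ite_self]
      _ = _ := by rw [sum_ite_mem, univ_inter]
  have hsupp : ∀ φ, 0 < ∑ ω with f ω = φ, ν ω → IsTreeEmb G π S r U φ ∧ φ r ∈ D := by
    intro φ h
    obtain ⟨ω, hω, h3⟩ := exists_ne_zero_of_sum_ne_zero h.ne'
    rw [← (mem_filter.1 hω).2]
    exact hfemb ω h3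
  have hμ0 : ∀ φ, 0 ≤ ∑ ω with f ω = φ, ν ω := fun φ => sum_nonneg fun ω _ => hν0 ω
  have hone : ∑ φ, ∑ ω with f ω = φ, ν ω = 1 := by
    have := hsum fun _ => True
    simp only [filter_true, if_true] at this
    rw [this]
    have h3 : ∀ W ∈ 𝒲, ∑ φ, μ₁ W φ * ∑ ψ, μ₂ W (φ (π x)) ψ = 1 := by
      intro W hW
      rw [← (h₁ W hW).sum_eq_one]
      refine sum_congr rfl fun φ _ => ?_
      rcases ((h₁ W hW).nonneg φ).eq_or_lt with h | h
      · simp [← h]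
      · rw [(h₂ W hW _ (hrange W hW φ h)).sum_eq_one, mul_one]
    rw [sum_congr rfl fun W hW => by rw [h3 W hW], sum_const, nsmul_eq_mul, mul_one]
    exact mul_inv_cancel₀ h𝒲0.ne'
  refine ⟨fun φ => ∑ ω with f ω = φ, ν ω, hμ0, hone, hsupp, fun X hX y => ?_⟩
  rcases X.eq_empty_or_nonempty with rfl | hXne
  · simp [hone]
  by_cases hy : Set.InjOn y X ∧ ∀ i ∈ X, y i ∈ U
  swap
  · have h0 : ∑ φ with ∀ i ∈ X, φ i = y i, ∑ ω with f ω = φ, ν ω = 0 := by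
      refine sum_eq_zero fun φ hφ => ?_
      by_contra h
      have h3 := (hsupp φ ((hμ0 φ).lt_of_ne' h)).1
      have h4 := (mem_filter.1 hφ).2
      exact hy ⟨fun i hi j hj hij => h3.inj (hX hi) (hX hj) (by rwa [h4 i hi, h4 j hj]),
        fun i hi => h4 i hi ▸ h3.mem i (hX hi)⟩
    rw [h0, mul_zero]
    positivity
  obtain ⟨hyinj, hyU⟩ := hy
  have hX₁ : X \ B ⊆ S \ B := sdiff_subset_sdiff hX le_rfl
  have hX₂ : X ∩ B ⊆ B := inter_subset_right
  obtain ⟨P, hP⟩ : ∃ P, P = (X ∩ B).image y := ⟨_, rfl⟩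
  obtain ⟨Q, hQ⟩ : ∃ Q, Q = (X \ B).image y := ⟨_, rfl⟩
  have hPU : P ⊆ U := by
    rw [hP, image_subset_iff]
    exact fun i hi => hyU i (mem_inter.1 hi).1
  have hQU : Q ⊆ U := by
    rw [hQ, image_subset_iff]
    exact fun i hi => hyU i (mem_sdiff.1 hi).1
  have hPQ : Disjoint P Q := by
    rw [hP, hQ, Finset.disjoint_left]
    intro a ha ha'
    obtain ⟨i, hi, rfl⟩ := mem_image.1 ha
    obtain ⟨j, hj, hij⟩ := mem_image.1 ha'
    obtain ⟨hi, hi'⟩ := mem_inter.1 hi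
    obtain ⟨hj, hj'⟩ := mem_sdiff.1 hj
    exact hj' (hyinj hi hj hij.symm ▸ hi')
  have hPc : #P = #(X ∩ B) := by
    rw [hP, card_image_of_injOn (hyinj.mono (by exact_mod_cast inter_subset_left))]
  have hQc : #Q = #(X \ B) := by
    rw [hQ, card_image_of_injOn (hyinj.mono (by exact_mod_cast sdiff_subset))]
  have hXc : #(X ∩ B) + #(X \ B) = #X := card_inter_add_card_sdiff X B
  obtain ⟨a, ha⟩ := Nat.exists_eq_add_of_le' (card_le_card hX₂)
  have hSB : #(S \ B) + #B = #U := hSU ▸ card_sdiff_add_card_eq_card hBS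
  obtain ⟨b, hb⟩ := Nat.exists_eq_add_of_le' (card_le_card hX₁)
  obtain ⟨s, hs⟩ : ∃ s, s = #(X ∩ B) := ⟨_, rfl⟩
  obtain ⟨t, ht⟩ : ∃ t, t = #(X \ B) := ⟨_, rfl⟩
  rw [← hs] at ha hPc hXc
  rw [← ht] at hb hQc hXc
  have hUc : #U = a + s + (b + t) := by omega
  have hd1 : (0 : ℝ) < (b + t).descFactorial t := by
    exact_mod_cast Nat.descFactorial_pos.2 (Nat.le_add_left _ _)
  have hd2 : (0 : ℝ) < (a + s).descFactorial s := by
    exact_mod_cast Nat.descFactorial_pos.2 (Nat.le_add_left _ _)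
  have hinner : ∀ W ∈ 𝒲, (∑ φ, μ₁ W φ * ∑ ψ, if ∀ i ∈ X, f (W, φ, ψ) i = y i
      then μ₂ W (φ (π x)) ψ else 0) ≤ if P ⊆ W ∧ Disjoint Q W then
        A' ^ t / (b + t).descFactorial t * (A' ^ s / (a + s).descFactorial s) else 0 := by
    intro W hW
    have hcases : ∀ φ ψ, (∀ i ∈ X, f (W, φ, ψ) i = y i) →
        (∀ i ∈ X \ B, φ i = y i) ∧ ∀ i ∈ X ∩ B, ψ i = y i := by
      intro φ ψ h
      refine ⟨fun i hi => ?_, fun i hi => ?_⟩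
      · have := h i (mem_sdiff.1 hi).1
        rwa [hf, piecewise_eq_of_notMem _ _ _ (mem_sdiff.1 hi).2] at this
      · have := h i (mem_inter.1 hi).1
        rwa [hf, piecewise_eq_of_mem _ _ _ (mem_inter.1 hi).2] at this
    have h1 := h₁ W hW
    split_ifs with hPQW
    · have hb1 : ∑ φ with ∀ i ∈ X \ B, φ i = y i, μ₁ W φ ≤ A' ^ t / (b + t).descFactorial t := by
        rw [le_div_iff₀' hd1, ← hb, ht]
        have := h1.spread _ hX₁ y
        rwa [card_sdiff_of_subset (hWU W hW).1, (hWU W hW).2, ← hSB, Nat.add_sub_cancel] at this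
      have hb2 : ∀ φ, 0 < μ₁ W φ → ∑ ψ with ∀ i ∈ X ∩ B, ψ i = y i, μ₂ W (φ (π x)) ψ ≤
          A' ^ s / (a + s).descFactorial s := by
        intro φ hφ
        rw [le_div_iff₀' hd2, ← ha, hs]
        have := (h₂ W hW _ (hrange W hW φ hφ)).spread _ hX₂ y
        rwa [(hWU W hW).2] at this
      calc _ ≤ ∑ φ with ∀ i ∈ X \ B, φ i = y i, μ₁ W φ * (A' ^ s / (a + s).descFactorial s) := by
            rw [sum_filter]
            refine sum_le_sum fun φ _ => ?_
            rcases (h1.nonneg φ).eq_or_lt with h | h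
            · simp [← h]
            · have h2 := h₂ W hW _ (hrange W hW φ h)
              split_ifs with h3
              · refine mul_le_mul_of_nonneg_left (le_trans ?_ (hb2 φ h)) h.le
                rw [sum_filter]
                refine sum_le_sum fun ψ _ => ?_
                split_ifs with h4 h5
                · exact le_rfl
                · exact absurd (hcases φ ψ h4).2 h5
                · exact h2.nonneg ψ
                · exact le_rfl
              · rw [sum_eq_zero, mul_zero]
                exact fun ψ _ => if_neg fun h4 => h3 (hcases φ ψ h4).1
        _ ≤ _ := by
            rw [← sum_mul]
            exact mul_le_mul_of_nonneg_right hb1 (by positivity)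
    · refine (sum_eq_zero fun φ _ => ?_).le
      rcases (h1.nonneg φ).eq_or_lt with h | h
      · rw [← h, zero_mul]
      · rw [sum_eq_zero, mul_zero]
        intro ψ _
        by_cases h4 : ∀ i ∈ X, f (W, φ, ψ) i = y i
        · rw [if_pos h4]
          by_contra h5
          have h6 := h₂ W hW _ (hrange W hW φ h)
          have h7 := (h6.emb ψ ((h6.nonneg ψ).lt_of_ne' h5)).1
          have h8 := (h1.emb φ h).1
          obtain ⟨h9, h10⟩ := hcases φ ψ h4
          refine hPQW ⟨?_, ?_⟩
          · rw [hP, image_subset_iff]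
            exact fun i hi => h10 i hi ▸ h7.mem i (hX₂ hi)
          · rw [hQ, Finset.disjoint_left]
            intro c hc
            obtain ⟨i, hi, rfl⟩ := mem_image.1 hc
            exact h9 i hi ▸ (mem_sdiff.1 (h8.mem i (hX₁ hi))).2
        · exact if_neg h4
  have hcount : (#{W ∈ 𝒲 | P ⊆ W ∧ Disjoint Q W} : ℝ) ≤ (a + b).choose a := by
    have h3 := (card_le_card (filter_subset_filter _ h𝒲)).trans
      (card_filter_subset_disjoint_le hPU hQU hPQ #B)
    rw [hPc, hQc, ha, hUc, show a + s + (b + t) - (s + t) = a + b by omega,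
      Nat.add_sub_cancel] at h3
    exact_mod_cast h3
  have hprob : ∑ φ with ∀ i ∈ X, φ i = y i, ∑ ω with f ω = φ, ν ω ≤
      (#𝒲 : ℝ)⁻¹ * ((a + b).choose a * (A' ^ t / (b + t).descFactorial t *
        (A' ^ s / (a + s).descFactorial s))) := by
    have h0 := hsum fun φ => ∀ i ∈ X, φ i = y i
    rw [← mul_sum] at h0
    have h3 : ∑ W ∈ 𝒲, (if P ⊆ W ∧ Disjoint Q W then
        A' ^ t / (b + t).descFactorial t * (A' ^ s / (a + s).descFactorial s) else 0) ≤
        (a + b).choose a * (A' ^ t / (b + t).descFactorial t *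
          (A' ^ s / (a + s).descFactorial s)) := by
      rw [← sum_filter, sum_const, nsmul_eq_mul]
      exact mul_le_mul_of_nonneg_right hcount (by positivity)
    calc _ = _ := by convert h0
      _ ≤ _ := mul_le_mul_of_nonneg_left (le_trans (by convert sum_le_sum hinner) h3)
        (by positivity)
  have hid : ((a + s + (b + t)).descFactorial (s + t) : ℝ) * (a + b).choose a =
      (#U).choose #B * ((a + s).descFactorial s * (b + t).descFactorial t) := by
    rw [hUc, ha]
    exact_mod_cast descFactorial_add_mul_choose a b s t
  have hθ1 : 0 < 1 - θ := by linarith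
  have hX1 : 1 ≤ #X := card_pos.2 hXne
  calc ((#U).descFactorial #X : ℝ) * _ ≤ (#U).descFactorial #X * _ :=
        mul_le_mul_of_nonneg_left hprob (by positivity)
    _ = ((a + s + (b + t)).descFactorial (s + t) * (a + b).choose a : ℝ) * (#𝒲 : ℝ)⁻¹ *
        (A' ^ t / (b + t).descFactorial t * (A' ^ s / (a + s).descFactorial s)) := by
        rw [hUc, ← hXc]; ring
    _ = (#U).choose #B * (#𝒲 : ℝ)⁻¹ * A' ^ #X := by
        rw [hid, ← hXc, pow_add]
        field_simp
    _ ≤ (1 - θ)⁻¹ * A' ^ #X := by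
        refine mul_le_mul_of_nonneg_right ?_ (by positivity)
        rw [← div_eq_mul_inv, div_le_iff₀ h𝒲0, inv_mul_eq_div, le_div_iff₀' hθ1]
        exact hcard
    _ ≤ (1 - θ)⁻¹ * ((1 - θ) ^ #X * A ^ #X) := by
        rw [← mul_pow]
        gcongr
    _ ≤ (1 - θ)⁻¹ * ((1 - θ) ^ 1 * A ^ #X) := by
        gcongr (1 - θ)⁻¹ * (?_ * A ^ #X)
        exact pow_le_pow_of_le_one hθ1.le (by linarith) hX1
    _ = A ^ #X := by
        rw [pow_one]
        field_simp

end VertexSpread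

section VertexSpreadInduction

/-- A deviation `g`, negligible in total when summed along a sequence decreasing geometrically,
but large enough to make the failure probability in a random splitting negligible. -/
theorem exists_sampling_rate (c δ : ℝ) (hc : 0 < c) (hc1 : c ≤ 1) (hδ : 0 < δ) :
    ∃ (g h : ℕ → ℝ) (K : ℕ), (∀ m, K ≤ m → 0 < g m ∧ g m ≤ 1 ∧ 0 ≤ h m ∧ h m ≤ δ ∧
      (2 * (m : ℝ) + 1) * (m + 1) * Real.exp (-(g m ^ 2 * (c * m) / 2)) ≤ g m / 2) ∧
      ∀ m k : ℕ, 1 ≤ k → (k : ℝ) ≤ (1 - c) * m → h m + g m ≤ h k := by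
  obtain ⟨x, hx⟩ : ∃ x : ℕ → ℝ, ∀ m, x m = √√(m : ℝ) := ⟨_, fun _ => rfl⟩
  have hx4 : ∀ m, x m ^ 4 = m := fun m => by
    rw [hx, show 4 = 2 * 2 from rfl, pow_mul, Real.sq_sqrt (by positivity),
      Real.sq_sqrt (by positivity)]
  have hxpos : ∀ m : ℕ, 1 ≤ m → 1 ≤ x m := fun m hm => by
    rw [hx, Real.one_le_sqrt, Real.one_le_sqrt]
    exact_mod_cast hm
  have htend : Filter.Tendsto x Filter.atTop Filter.atTop := by
    have : x = Real.sqrt ∘ Real.sqrt ∘ fun m : ℕ => (m : ℝ) := funext hx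
    rw [this]
    exact Real.tendsto_sqrt_atTop.comp (Real.tendsto_sqrt_atTop.comp tendsto_natCast_atTop_atTop)
  have h1 : Filter.Tendsto (fun y : ℝ => 12 * (y ^ 9 * Real.exp (-(c / 2 * y)))) Filter.atTop
      (nhds 0) := by
    have h2 := (Real.tendsto_pow_mul_exp_neg_atTop_nhds_zero 9).comp
      (Filter.tendsto_id.const_mul_atTop (show 0 < c / 2 by positivity))
    have h3 := h2.const_mul (12 * ((c / 2) ^ 9)⁻¹)
    rw [mul_zero] at h3
    refine h3.congr fun y => ?_
    simp only [Function.comp_apply, mul_pow, id]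
    field_simp
  obtain ⟨K₁, hK₁⟩ := Filter.eventually_atTop.1
    ((h1.comp htend).eventually (gt_mem_nhds one_pos))
  obtain ⟨K₂, hK₂⟩ := Filter.eventually_atTop.1 (htend.eventually_ge_atTop (4 / c / δ))
  refine ⟨fun m => (x m)⁻¹, fun m => 4 / c * (x m)⁻¹, K₁ + K₂ + 1, fun m hm => ?_,
    fun m k hk hkm => ?_⟩ <;> beta_reduce
  · have hx1 := hxpos m (by omega)
    have hx0 : 0 < x m := by linarith
    have h2 := hK₂ m (by omega)
    have h3 := hK₁ m (by omega)
    simp only [Function.comp_apply] at h3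
    refine ⟨by positivity, inv_le_one_of_one_le₀ hx1, by positivity, ?_, ?_⟩
    · rw [← div_eq_mul_inv, div_le_iff₀ hx0]
      rwa [div_le_iff₀ hδ, mul_comm] at h2
    · rw [← hx4 m]
      have h4 : (x m)⁻¹ ^ 2 * (c * x m ^ 4) / 2 = c / 2 * x m ^ 2 := by field_simp
      rw [h4, div_eq_mul_inv (x m)⁻¹, ← mul_inv, ← one_div, le_div_iff₀ (by positivity)]
      have h5 : Real.exp (-(c / 2 * x m ^ 2)) ≤ Real.exp (-(c / 2 * x m)) := by
        refine Real.exp_le_exp.2 ?_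
        have : x m ≤ x m ^ 2 := le_self_pow₀ hx1 (by norm_num)
        have := mul_le_mul_of_nonneg_left this (show 0 ≤ c / 2 by positivity)
        linarith
      have h6 : 1 ≤ x m ^ 4 := one_le_pow₀ hx1
      calc (2 * x m ^ 4 + 1) * (x m ^ 4 + 1) * Real.exp (-(c / 2 * x m ^ 2)) * (x m * 2)
          ≤ (2 * x m ^ 4 + x m ^ 4) * (x m ^ 4 + x m ^ 4) * Real.exp (-(c / 2 * x m)) *
            (x m * 2) := by gcongr
        _ = 12 * (x m ^ 9 * Real.exp (-(c / 2 * x m))) := by ring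
        _ ≤ 1 := h3.le
  · have hk1 := hxpos k hk
    have hk0 : 0 < x k := by linarith
    have hc4 : 0 < 1 - c / 4 := by linarith
    have hxk : x k ≤ (1 - c / 4) * x m := by
      rw [hx k, Real.sqrt_le_iff]
      refine ⟨mul_nonneg hc4.le (by rw [hx]; positivity), ?_⟩
      rw [Real.sqrt_le_iff]
      refine ⟨by positivity, ?_⟩
      rw [← pow_mul, mul_pow, hx4]
      refine hkm.trans (mul_le_mul_of_nonneg_right ?_ (by positivity))
      have := one_add_mul_le_pow (a := -(c / 4)) (by linarith) 4
      norm_num at this ⊢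
      rw [← sub_eq_add_neg] at this
      linarith
    have hm0 : 0 < x m := (mul_pos_iff_of_pos_left hc4).1 (hk0.trans_le hxk)
    have h2 : ((1 - c / 4) * x m)⁻¹ ≤ (x k)⁻¹ := inv_anti₀ hk0 hxk
    have h3 : (1 + c / 4) * (x m)⁻¹ ≤ ((1 - c / 4) * x m)⁻¹ := by
      rw [mul_inv]
      refine mul_le_mul_of_nonneg_right ?_ (by positivity)
      rw [← one_div, le_div_iff₀ hc4]
      nlinarith [sq_nonneg (c / 4)]
    calc 4 / c * (x m)⁻¹ + (x m)⁻¹ = 4 / c * ((1 + c / 4) * (x m)⁻¹) := by field_simp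
      _ ≤ 4 / c * (x k)⁻¹ := by
        gcongr
        exact h3.trans h2

variable {α β : Type}

/-- Most splittings of `U` preserve the degree condition on both sides. -/
theorem DiracOn.exists_splits {G : SimpleGraph β} {δ g : ℝ} {U D : Finset β} (hG : DiracOn G δ U)
    (hg : 0 ≤ g) (hDU : D ⊆ U) (hD : (1 / 2 + δ) * #U ≤ #D) {k : ℕ} (hk : 2 * k ≤ #U) :
    ∃ 𝒲 ⊆ powersetCard k U,
      (1 - (2 * (#U : ℝ) + 1) * (#U + 1) * Real.exp (-(g ^ 2 * k / 2))) * (#U).choose k ≤ #𝒲 ∧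
      ∀ W ∈ 𝒲, (∀ v ∈ U, (1 / 2 + (δ - g)) * k ≤ #(nbrsIn G v W)) ∧
        (∀ v ∈ U, (1 / 2 + (δ - g)) * (#U - k) ≤ #(nbrsIn G v (U \ W))) ∧
        (1 / 2 + (δ - g)) * (#U - k) ≤ #(D \ W) := by
  set 𝒲 := {W ∈ powersetCard k U | (∀ v ∈ U, (1 / 2 + (δ - g)) * k ≤ #(nbrsIn G v W)) ∧
        (∀ v ∈ U, (1 / 2 + (δ - g)) * (#U - k) ≤ #(nbrsIn G v (U \ W))) ∧
        (1 / 2 + (δ - g)) * (#U - k) ≤ #(D \ W)}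
  obtain ⟨I, hI⟩ : ∃ I, I = U.image (fun v => nbrsIn G v U) ∪
    (U.image (fun v => U \ nbrsIn G v U) ∪ {U \ D}) := ⟨_, rfl⟩
  have hIU : ∀ A ∈ I, A ⊆ U := by
    intro A hA
    rw [hI] at hA
    simp only [mem_union, mem_image, mem_singleton] at hA
    rcases hA with ⟨v, -, rfl⟩ | ⟨v, -, rfl⟩ | rfl
    · exact nbrsIn_subset _ _ _
    · exact sdiff_subset
    · exact sdiff_subset
  have hIc : (#I : ℝ) ≤ 2 * #U + 1 := by
    have : #I ≤ #U + (#U + 1) := by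
      rw [hI]
      refine (card_union_le _ _).trans (add_le_add card_image_le ?_)
      exact (card_union_le _ _).trans (add_le_add card_image_le (card_singleton _).le)
    have : (#I : ℝ) ≤ #U + (#U + 1) := by exact_mod_cast this
    linarith
  refine ⟨𝒲, filter_subset _ _, ?_, fun W hW => (mem_filter.1 hW).2⟩
  have h1 := card_filter_exists_inter_lt_le I U (fun A => A) hIU k (by omega) g hg
  have h2 : powersetCard k U ⊆ 𝒲 ∪ {W ∈ powersetCard k U |
      ∃ A ∈ I, (#(A ∩ W) : ℝ) < ((#A : ℝ) / #U - g) * k} := by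
    intro W hW
    by_contra hcon
    rw [mem_union, not_or] at hcon
    have hprop : ∀ A ∈ I, ((#A : ℝ) / #U - g) * k ≤ #(A ∩ W) := by
      intro A hA
      by_contra h
      exact hcon.2 (mem_filter.2 ⟨hW, A, hA, not_le.1 h⟩)
    obtain ⟨hWU, hWk⟩ := mem_powersetCard.1 hW
    have hin : ∀ B : Finset β, (1 / 2 + δ) * #U ≤ (#B : ℝ) → 0 < (#U : ℝ) →
        (1 / 2 + δ) ≤ (#B : ℝ) / #U := fun B hB hU => by rwa [le_div_iff₀ hU]
    have hkU : 2 * (k : ℝ) ≤ #U := by exact_mod_cast hk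
    have hout : ∀ B ⊆ U, (1 / 2 + δ) * #U ≤ (#B : ℝ) → U \ B ∈ I →
        (1 / 2 + (δ - g)) * (#U - k) ≤ #(B \ W) := by
      intro B hB hBc hBI
      have h3 := hprop _ hBI
      have h4 : #((U \ B) ∩ W) + #(B ∩ W) = k := by
        rw [← hWk, ← card_union_of_disjoint]
        · congr 1
          ext a
          simp only [mem_union, mem_inter, mem_sdiff]
          exact ⟨fun h => h.elim (fun h => h.2) fun h => h.2,
            fun h => by by_cases hB : a ∈ B <;> simp [h, hB, hWU h]⟩
        · rw [Finset.disjoint_left]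
          intro a ha hb
          exact (mem_sdiff.1 (mem_inter.1 ha).1).2 (mem_inter.1 hb).1
      have h5 : #(B ∩ W) + #(B \ W) = #B := card_inter_add_card_sdiff _ _
      have h6 : #(U \ B) + #B = #U := card_sdiff_add_card_eq_card hB
      have h4' : (#((U \ B) ∩ W) : ℝ) + #(B ∩ W) = k := by exact_mod_cast h4
      have h5' : (#(B ∩ W) : ℝ) + #(B \ W) = #B := by exact_mod_cast h5
      have h6' : (#(U \ B) : ℝ) + #B = #U := by exact_mod_cast h6
      rcases (Nat.cast_nonneg (α := ℝ) #U).eq_or_lt with h0 | h0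
      · have hk0 : (k : ℝ) = 0 := by
          have : (0 : ℝ) ≤ k := by positivity
          linarith
        rw [← h0, hk0]
        simp
      · have h7 := hin B hBc h0
        have h8 : (#(U \ B) : ℝ) / #U = 1 - (#B : ℝ) / #U := by
          rw [eq_sub_iff_add_eq, ← add_div, h6', div_self h0.ne']
        rw [h8] at h3
        have h9 : (#B : ℝ) = (#B : ℝ) / #U * #U := by field_simp
        have h10 : (1 / 2 + δ) * (#U - k) ≤ (#B : ℝ) / #U * (#U - k) :=
          mul_le_mul_of_nonneg_right h7 (by linarith)
        have h11 : g * k ≤ g * (#U - k) := mul_le_mul_of_nonneg_left (by linarith) hg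
        nlinarith
    refine hcon.1 (mem_filter.2 ⟨hW, fun v hv => ?_, fun v hv => ?_, ?_⟩)
    · have h3 := hprop (nbrsIn G v U) (by rw [hI]; exact mem_union_left _ (mem_image_of_mem _ hv))
      rw [nbrsIn_inter G v hWU] at h3
      refine le_trans (mul_le_mul_of_nonneg_right ?_ (by positivity)) h3
      have := hin _ (hG v hv) (by exact_mod_cast card_pos.2 ⟨v, hv⟩)
      linarith
    · have h3 := hout (nbrsIn G v U) (nbrsIn_subset _ _ _) (hG v hv) (by
        rw [hI]
        exact mem_union_right _ (mem_union_left _ (mem_image_of_mem _ hv)))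
      refine h3.trans ?_
      have : nbrsIn G v U \ W ⊆ nbrsIn G v (U \ W) := fun a ha => by
        obtain ⟨h4, h5⟩ := mem_sdiff.1 ha
        obtain ⟨h6, h7⟩ := mem_nbrsIn.1 h4
        exact mem_nbrsIn.2 ⟨mem_sdiff.2 ⟨h6, h5⟩, h7⟩
      exact_mod_cast card_le_card this
    · exact hout D hDU hD (by rw [hI]; simp)
  have h3 : ((#U).choose k : ℝ) ≤ #𝒲 + #{W ∈ powersetCard k U |
      ∃ A ∈ I, (#(A ∩ W) : ℝ) < ((#A : ℝ) / #U - g) * k} := by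
    rw [← card_powersetCard]
    exact_mod_cast (card_le_card h2).trans (card_union_le _ _)
  have h4 : (#I : ℝ) * ((#U + 1) * Real.exp (-(g ^ 2 * k / 2))) * (#U).choose k ≤
      (2 * #U + 1) * ((#U + 1) * Real.exp (-(g ^ 2 * k / 2))) * (#U).choose k := by
    gcongr
  linarith

set_option maxHeartbeats 1000000 in
/-- A graph with minimum degree well above half its order has a vertex-spread distribution on the
embeddings of any spanning tree of bounded degree. -/
theorem exists_isSpreadEmb (Δ : ℕ) (hΔ1 : 1 ≤ Δ) (δ : ℝ) (hδ : 0 < δ) (hδ1 : δ ≤ 1 / 2) :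
    ∃ A : ℝ, 0 < A ∧ ∃ K : ℕ, ∀ (α β : Type) [Fintype α] [Fintype β] (π : α → α) (d : α → ℕ),
      (∀ i, #{j | π j = i} ≤ Δ) → ∀ (G : SimpleGraph β) (U : Finset β), DiracOn G δ U →
      K ≤ #U → ∀ (S : Finset α) (r : α), IsSubtree π d S r → #S = #U →
      ∀ D ⊆ U, (1 / 2 + δ) * #U ≤ (#D : ℝ) → ∃ μ, IsSpreadEmb G π S r U D A μ := by
  have hΔ0 : (1 : ℝ) ≤ Δ := by exact_mod_cast hΔ1
  obtain ⟨c, hc⟩ : ∃ c, c = 1 / (8 * (Δ : ℝ)) := ⟨_, rfl⟩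
  have hc0 : 0 < c := by rw [hc]; positivity
  have hc1 : c ≤ 1 / 8 := by
    rw [hc]
    exact one_div_le_one_div_of_le (by norm_num) (by linarith)
  obtain ⟨K₁, hK₁⟩ := exists_isTreeEmb_spanning Δ hΔ1 (δ / 2) (by positivity) (by linarith)
  obtain ⟨g, h, K₂, hK₂, hrec⟩ := exists_sampling_rate c (δ / 2) hc0 (by linarith)
    (by positivity)
  obtain ⟨K, hK⟩ : ∃ K, K = K₁ + K₂ + 1 := ⟨_, rfl⟩
  obtain ⟨A, hA⟩ : ∃ A : ℕ → ℝ, ∀ m, A m = 8 * Δ * K * Real.exp 1 * Real.exp (-h m) :=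
    ⟨_, fun _ => rfl⟩
  have hK0 : (1 : ℝ) ≤ K := by exact_mod_cast (by omega : 1 ≤ K)
  have hApos : ∀ m, 0 < A m := fun m => by rw [hA]; positivity
  refine ⟨8 * Δ * K * Real.exp 1, by positivity, K, fun α β _ _ π d hΔ G U hG hKU S r hS hSU D hDU
    hD => ?_⟩
  suffices hmain : ∀ m, K ≤ m → ∀ (U : Finset β), #U = m → DiracOn G (δ - h m) U →
      ∀ (S : Finset α) (r : α), IsSubtree π d S r → #S = #U → ∀ D ⊆ U,
      (1 / 2 + (δ - h m)) * #U ≤ (#D : ℝ) → ∃ μ, IsSpreadEmb G π S r U D (A m) μ by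
    have h0 := (hK₂ #U (by omega)).2.2.1
    have h1 : ∀ a b : ℝ, (1 / 2 + δ) * a ≤ b → 0 ≤ a → (1 / 2 + (δ - h #U)) * a ≤ b := by
      intro a b hab ha
      have := mul_nonneg h0 ha
      linarith
    obtain ⟨μ, hμ⟩ := hmain #U hKU U rfl (fun v hv => h1 _ _ (hG v hv) (by positivity)) S r hS hSU
      D hDU (h1 _ _ hD (by positivity))
    refine ⟨μ, hμ.mono (hApos _).le ?_⟩
    rw [hA]
    refine mul_le_of_le_one_right (by positivity) ?_
    rw [Real.exp_le_one_iff]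
    linarith
  clear! U S D
  intro m
  induction m using Nat.strong_induction_on with
  | _ m ih =>
    intro hKm U hU hG S r hS hSU D hDU hD
    obtain ⟨hg0, hg1, hh0, hhδ, hexp⟩ := hK₂ m (by omega)
    by_cases hm : m ≤ 8 * Δ * K
    · have h1 : ∀ a b : ℝ, (1 / 2 + (δ - h m)) * a ≤ b → 0 ≤ a → (1 / 2 + δ / 2) * a ≤ b := by
        intro a b hab ha
        nlinarith
      obtain ⟨φ, hφ, hφr⟩ := hK₁ α β π d hΔ G U (fun v hv => h1 _ _ (hG v hv) (by positivity))
        (by omega) S r hS hSU D hDU (h1 _ _ hD (by positivity))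
      refine hφ.exists_isSpreadEmb hφr ?_
      have h2 : (m : ℝ) ≤ 8 * Δ * K := by exact_mod_cast hm
      rw [hU, hA, mul_assoc _ (Real.exp 1), ← Real.exp_add]
      refine h2.trans (le_mul_of_one_le_right (by positivity) ?_)
      rw [Real.one_le_exp_iff]
      linarith
    · push Not at hm
      obtain ⟨t, ht⟩ : ∃ t, t = m / (4 * Δ) := ⟨_, rfl⟩
      have hm8 : 8 * Δ ≤ m := by nlinarith
      have ht2 : 2 ≤ t := by
        rw [ht, Nat.le_div_iff_mul_le (by omega)]
        linarith
      have ht4 : 4 * Δ * t ≤ m := by rw [ht]; exact Nat.mul_div_le _ _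
      have htm : m < 4 * Δ * (t + 1) := by rw [ht]; exact Nat.lt_mul_div_succ _ (by omega)
      have htm' : m ≤ 8 * Δ * t := by nlinarith
      obtain ⟨x, hxS, hxr, hxt, hxle⟩ := hS.exists_branch (t := t) hΔ hΔ1 (by omega) (by
        rw [hSU, hU]
        nlinarith)
      obtain ⟨k, hk⟩ : ∃ k, k = #(branch π d S x) := ⟨_, rfl⟩
      rw [← hk] at hxt hxle
      have hkm : 4 * k ≤ m := by linarith
      have hmk : m ≤ 8 * Δ * k := htm'.trans (by gcongr)
      have hKk : K ≤ k := by
        by_contra hlt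
        have : 8 * Δ * k ≤ 8 * Δ * K := by gcongr; omega
        omega
      have hkm' : 4 * (k : ℝ) ≤ m := by exact_mod_cast hkm
      have hcm : c * m ≤ k := by
        rw [hc, div_mul_eq_mul_div, one_mul, div_le_iff₀' (by positivity)]
        exact_mod_cast hmk
      have hm0 : (0 : ℝ) ≤ m := by positivity
      have hr1 := hrec m k (by omega) (by nlinarith)
      have hr2 := hrec m (m - k) (by omega) (by
        rw [Nat.cast_sub (by omega)]
        linarith)
      obtain ⟨𝒲, h𝒲, hgood, hW𝒲⟩ := hG.exists_splits hg0.le hDU hD (k := k) (by omega)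
      have hAk : ∀ k, h m + g m ≤ h k → A k ≤ A m * Real.exp (-g m) := by
        intro k hk
        rw [hA, hA, mul_assoc _ (Real.exp (-h m)), ← Real.exp_add]
        gcongr
        linarith
      have hmono : ∀ k a : ℕ, h m + g m ≤ h k → ∀ b : ℝ, (1 / 2 + (δ - h m - g m)) * a ≤ b →
          (1 / 2 + (δ - h k)) * a ≤ b := by
        intro k a hk b hab
        refine le_trans (mul_le_mul_of_nonneg_right ?_ (by positivity)) hab
        linarith
      have hBk : #(S \ branch π d S x) = m - k := by
        rw [card_sdiff_of_subset (branch_subset x), ← hk, hSU, hU]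
      have hWk : ∀ W ∈ 𝒲, W ⊆ U ∧ #W = k ∧ #(U \ W) = m - k := by
        intro W hW
        obtain ⟨h1, h2⟩ := mem_powersetCard.1 (h𝒲 hW)
        exact ⟨h1, h2, by rw [card_sdiff_of_subset h1, h2, hU]⟩
      have hsub : (#U : ℝ) - k = (m - k : ℕ) := by rw [hU, Nat.cast_sub (by omega)]
      refine exists_isSpreadEmb_glue hS hxS hxr hSU (A' := A m * Real.exp (-g m))
        (θ := g m / 2) (by linarith) (by linarith) (by have := hApos m; positivity) ?_ 𝒲
        (by rwa [← hk]) ?_ (fun W hW => ?_) fun W hW a ha => ?_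
      · rw [mul_comm]
        refine mul_le_mul_of_nonneg_right ?_ (hApos m).le
        have h1 := Real.add_one_le_exp (g m)
        rw [Real.exp_neg, inv_le_iff_one_le_mul₀ (Real.exp_pos _)]
        nlinarith
      · rw [← hk]
        refine le_trans (mul_le_mul_of_nonneg_right ?_ (by positivity)) hgood
        rw [hU]
        have h1 : Real.exp (-(g m ^ 2 * k / 2)) ≤ Real.exp (-(g m ^ 2 * (c * m) / 2)) := by
          refine Real.exp_le_exp.2 (neg_le_neg ?_)
          gcongr
        have h2 : (2 * (m : ℝ) + 1) * (m + 1) * Real.exp (-(g m ^ 2 * k / 2)) ≤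
            (2 * (m : ℝ) + 1) * (m + 1) * Real.exp (-(g m ^ 2 * (c * m) / 2)) :=
          mul_le_mul_of_nonneg_left h1 (by positivity)
        linarith
      · obtain ⟨hWU, hW1, hW2⟩ := hWk W hW
        obtain ⟨-, h3, h4⟩ := hW𝒲 W hW
        rw [hsub] at h3 h4
        obtain ⟨μ, hμ⟩ := ih (m - k) (by omega) (by omega) (U \ W) hW2 (fun v hv => by
          rw [hW2]
          exact hmono _ _ hr2 _ (h3 v (mem_sdiff.1 hv).1)) _ r (hS.sdiff_branch hxS hxr)
          (by rw [hBk, hW2]) (D \ W) (sdiff_subset_sdiff hDU le_rfl) (by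
            rw [hW2]
            exact hmono _ _ hr2 _ h4)
        exact ⟨μ, hμ.mono (hApos _).le (hAk _ hr2)⟩
      · obtain ⟨hWU, hW1, hW2⟩ := hWk W hW
        obtain ⟨h3, -, -⟩ := hW𝒲 W hW
        obtain ⟨μ, hμ⟩ := ih k (by omega) (by omega) W hW1 (fun v hv => by
          rw [hW1]
          exact hmono _ _ hr1 _ (h3 v (hWU hv))) _ x (hS.branch hxS)
          (by rw [← hk, hW1]) (nbrsIn G a W) (nbrsIn_subset _ _ _) (by
            rw [hW1]
            exact hmono _ _ hr1 _ (h3 a ha))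
        exact ⟨μ, hμ.mono (hApos _).le (hAk _ hr1)⟩

end VertexSpreadInduction

section EdgeSpread

theorem pow_le_exp_mul_descFactorial (n s : ℕ) (h : s ≤ n) :
    (n : ℝ) ^ s ≤ Real.exp 1 ^ s * n.descFactorial s := by
  induction n generalizing s with
  | zero => simp [Nat.le_zero.1 h]
  | succ n ih =>
    cases s with
    | zero => simp
    | succ s =>
      rw [Nat.succ_descFactorial_succ]
      have hs : s ≤ n := by omega
      rcases Nat.eq_zero_or_pos n with rfl | hn
      · obtain rfl : s = 0 := by omega
        simp
      have hn0 : (0 : ℝ) < n := by exact_mod_cast hn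
      have h1 : ((n : ℝ) + 1) ^ s ≤ Real.exp 1 * (n : ℝ) ^ s := by
        have h2 : (n : ℝ) + 1 ≤ Real.exp (1 / n) * n := by
          have := Real.add_one_le_exp (1 / (n : ℝ))
          calc (n : ℝ) + 1 = (1 / n + 1) * n := by field_simp; ring
            _ ≤ _ := by gcongr
        calc ((n : ℝ) + 1) ^ s ≤ (Real.exp (1 / n) * n) ^ s := by gcongr
          _ = Real.exp (s * (1 / n)) * (n : ℝ) ^ s := by rw [mul_pow, ← Real.exp_nat_mul]
          _ ≤ _ := by
            gcongr
            rw [mul_one_div, div_le_one hn0]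
            exact_mod_cast hs
      push_cast
      calc ((n : ℝ) + 1) ^ (s + 1) = (n + 1) * (n + 1) ^ s := by ring
        _ ≤ (n + 1) * (Real.exp 1 * (Real.exp 1 ^ s * n.descFactorial s)) := by
          gcongr
          exact h1.trans (by gcongr; exact ih s hs)
        _ = _ := by ring

variable {α β : Type} [Fintype α]

/-- The maps sending the parent edges of `I` to pairs in a relation `R` of degree at most `D`
form at most a `(D / n) ^ #I` fraction of all maps. -/
theorem card_hom_le {π : α → α} {d : α → ℕ} {R : α → α → Prop} {D : ℕ}
    (hR : ∀ y, #{x | R x y} ≤ D) (I : Finset α) (hI : ∀ i ∈ I, d i = d (π i) + 1) :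
    (Fintype.card α : ℝ) ^ #I * (∑ θ : α → α, if ∀ i ∈ I, R (θ i) (θ (π i)) then (1 : ℝ) else 0) ≤
      (D : ℝ) ^ #I * (Fintype.card α : ℝ) ^ Fintype.card α := by
  induction I using Finset.induction_on_max_value d with
  | empty => simp
  | insert i I hi hmax ih =>
    have hα : Nonempty α := ⟨i⟩
    have hn : (0 : ℝ) < Fintype.card α := by exact_mod_cast Fintype.card_pos
    have ih := ih fun j hj => hI j (mem_insert_of_mem hj)
    have hπ : π i ≠ i := fun h => by
      have := hI i (mem_insert_self _ _)
      rw [h] at this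
      omega
    have hne : ∀ j ∈ I, π j ≠ i := fun j hj h => by
      have h1 := hI j (mem_insert_of_mem hj)
      have h2 := hmax j hj
      rw [h] at h1
      omega
    have key : ∑ a : α, ∑ θ : α → α,
        (if ∀ j ∈ insert i I, R (Function.update θ i a j) (Function.update θ i a (π j))
          then (1 : ℝ) else 0) ≤
        D * ∑ θ : α → α, if ∀ j ∈ I, R (θ j) (θ (π j)) then (1 : ℝ) else 0 := by
      rw [sum_comm, mul_sum]
      refine sum_le_sum fun θ _ => ?_
      by_cases h : ∀ j ∈ I, R (θ j) (θ (π j))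
      · rw [if_pos h, mul_one]
        refine le_trans (sum_le_sum (g := fun a => if R a (θ (π i)) then (1 : ℝ) else 0)
          fun a _ => ?_) ?_
        · by_cases ha : R a (θ (π i))
          · rw [if_pos ha]
            split_ifs <;> norm_num
          · rw [if_neg ha, if_neg fun h' => ha ?_]
            simpa [hπ] using h' i (mem_insert_self _ _)
        · rw [sum_boole]
          exact_mod_cast hR _
      · rw [if_neg h, mul_zero]
        refine sum_nonpos fun a _ => ?_
        rw [if_neg fun h' => h fun j hj => ?_]
        have h1 := h' j (mem_insert_of_mem hj)
        rwa [Function.update_of_ne (fun h2 : j = i => hi (h2 ▸ hj)),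
          Function.update_of_ne (hne j hj)] at h1
    rw [card_insert_of_notMem hi, sum_eq_sum_update i, pow_succ, pow_succ]
    calc _ = (Fintype.card α : ℝ) ^ #I * (∑ a : α, ∑ θ : α → α,
        (if ∀ j ∈ insert i I, R (Function.update θ i a j) (Function.update θ i a (π j))
          then (1 : ℝ) else 0)) := by
          field_simp
      _ ≤ (Fintype.card α : ℝ) ^ #I *
          (D * ∑ θ : α → α, if ∀ j ∈ I, R (θ j) (θ (π j)) then (1 : ℝ) else 0) := by gcongr
      _ = D * ((Fintype.card α : ℝ) ^ #I *
          ∑ θ : α → α, if ∀ j ∈ I, R (θ j) (θ (π j)) then (1 : ℝ) else 0) := by ring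
      _ ≤ D * ((D : ℝ) ^ #I * (Fintype.card α : ℝ) ^ Fintype.card α) := by gcongr
      _ = _ := by ring

/-- A uniformly random permutation takes prescribed values on `I` with probability at most
`1 / q (q - 1) ⋯ (q - #I + 1)`. -/
theorem card_perm_prescribed_le {K : Type} [Fintype K] (I : Finset K) (y : K → K) :
    (Fintype.card K).descFactorial #I * #{σ : Equiv.Perm K | ∀ i ∈ I, σ i = y i} ≤
      Fintype.card (Equiv.Perm K) := by
  induction I using Finset.induction_on with
  | empty => simp
  | insert i I hi ih =>
    rw [card_insert_of_notMem hi, Nat.descFactorial_succ]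
    refine le_trans ?_ ih
    rw [mul_comm (_ - _), mul_assoc]
    refine Nat.mul_le_mul_left _ ?_
    by_cases hy : y i ∈ I.image y
    · obtain ⟨j, hj, hji⟩ := mem_image.1 hy
      rw [filter_eq_empty_iff.2, card_empty, mul_zero]
      · exact Nat.zero_le _
      intro σ _ h
      have h1 := h i (mem_insert_self _ _)
      rw [← hji, ← h j (mem_insert_of_mem hj)] at h1
      exact hi (σ.injective h1 ▸ hj)
    · have hc : Fintype.card K - #I ≤ #(univ \ I.image y) := by
        rw [card_sdiff_of_subset (subset_univ _), card_univ]
        exact Nat.sub_le_sub_left card_image_le _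
      refine (Nat.mul_le_mul_right _ hc).trans ?_
      rw [← card_product]
      refine card_le_card_of_injOn (fun x => Equiv.swap (y i) x.1 * x.2) ?_ ?_
      · rintro ⟨c, σ⟩ h
        simp only [coe_product, Set.mem_prod, mem_coe, mem_sdiff, mem_univ, true_and, mem_filter,
          mem_image, not_exists, not_and] at h ⊢
        intro j hj
        rw [Equiv.Perm.mul_apply, h.2 j (mem_insert_of_mem hj)]
        exact Equiv.swap_apply_of_ne_of_ne (fun h' => hy (mem_image.2 ⟨j, hj, h'⟩)) (h.1 j hj)
      · rintro ⟨c, σ⟩ h ⟨c', σ'⟩ h' heq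
        simp only [coe_product, Set.mem_prod, mem_coe, mem_filter, mem_univ, true_and] at h h'
        have h1 : ∀ c σ, σ i = y i → (Equiv.swap (y i) c * σ) i = c := fun c σ h => by
          rw [Equiv.Perm.mul_apply, h, Equiv.swap_apply_left]
        have h2 := h1 c σ (h.2 i (mem_insert_self _ _))
        dsimp only at heq
        rw [heq, h1 c' σ' (h'.2 i (mem_insert_self _ _))] at h2
        subst h2
        simpa using heq

end EdgeSpread

section EdgeSpread

variable {α β : Type} {G : SimpleGraph β} {π : α → α} {d : α → ℕ} {r : α}

/-- The image of the parent edge of `i` under `φ`. -/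
def parentEdge (π : α → α) (φ : α → β) (i : α) : Sym2 β := s(φ i, φ (π i))

theorem IsTreeEmb.parentEdge_injOn {S : Finset α} {U : Finset β} {φ : α → β}
    (h : IsTreeEmb G π S r U φ) (hS : IsSubtree π d S r) :
    Set.InjOn (parentEdge π φ) (S.erase r) := by
  intro i hi j hj hij
  simp only [coe_erase, Set.mem_sdiff, mem_coe, Set.mem_singleton_iff] at hi hj
  rcases Sym2.eq_iff.1 hij with ⟨h1, -⟩ | ⟨h1, h2⟩
  · exact h.inj hi.1 hj.1 h1
  · have h3 := h.inj hi.1 (hS.parent_mem j hj.1 hj.2) h1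
    have h4 := h.inj (hS.parent_mem i hi.1 hi.2) hj.1 h2
    have h5 := hS.depth_eq i hi.1 hi.2
    have h6 := hS.depth_eq j hj.1 hj.2
    rw [h4] at h5
    rw [← h3] at h6
    omega

theorem card_filter_prescribed [Fintype α] [Fintype β] (V : Finset β) (g : β → α) :
    #{ψ : β → α | ∀ w ∈ V, ψ w = g w} = Fintype.card α ^ (Fintype.card β - #V) := by
  have h : ({ψ : β → α | ∀ w ∈ V, ψ w = g w} : Finset (β → α)) =
      Fintype.piFinset fun w => if w ∈ V then {g w} else univ := by
    ext ψ
    simp only [mem_filter, mem_univ, true_and, Fintype.mem_piFinset]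
    refine forall_congr' fun w => ?_
    by_cases hw : w ∈ V <;> simp [hw]
  rw [h, Fintype.card_piFinset, ← card_compl, ← prod_const, ← prod_mul_prod_compl V,
    prod_congr rfl fun w hw => by rw [if_pos hw, card_singleton], prod_const_one, one_mul]
  exact prod_congr rfl fun w hw => by rw [if_neg (mem_compl.1 hw), card_univ]

variable [Fintype α] [Fintype β]

/-- Under a vertex-spread distribution, a set `E` of edges is contained in the image of the tree
with probability at most `(K / n) ^ #E`. -/
theorem IsSpreadEmb.sum_edges_le {D : Finset β} {A : ℝ} {μ : (α → β) → ℝ} {Δ : ℕ}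
    (hμ : IsSpreadEmb G π univ r univ D A μ) (hA : 1 ≤ A)
    (hcard : Fintype.card α = Fintype.card β) (hS : IsSubtree π d univ r)
    (hΔ : ∀ i, #{j | π j = i} ≤ Δ) (E : Finset (Sym2 β)) :
    ∑ φ with E ⊆ (univ.erase r).image (parentEdge π φ), μ φ ≤
      ((Real.exp 1 * A) ^ 2 * (Δ + 1) / Fintype.card α) ^ #E := by
  have hn : (0 : ℝ) < Fintype.card α := by exact_mod_cast Fintype.card_pos_iff.2 ⟨r⟩
  obtain ⟨n, hnα⟩ : ∃ n, n = Fintype.card α := ⟨_, rfl⟩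
  rw [← hnα] at hn ⊢
  by_cases hex : ∃ φ, 0 < μ φ ∧ E ⊆ (univ.erase r).image (parentEdge π φ)
  swap
  · rw [sum_eq_zero]
    · positivity
    intro φ hφ
    rw [mem_filter] at hφ
    exact le_antisymm (not_lt.1 fun h => hex ⟨φ, h, hφ.2⟩) (hμ.nonneg φ)
  obtain ⟨φ₀, hφ₀, hE⟩ := hex
  have hbij : ∀ φ, 0 < μ φ → Function.Bijective φ := fun φ h =>
    (Fintype.bijective_iff_injective_and_card φ).2
      ⟨fun i j hij => (hμ.emb φ h).1.inj (by simp) (by simp) hij, hcard⟩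
  obtain ⟨I, hIdef⟩ : ∃ I : Finset α, ∀ i, i ∈ I ↔ i ≠ r ∧ parentEdge π φ₀ i ∈ E :=
    ⟨({i | i ≠ r ∧ parentEdge π φ₀ i ∈ E} : Finset α), by simp⟩
  have hIE : I.image (parentEdge π φ₀) = E := by
    ext e
    rw [mem_image]
    refine ⟨fun ⟨i, hi, h⟩ => h ▸ ((hIdef i).1 hi).2, fun he => ?_⟩
    obtain ⟨i, hi, rfl⟩ := mem_image.1 (hE he)
    exact ⟨i, (hIdef i).2 ⟨(mem_erase.1 hi).1, he⟩, rfl⟩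
  have hIc : #I = #E := by
    rw [← hIE, card_image_of_injOn]
    exact ((hμ.emb φ₀ hφ₀).1.parentEdge_injOn hS).mono fun i hi => by
      simpa using ((hIdef i).1 hi).1
  obtain ⟨V, hV⟩ : ∃ V, V = I.image φ₀ ∪ I.image fun i => φ₀ (π i) := ⟨_, rfl⟩
  have hVc : #V ≤ 2 * #E := by
    rw [hV, ← hIc, two_mul]
    exact (card_union_le _ _).trans (add_le_add card_image_le card_image_le)
  have hVn : #V ≤ n := by
    rw [hnα, hcard]
    exact card_le_univ V
  have hV1 : ∀ i ∈ I, φ₀ i ∈ V := fun i hi =>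
    hV ▸ mem_union_left _ (mem_image_of_mem _ hi)
  have hV2 : ∀ i ∈ I, φ₀ (π i) ∈ V := fun i hi =>
    hV ▸ mem_union_right _ (mem_image_of_mem (fun i => φ₀ (π i)) hi)
  obtain ⟨R, hR⟩ : ∃ R : α → α → Prop, ∀ x y, R x y ↔ π x = y ∨ π y = x := ⟨_, fun _ _ => Iff.rfl⟩
  have hRD : ∀ y, #{x | R x y} ≤ Δ + 1 := fun y => by
    have : ({x | R x y} : Finset α) ⊆ ({x | π x = y} : Finset α) ∪ {π y} := by
      intro x hx
      simp only [mem_filter, mem_univ, true_and, hR, mem_union, mem_singleton] at hx ⊢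
      exact hx.imp id Eq.symm
    exact (card_le_card this).trans ((card_union_le _ _).trans (add_le_add (hΔ y) (by simp)))
  obtain ⟨hom, hhom⟩ : ∃ hom : (β → α) → Prop,
      ∀ ψ, hom ψ ↔ ∀ i ∈ I, R (ψ (φ₀ i)) (ψ (φ₀ (π i))) := ⟨_, fun _ => Iff.rfl⟩
  have hcount : (n : ℝ) ^ #E * #{ψ | hom ψ} ≤ (Δ + 1 : ℝ) ^ #E * (n : ℝ) ^ n := by
    have h1 := card_hom_le hRD I (fun i hi => hS.depth_eq i (mem_univ i) ((hIdef i).1 hi).1)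
    rw [← hnα, hIc] at h1
    push_cast at h1
    refine le_trans (le_of_eq ?_) h1
    rw [← sum_boole]
    congr 1
    refine Fintype.sum_equiv ((Equiv.ofBijective φ₀ (hbij φ₀ hφ₀)).symm.arrowCongr (Equiv.refl α))
      _ _ fun ψ => ?_
    simp [hhom]
  have hpoint : ∀ ψ : β → α, (n.descFactorial #V : ℝ) * ∑ φ with ∀ w ∈ V, φ (ψ w) = w, μ φ ≤
      A ^ #V := by
    intro ψ
    by_cases hinj : Set.InjOn ψ V
    · have h1 := hμ.spread (V.image ψ) (subset_univ _) fun i =>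
        if h : ∃ w ∈ V, ψ w = i then h.choose else φ₀ i
      rw [card_image_of_injOn hinj, card_univ, ← hcard, ← hnα] at h1
      refine le_trans (mul_le_mul_of_nonneg_left ?_ (Nat.cast_nonneg _)) h1
      refine sum_le_sum_of_subset_of_nonneg (fun φ hφ => ?_) fun φ _ _ => hμ.nonneg φ
      rw [mem_filter] at hφ ⊢
      refine ⟨mem_univ _, fun i hi => ?_⟩
      have h : ∃ w ∈ V, ψ w = i := mem_image.1 hi
      rw [dif_pos h]
      conv_lhs => rw [← h.choose_spec.2]
      exact hφ.2 _ h.choose_spec.1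
    · rw [filter_eq_empty_iff.2, sum_empty, mul_zero]
      · positivity
      exact fun φ _ h => hinj fun w hw w' hw' hww => by rw [← h w hw, hww, h w' hw']
  have hmain : (n : ℝ) ^ (n - #V) *
      ∑ φ with E ⊆ (univ.erase r).image (parentEdge π φ), μ φ ≤
      ∑ ψ with hom ψ, ∑ φ with ∀ w ∈ V, φ (ψ w) = w, μ φ := by
    simp only [sum_filter _ μ]
    rw [sum_comm, mul_sum]
    refine sum_le_sum fun φ _ => ?_
    rw [← sum_filter, sum_const, nsmul_eq_mul]
    split_ifs with h
    swap
    · rw [mul_zero]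
      exact mul_nonneg (Nat.cast_nonneg _) (hμ.nonneg φ)
    rcases (hμ.nonneg φ).eq_or_lt with h0 | h0
    · rw [← h0, mul_zero, mul_zero]
    refine mul_le_mul_of_nonneg_right ?_ h0.le
    have h1 := card_filter_prescribed V (Equiv.ofBijective φ (hbij φ h0)).symm
    rw [← hcard, ← hnα] at h1
    rw [← Nat.cast_pow, ← h1, Nat.cast_le]
    refine card_le_card fun ψ hψ => ?_
    simp only [mem_filter, mem_univ, true_and] at hψ ⊢
    have h2 : ∀ w ∈ V, φ (ψ w) = w := fun w hw => by
      rw [hψ w hw]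
      exact Equiv.ofBijective_apply_symm_apply φ _ w
    refine ⟨(hhom ψ).2 fun i hi => ?_, h2⟩
    obtain ⟨j, hj, hij⟩ := mem_image.1 (h ((hIdef i).1 hi).2)
    have h3 := (hbij φ h0).1
    have h4 := h2 _ (hV1 i hi)
    have h5 := h2 _ (hV2 i hi)
    rw [hR]
    rcases Sym2.eq_iff.1 hij with ⟨h6, h7⟩ | ⟨h6, h7⟩
    · left
      rw [h3 (h4.trans h6.symm), h3 (h5.trans h7.symm)]
    · right
      rw [h3 (h5.trans h6.symm), h3 (h4.trans h7.symm)]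
  obtain ⟨P, hP⟩ : ∃ P, P = ∑ φ with E ⊆ (univ.erase r).image (parentEdge π φ), μ φ := ⟨_, rfl⟩
  rw [← hP] at hmain ⊢
  have hP0 : 0 ≤ P := hP ▸ sum_nonneg fun φ _ => hμ.nonneg φ
  have hdf : (n.descFactorial #V : ℝ) * ((n : ℝ) ^ (n - #V) * P) ≤ #{ψ | hom ψ} * A ^ #V := by
    refine (mul_le_mul_of_nonneg_left hmain (Nat.cast_nonneg _)).trans ?_
    rw [mul_sum, ← nsmul_eq_mul]
    exact sum_le_card_nsmul _ _ _ fun ψ _ => hpoint ψ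
  have he := Real.add_one_le_exp (1 : ℝ)
  have heA : 1 ≤ Real.exp 1 * A := by nlinarith
  have hfinal : (n : ℝ) ^ #E * P * (n : ℝ) ^ n ≤
      ((Real.exp 1 * A) ^ 2 * (Δ + 1)) ^ #E * (n : ℝ) ^ n := by
    calc (n : ℝ) ^ #E * P * (n : ℝ) ^ n =
        (n : ℝ) ^ #E * ((n : ℝ) ^ #V * ((n : ℝ) ^ (n - #V) * P)) := by
          rw [← Nat.add_sub_cancel' hVn, pow_add, Nat.add_sub_cancel' hVn]
          ring
      _ ≤ (n : ℝ) ^ #E * ((Real.exp 1 ^ #V * n.descFactorial #V) * ((n : ℝ) ^ (n - #V) * P)) := by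
          gcongr
          exact pow_le_exp_mul_descFactorial n _ hVn
      _ = (n : ℝ) ^ #E * Real.exp 1 ^ #V *
          (n.descFactorial #V * ((n : ℝ) ^ (n - #V) * P)) := by ring
      _ ≤ (n : ℝ) ^ #E * Real.exp 1 ^ #V * (#{ψ | hom ψ} * A ^ #V) := by gcongr
      _ = (Real.exp 1 * A) ^ #V * ((n : ℝ) ^ #E * #{ψ | hom ψ}) := by
          rw [mul_pow]
          ring
      _ ≤ (Real.exp 1 * A) ^ (2 * #E) * ((Δ + 1 : ℝ) ^ #E * (n : ℝ) ^ n) := by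
          gcongr
      _ = _ := by
          rw [pow_mul, mul_pow _ (Δ + 1 : ℝ)]
          ring
  rw [div_pow, le_div_iff₀ (by positivity), mul_comm]
  exact le_of_mul_le_mul_right hfinal (by positivity)

end EdgeSpread

section Assembly

variable {α β K : Type} [Fintype α] {G : SimpleGraph β} {π : α → α}
  {d : α → ℕ} {r : α}

/-- The parent edges embedded by `φ`, where the edge below `i` is paired with the colour `c i`. -/
noncomputable def colouredEdges (π : α → α) (r : α) (φ : α → β) (c : α → K) :
    Finset (Sym2 β × K) :=
  (univ.erase r).image fun i => (parentEdge π φ i, c i)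

theorem mem_colouredEdges {φ : α → β} {c : α → K} {x : Sym2 β × K} :
    x ∈ colouredEdges π r φ c ↔ ∃ i, i ≠ r ∧ (parentEdge π φ i, c i) = x := by
  simp [colouredEdges]

theorem IsTreeEmb.fst_injOn_colouredEdges {U : Finset β} {φ : α → β}
    (h : IsTreeEmb G π univ r U φ) (hS : IsSubtree π d univ r) (c : α → K) :
    Set.InjOn Prod.fst (colouredEdges π r φ c : Set (Sym2 β × K)) := by
  intro x hx y hy hxy
  obtain ⟨i, hi, rfl⟩ := mem_colouredEdges.1 hx
  obtain ⟨j, hj, rfl⟩ := mem_colouredEdges.1 hy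
  rw [h.parentEdge_injOn hS (by simpa using hi) (by simpa using hj) hxy]

variable [Fintype K]

theorem IsTreeEmb.card_perm_le {U : Finset β} {φ : α → β}
    (h : IsTreeEmb G π univ r U φ) (hS : IsSubtree π d univ r) {ι : α → K}
    (hι : Set.InjOn ι {i | i ≠ r}) (Z : Finset (Sym2 β × K)) :
    (#{σ : Equiv.Perm K | Z ⊆ colouredEdges π r φ fun i => σ (ι i)} : ℝ) ≤
      (Real.exp 1 / Fintype.card K) ^ #Z * Fintype.card (Equiv.Perm K) := by
  by_cases hex : ∃ σ : Equiv.Perm K, Z ⊆ colouredEdges π r φ fun i => σ (ι i)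
  swap
  · rw [filter_eq_empty_iff.2 fun σ _ h => hex ⟨σ, h⟩, card_empty, Nat.cast_zero]
    positivity
  obtain ⟨σ₀, hσ₀⟩ := hex
  have hinj := h.parentEdge_injOn hS
  obtain ⟨I, hI⟩ : ∃ I : Finset α, ∀ i, i ∈ I ↔ i ≠ r ∧ (parentEdge π φ i, σ₀ (ι i)) ∈ Z :=
    ⟨({i | i ≠ r ∧ (parentEdge π φ i, σ₀ (ι i)) ∈ Z} : Finset α), by simp⟩
  have hIZ : #(I.image ι) = #Z := by
    rw [card_image_of_injOn (hι.mono fun i hi => ((hI i).1 hi).1)]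
    refine card_bij (fun i _ => (parentEdge π φ i, σ₀ (ι i))) (fun i hi => ((hI i).1 hi).2)
      (fun i hi j hj hij => ?_) fun x hx => ?_
    · exact hinj (by simpa using ((hI i).1 hi).1) (by simpa using ((hI j).1 hj).1)
        (Prod.mk.inj hij).1
    · obtain ⟨i, hi, rfl⟩ := mem_colouredEdges.1 (hσ₀ hx)
      exact ⟨i, (hI i).2 ⟨hi, hx⟩, rfl⟩
  have hsub : #{σ : Equiv.Perm K | Z ⊆ colouredEdges π r φ fun i => σ (ι i)} ≤
      #{σ : Equiv.Perm K | ∀ k ∈ I.image ι, σ k = σ₀ k} := by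
    refine card_le_card fun σ hσ => ?_
    simp only [mem_filter, mem_univ, true_and] at hσ ⊢
    intro k hk
    obtain ⟨i, hi, rfl⟩ := mem_image.1 hk
    obtain ⟨j, hj, hji⟩ := mem_colouredEdges.1 (hσ ((hI i).1 hi).2)
    have h1 := Prod.mk.inj hji
    obtain rfl : j = i := hinj (by simpa using hj) (by simpa using ((hI i).1 hi).1) h1.1
    exact h1.2
  have h2 := card_perm_prescribed_le (I.image ι) σ₀
  rw [hIZ] at h2
  have h3 := pow_le_exp_mul_descFactorial (Fintype.card K) #Z (hIZ ▸ card_le_univ _)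
  rcases Nat.eq_zero_or_pos (Fintype.card K) with hK | hK
  · have : #Z = 0 := Nat.le_zero.1 (hK ▸ hIZ ▸ card_le_univ _)
    rw [this, pow_zero, one_mul]
    exact_mod_cast card_le_univ _
  have hK0 : (0 : ℝ) < Fintype.card K := by exact_mod_cast hK
  rw [div_pow, div_mul_eq_mul_div, le_div_iff₀ (by positivity)]
  calc _ ≤ (#{σ : Equiv.Perm K | ∀ k ∈ I.image ι, σ k = σ₀ k} : ℝ) *
        (Real.exp 1 ^ #Z * (Fintype.card K).descFactorial #Z) := by
        gcongr
    _ = Real.exp 1 ^ #Z * ((Fintype.card K).descFactorial #Z *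
        #{σ : Equiv.Perm K | ∀ k ∈ I.image ι, σ k = σ₀ k}) := by ring
    _ ≤ _ := by
        gcongr
        exact_mod_cast h2

/-- Colouring the parent edges by a uniformly random injection turns a vertex-spread distribution
on embeddings into a spread distribution on sets of coloured edges. -/
theorem IsSpreadEmb.isSpread_colouredEdges [Fintype β] {D : Finset β} {A : ℝ} {μ : (α → β) → ℝ}
    {Δ : ℕ}
    (hμ : IsSpreadEmb G π univ r univ D A μ) (hA : 1 ≤ A)
    (hcard : Fintype.card α = Fintype.card β) (hS : IsSubtree π d univ r)
    (hΔ : ∀ i, #{j | π j = i} ≤ Δ) {ι : α → K} (hι : Set.InjOn ι {i | i ≠ r}) :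
    IsSpread (fun ω : (α → β) × Equiv.Perm K => μ ω.1 / Fintype.card (Equiv.Perm K))
      (fun ω => colouredEdges π r ω.1 fun i => ω.2 (ι i))
      ((Real.exp 1 * A) ^ 2 * (Δ + 1) / Fintype.card α * (Real.exp 1 / Fintype.card K)) := by
  intro Z
  have hN : (0 : ℝ) < Fintype.card (Equiv.Perm K) := by exact_mod_cast Fintype.card_pos
  obtain ⟨hit, hhit⟩ : ∃ hit : (α → β) → Equiv.Perm K → Prop,
      ∀ φ σ, hit φ σ ↔ Z ⊆ colouredEdges π r φ fun i => σ (ι i) := ⟨_, fun _ _ => Iff.rfl⟩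
  trans ∑ ω : (α → β) × Equiv.Perm K with hit ω.1 ω.2, μ ω.1 / Fintype.card (Equiv.Perm K)
  · refine le_of_eq (sum_congr ?_ fun _ _ => rfl)
    ext ω
    simp only [mem_filter, hhit]
  by_cases hex : ∃ φ, ∃ σ : Equiv.Perm K, 0 < μ φ ∧ Z ⊆ colouredEdges π r φ fun i => σ (ι i)
  swap
  · rw [sum_eq_zero]
    · positivity
    rintro ⟨φ, σ⟩ hω
    rw [mem_filter] at hω
    have : μ φ = 0 := le_antisymm (not_lt.1 fun h => hex ⟨φ, σ, h, (hhit _ _).1 hω.2⟩) (hμ.nonneg φ)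
    simp [this]
  obtain ⟨φ₀, σ₀, hφ₀, hZ⟩ := hex
  have hE : #(Z.image Prod.fst) = #Z :=
    card_image_of_injOn (((hμ.emb φ₀ hφ₀).1.fst_injOn_colouredEdges hS _).mono hZ)
  have h1 := hμ.sum_edges_le hA hcard hS hΔ (Z.image Prod.fst)
  rw [hE] at h1
  rw [mul_pow]
  refine le_trans ?_ (mul_le_mul_of_nonneg_right h1 (by positivity))
  rw [sum_filter, Fintype.sum_prod_type, sum_filter, sum_mul]
  refine sum_le_sum fun φ _ => ?_
  dsimp only
  rw [← sum_filter, sum_const, nsmul_eq_mul]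
  rcases (hμ.nonneg φ).eq_or_lt with h0 | h0
  · rw [← h0]
    simp
  split_ifs with h
  · have h2 := (hμ.emb φ h0).1.card_perm_le hS hι Z
    simp only [← hhit] at h2
    rw [mul_div_assoc', div_le_iff₀ hN]
    calc _ = μ φ * (#{σ | hit φ σ} : ℝ) :=
          mul_comm _ _
      _ ≤ μ φ * ((Real.exp 1 / Fintype.card K) ^ #Z * Fintype.card (Equiv.Perm K)) := by gcongr
      _ = _ := by ring
  · rw [filter_eq_empty_iff.2, card_empty]
    · simp
    intro σ _ hσ
    refine h fun e he => ?_
    obtain ⟨x, hx, rfl⟩ := mem_image.1 he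
    obtain ⟨i, hi, rfl⟩ := mem_colouredEdges.1 ((hhit _ _).1 hσ hx)
    exact mem_image_of_mem _ (by simpa using hi)

theorem IsSpread.mono_set {X Ω : Type*} [Fintype Ω] {μ : Ω → ℝ} {H H' : Ω → Finset X} {ρ : ℝ}
    (h : IsSpread μ H ρ) (hμ : ∀ ω, 0 ≤ μ ω) (hH : ∀ ω, H' ω ⊆ H ω) : IsSpread μ H' ρ := fun S =>
  (sum_le_sum_of_subset_of_nonneg (monotone_filter_right _ fun ω _ h' => h'.trans (hH ω))
    fun ω _ _ => hμ ω).trans (h S)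

/-- Containing a member of a family of sets, each of which meets every fibre of the first
projection at most once, is a subadditive event on fibres. -/
theorem fiberSubadditive_hit {E K : Type*} {ℋ : Set (Finset (E × K))}
    (hℋ : ∀ H ∈ ℋ, Set.InjOn Prod.fst (H : Set (E × K))) :
    FiberSubadditive fun W => if ∃ H ∈ ℋ, H ⊆ W then (1 : ℝ) else 0 := by
  intro e W A
  by_cases hW : ∃ H ∈ ℋ, H ⊆ W
  · have h1 : ∀ W', W ⊆ W' → ∃ H ∈ ℋ, H ⊆ W' := fun W' h =>
      let ⟨H, hH, hHW⟩ := hW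
      ⟨H, hH, hHW.trans h⟩
    simp only
    rw [if_pos hW, if_pos (h1 _ subset_union_left), sum_eq_zero, add_zero]
    intro a _
    rw [if_pos (h1 _ (subset_insert _ _)), sub_self]
  · simp only [if_neg hW, sub_zero, zero_add]
    have h0 : ∀ a ∈ A, (0 : ℝ) ≤ if ∃ H ∈ ℋ, H ⊆ insert (e, a) W then (1 : ℝ) else 0 :=
      fun a _ => by split_ifs <;> norm_num
    split_ifs with h
    swap
    · exact sum_nonneg h0
    obtain ⟨H, hH, hHW⟩ := h
    have hx : ∃ x ∈ H, x ∉ W := by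
      by_contra! hcon
      exact hW ⟨H, hH, hcon⟩
    obtain ⟨x, hx, hxW⟩ := hx
    obtain ⟨a, ha, rfl⟩ := mem_image.1 ((mem_union.1 (hHW hx)).resolve_left hxW)
    refine le_trans (le_of_eq ?_) (single_le_sum h0 ha)
    rw [if_pos]
    refine ⟨H, hH, fun y hy => ?_⟩
    by_cases hyW : y ∈ W
    · exact mem_insert_of_mem hyW
    · obtain ⟨b, -, rfl⟩ := mem_image.1 ((mem_union.1 (hHW hy)).resolve_left hyW)
      rw [hℋ H hH hx hy rfl]
      exact mem_insert_self _ _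

/-- A finite tree is given by the parent function of any of its vertices. -/
theorem SimpleGraph.IsTree.exists_parent {T : SimpleGraph α} [DecidableRel T.Adj] (hT : T.IsTree)
    (r : α) {Δ : ℕ} (hΔ : ∀ v, T.degree v ≤ Δ) : ∃ (π : α → α) (d : α → ℕ), IsSubtree π d univ r ∧
      (∀ i, #{j | π j = i} ≤ Δ + 1) ∧ ∀ e ∈ T.edgeFinset, ∃ i, i ≠ r ∧ parentEdge π id i = e := by
  have hpar : ∀ v, ∃ w, v ≠ r → T.Adj v w ∧ T.dist v r = T.dist w r + 1 := by
    intro v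
    by_cases hv : v = r
    · exact ⟨v, fun h => (h hv).elim⟩
    obtain ⟨p, hp⟩ := hT.connected.exists_walk_length_eq_dist v r
    cases p with
    | nil => exact (hv rfl).elim
    | @cons _ w _ hadj q =>
      refine ⟨w, fun _ => ⟨hadj, ?_⟩⟩
      rw [Walk.length_cons] at hp
      have h1 := dist_le q
      have h2 := hT.connected.dist_triangle (u := v) (v := w) (w := r)
      rw [dist_eq_one_iff_adj.2 hadj] at h2
      omega
  choose π hπ using hpar
  have hS : IsSubtree π (fun v => T.dist v r) univ r :=
    ⟨mem_univ _, fun _ _ _ => mem_univ _, fun i _ hi => (hπ i hi).2⟩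
  have hemb : IsTreeEmb T π univ r univ id :=
    ⟨fun _ _ => mem_univ _, fun _ _ _ _ h => h, fun i _ hi => (hπ i hi).1.symm⟩
  refine ⟨π, fun v => T.dist v r, hS, fun i => ?_, ?_⟩
  · have : ({j | π j = i} : Finset α) ⊆ insert r (T.neighborFinset i) := by
      intro j hj
      rw [mem_insert, mem_neighborFinset]
      rw [mem_filter] at hj
      by_cases h : j = r
      · exact Or.inl h
      · exact Or.inr (hj.2 ▸ (hπ j h).1.symm)
    exact (card_le_card this).trans ((card_insert_le _ _).trans
      (Nat.add_le_add_right ((T.card_neighborFinset_eq_degree i).le.trans (hΔ i)) 1))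
  · have h : (univ.erase r).image (parentEdge π id) = T.edgeFinset := by
      refine eq_of_subset_of_card_le (fun e he => ?_) ?_
      · obtain ⟨i, hi, rfl⟩ := mem_image.1 he
        rw [mem_edgeFinset]
        exact (hπ i (mem_erase.1 hi).1).1
      · rw [card_image_of_injOn (hemb.parentEdge_injOn hS), card_erase_of_mem (mem_univ _),
          card_univ, ← hT.card_edgeFinset, Nat.add_sub_cancel]
    intro e he
    rw [← h] at he
    obtain ⟨i, hi, rfl⟩ := mem_image.1 he
    exact ⟨i, (mem_erase.1 hi).1, rfl⟩

end Assembly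

/-- A bounded-degree rooted tree whose edges are coloured injectively appears in a randomly
coloured and sparsified graph of large minimum degree. -/
theorem exists_le_colouredExp (Δ : ℕ) (δ : ℝ) (hδ : 0 < δ) (hδ1 : δ ≤ 1 / 2) :
    ∃ C : ℝ, 0 < C ∧ ∀ ε : ℝ, 0 < ε → ∃ n₀ : ℕ, ∀ n : ℕ, n₀ ≤ n →
      ∀ (α β K : Type) [Fintype α] [Fintype β] [Fintype K] (π : α → α) (d : α → ℕ) (r : α)
        (G : SimpleGraph β) (E : Finset (Sym2 β)), Fintype.card α = n → Fintype.card β = n →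
        n - 1 ≤ Fintype.card K → IsSubtree π d univ r → (∀ i, #{j | π j = i} ≤ Δ + 1) →
        DiracOn G δ univ → (∀ v w, G.Adj v w → s(v, w) ∈ E) →
        0 ≤ C * Real.log n / n ∧ C * Real.log n / n ≤ 1 ∧
        1 - ε ≤ colouredExp (C * Real.log n / n) E fun W : Finset (Sym2 β × K) =>
          if ∃ φ c, IsTreeEmb G π univ r univ φ ∧ Set.InjOn c {i | i ≠ r} ∧
            colouredEdges π r φ c ⊆ W then 1 else 0 := by
  obtain ⟨A₀, hA₀, N₀, hemb⟩ := exists_isSpreadEmb (Δ + 1) (by omega) δ hδ hδ1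
  obtain ⟨A, hA⟩ : ∃ A, A = max A₀ 1 := ⟨_, rfl⟩
  have hA1 : 1 ≤ A := hA ▸ le_max_right _ _
  obtain ⟨C, hC⟩ : ∃ C, C = 200 * ((Real.exp 1 * A) ^ 2 * ((Δ + 1 : ℕ) + 1) * Real.exp 1) :=
    ⟨_, rfl⟩
  have hC0 : 0 < C := by rw [hC]; positivity
  refine ⟨C, hC0, fun ε hε => ?_⟩
  obtain ⟨r₀, hr₀⟩ := exists_le_hitProb_of_isSpread ε hε
  have hlim : ∀ᶠ n : ℕ in Filter.atTop, C * Real.log n / n ≤ 1 := by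
    have h1 := ((Real.isLittleO_log_id_atTop.comp_tendsto tendsto_natCast_atTop_atTop).def
      (inv_pos.2 hC0))
    filter_upwards [h1, Filter.eventually_ge_atTop 1] with n hn hn1
    have hn0 : (0 : ℝ) < n := by exact_mod_cast hn1
    simp only [Function.comp_apply, id, Real.norm_natCast] at hn
    rw [div_le_one hn0, ← le_inv_mul_iff₀ hC0]
    exact (le_abs_self _).trans hn
  obtain ⟨N₁, hN₁⟩ := Filter.eventually_atTop.1 hlim
  refine ⟨max (max r₀ N₀) (max N₁ 2),
    fun n hn α β K _ _ _ π d r G E hα hβ hK hS hπ hG hE => ?_⟩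
  simp only [max_le_iff] at hn
  obtain ⟨⟨hnr, hnN⟩, hnN₁, hn2⟩ := hn
  have hn0 : (0 : ℝ) < n := by exact_mod_cast (by omega : 0 < n)
  have hq0 : (0 : ℝ) < Fintype.card K := by exact_mod_cast (by omega : 0 < Fintype.card K)
  have hq1 : (1 : ℝ) ≤ Fintype.card K := by exact_mod_cast (by omega : 1 ≤ Fintype.card K)
  have : Nonempty K := Fintype.card_pos_iff.1 (by omega)
  obtain ⟨μ, hμ⟩ := hemb α β π d hπ G univ hG (by rw [card_univ]; omega) univ r hS
    (by rw [card_univ, card_univ, hα, hβ]) univ (subset_univ _) (by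
      have h2 : (0 : ℝ) ≤ #(univ : Finset β) := Nat.cast_nonneg _
      nlinarith)
  have hμ := hμ.mono hA₀.le (hA ▸ le_max_left _ _ : A₀ ≤ A)
  obtain ⟨ι, hι⟩ : ∃ ι : α → K, Set.InjOn ι {i | i ≠ r} := by
    obtain ⟨f⟩ : Nonempty ({i // i ≠ r} ↪ K) :=
      Function.Embedding.nonempty_of_card_le (by simp; omega)
    refine ⟨fun i => if h : i ≠ r then f ⟨i, h⟩ else Classical.arbitrary K,
      fun i hi j hj hij => ?_⟩
    beta_reduce at hij
    rw [dif_pos (show i ≠ r from hi), dif_pos (show j ≠ r from hj)] at hij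
    exact congrArg Subtype.val (f.injective hij)
  have hspread := hμ.isSpread_colouredEdges hA1 (hα.trans hβ.symm) hS hπ hι
  rw [hα] at hspread
  obtain ⟨U, hU⟩ : ∃ U : Finset (Sym2 β × K), U = E ×ˢ univ := ⟨_, rfl⟩
  have hp0 : 0 ≤ C * Real.log n / n := by
    have := Real.log_natCast_nonneg n
    positivity
  have hp1 := hN₁ n hnN₁
  have hHU : ∀ ω : (α → β) × Equiv.Perm (K), 0 < μ ω.1 →
      colouredEdges π r ω.1 (fun i => ω.2 (ι i)) ⊆ U := by
    intro ω hω x hx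
    obtain ⟨i, hi, rfl⟩ := mem_colouredEdges.1 hx
    rw [hU, mem_product]
    exact ⟨hE _ _ ((hμ.emb _ hω).1.adj i (mem_univ i) hi).symm, mem_univ _⟩
  have hN : (0 : ℝ) < Fintype.card (Equiv.Perm (K)) := by exact_mod_cast Fintype.card_pos
  obtain ⟨ℋ, hℋ⟩ : ∃ ℋ : Set (Finset (Sym2 β × K)), ℋ = {S | ∃ ω : (α → β) ×
      Equiv.Perm (K), 0 < μ ω.1 / Fintype.card (Equiv.Perm (K)) ∧
      colouredEdges π r ω.1 (fun i => ω.2 (ι i)) ∩ U = S} := ⟨_, rfl⟩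
  have hhit : 1 - ε ≤ hitProb (C * Real.log n / n / Fintype.card K) U ℋ := by
    rw [hℋ]
    refine hr₀ n hnr _ ((α → β) × Equiv.Perm (K)) (fun ω => μ ω.1 / Fintype.card (Equiv.Perm (K)))
      (fun ω => colouredEdges π r ω.1 (fun i => ω.2 (ι i)) ∩ U) U _ _
      (fun ω => div_nonneg (hμ.nonneg ω.1) hN.le) ?_ (fun ω => inter_subset_right) (fun ω => ?_)
      ?_ (hspread.mono_set (fun ω => div_nonneg (hμ.nonneg ω.1) hN.le) fun ω => inter_subset_left)
      ?_ ?_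
    · rw [Fintype.sum_prod_type]
      simp only [sum_const, card_univ, nsmul_eq_mul, mul_div_cancel₀ _ hN.ne', hμ.sum_eq_one]
    · refine (card_le_card inter_subset_left).trans (card_image_le.trans ?_)
      exact (card_le_univ _).trans hα.le
    · positivity
    · rw [div_le_one hq0]
      exact hp1.trans hq1
    · rw [hC]
      refine le_of_eq ?_
      field_simp
  have hmem : ∀ S ∈ ℋ, ∃ φ : α → β, ∃ c : α → K, IsTreeEmb G π univ r univ φ ∧
      Set.InjOn c {i | i ≠ r} ∧ S = colouredEdges π r φ c := by
    intro S hSℋ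
    rw [hℋ] at hSℋ
    obtain ⟨ω, hω, rfl⟩ := hSℋ
    have hω := (div_pos_iff_of_pos_right hN).1 hω
    exact ⟨ω.1, fun i => ω.2 (ι i), (hμ.emb _ hω).1, fun i hi j hj h => hι hi hj (ω.2.injective h),
      inter_eq_left.2 (hHU ω hω)⟩
  have hcol := subsetExp_le_colouredExp (K := K) hp0 hp1 E _
    (fiberSubadditive_hit (ℋ := ℋ) fun S hSℋ => by
      obtain ⟨φ, c, hφ, -, rfl⟩ := hmem S hSℋ
      exact hφ.fst_injOn_colouredEdges hS c)
  rw [← hU] at hcol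
  refine ⟨hp0, hp1, hhit.trans (hcol.trans ?_)⟩
  refine subsetExp_mono hp0 hp1 _ fun R _ => mul_le_mul_of_nonneg_left
    (sum_le_sum fun c _ => ?_) (by positivity)
  beta_reduce
  split_ifs with h1 h2
  · exact le_rfl
  · obtain ⟨S, hSℋ, hSR⟩ := h1
    obtain ⟨φ, σ, hφ, hσ, rfl⟩ := hmem S hSℋ
    exact (h2 ⟨φ, σ, hφ, hσ, hSR⟩).elim
  · norm_num
  · exact le_rfl

/-- For every `Δ ∈ ℕ` and `δ > 0` there is `C = C(Δ,δ) > 0` such that, uniformly over all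
`n`-vertex graphs `G` with minimum degree at least `(1/2+δ)n` and all `n`-vertex trees `T`
with maximum degree at most `Δ`: if the edges of `G` are colored independently and
uniformly at random with `q ≥ n-1` colors, then `G_{C log n / n}` contains a rainbow copy
of `T` with probability tending to `1` as `n → ∞`. -/
theorem rainbow_spanning_tree (Δ : ℕ) (δ : ℝ) (hδ : 0 < δ) :
    ∃ C : ℝ, 0 < C ∧ ∀ ε : ℝ, 0 < ε → ∃ n₀ : ℕ, ∀ n : ℕ, n₀ ≤ n →
      ∀ (G T : SimpleGraph (Fin n)) [DecidableRel G.Adj] [DecidableRel T.Adj],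
        (∀ v : Fin n, ((1 : ℝ) / 2 + δ) * (n : ℝ) ≤ (G.degree v : ℝ)) →
        T.IsTree → (∀ v : Fin n, T.degree v ≤ Δ) →
        ∀ qc : ℕ, n - 1 ≤ qc →
          1 - ε ≤ rainbowTreeProb n qc (C * Real.log n / n) G T := by
  obtain ⟨C, hC0, hC⟩ := exists_le_colouredExp Δ (min δ (1 / 2)) (lt_min hδ (by norm_num))
    (min_le_right _ _)
  refine ⟨C, hC0, fun ε hε => ?_⟩
  obtain ⟨n₀, hn₀⟩ := hC ε hε
  refine ⟨max n₀ 1, fun n hn G T _ _ hG hT hTΔ qc hqc => ?_⟩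
  obtain ⟨r, -⟩ : ∃ r : Fin n, r.val = 0 := ⟨⟨0, (le_max_right _ _).trans hn⟩, rfl⟩
  obtain ⟨π, d, hS, hπ, hedge⟩ := hT.exists_parent r hTΔ
  have hDirac : DiracOn G (min δ (1 / 2)) univ := fun v _ => by
    have h1 : #(nbrsIn G v univ) = G.degree v := by
      rw [← card_neighborFinset_eq_degree]
      congr 1
      ext w
      simp [mem_nbrsIn]
    rw [h1, card_univ, Fintype.card_fin]
    refine le_trans ?_ (hG v)
    gcongr
    exact min_le_left _ _
  obtain ⟨hp0, hp1, hcol⟩ := hn₀ n ((le_max_left _ _).trans hn) (Fin n) (Fin n) (Fin qc) π d r G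
    G.edgeFinset (Fintype.card_fin n) (Fintype.card_fin n) (by rwa [Fintype.card_fin]) hS
    (fun i => by convert hπ i) hDirac fun v w h => mem_edgeFinset.2 h
  refine hcol.trans ?_
  rw [colouredExp_eq_sum, Fintype.card_fin]
  unfold rainbowTreeProb
  refine sum_le_sum fun R hR => sum_le_sum fun c _ => mul_le_mul_of_nonneg_left ?_
    (mul_nonneg (mul_nonneg (pow_nonneg hp0 _) (pow_nonneg (by linarith) _)) (by positivity))
  split_ifs with h1 h2
  · exact le_rfl
  · refine (h2 ?_).elim
    obtain ⟨φ, σ, hφ, hσ, hSR⟩ := h1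
    have hmap : ∀ i, i ≠ r → parentEdge π φ i ∈ R ∧ c (parentEdge π φ i) = σ i := by
      intro i hi
      obtain ⟨e, he, heq⟩ := mem_image.1 (hSR (mem_colouredEdges.2 ⟨i, hi, rfl⟩))
      obtain ⟨rfl, h3⟩ := Prod.mk.inj heq
      exact ⟨he, h3⟩
    refine ⟨φ, fun i j hij => hφ.inj (by simp) (by simp) hij, fun e he => ?_,
      fun e₁ he₁ e₂ he₂ hc => ?_⟩
    · obtain ⟨i, hi, rfl⟩ := hedge e he
      exact (hmap i hi).1
    · obtain ⟨i, hi, rfl⟩ := hedge e₁ he₁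
      obtain ⟨j, hj, rfl⟩ := hedge e₂ he₂
      rw [hσ hi hj ((hmap i hi).2.symm.trans (hc.trans (hmap j hj).2))]
  · norm_num
  · exact le_rfl
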